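/- Let K be a global function field of characteristic different from 2, i.e. a finite extension of 𝔽_q(t) where q is odd. Then the set {(a₁, a₂) ∈ K² : the equation a₁x₁² + a₂x₂² = 0 has only the trivial solution x₁ = x₂ = 0 in K} is diophantine over K. -/

import Mathlib

/-- A subset `S ⊆ K^ι` is diophantine over `K` if there are `m ∈ ℕ` and a polynomial
`f` in the variables `y_i` (`i : ι`) and `x_1, …, x_m` with coefficients in `K` such that
`a ∈ S` iff `f(a, x) = 0` has a solution `x ∈ K^m`. -/
def IsDiophantine {K : Type*} [Field K] {ι : Type*} [Fintype ι] (S : Set (ι → K)) : Prop :=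
  ∃ (m : ℕ) (f : MvPolynomial (ι ⊕ Fin m) K),
    ∀ a : ι → K, a ∈ S ↔ ∃ x : Fin m → K, MvPolynomial.eval (Sum.elim a x) f = 0


section
open IntermediateField Polynomial
namespace FF

/-- `X` is a function field in one variable over `F`. -/
class GFF (F X : Type*) [Field F] [Field X] [Algebra F X] : Prop where
  ess : Algebra.EssFiniteType F X
  trdeg : Algebra.trdeg F X = 1

section
variable {F X : Type*} [Field F] [Field X] [Algebra F X] [GFF F X]

theorem exists_transcendental (F X : Type*) [Field F] [Field X] [Algebra F X] [GFF F X] :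
    ∃ t : X, Transcendental F t := by
  by_contra h
  push Not at h
  have : Algebra.IsAlgebraic F X := ⟨fun x => by simpa [Transcendental] using h x⟩
  have h1 := (_root_.trdeg_eq_zero_iff (R := F) (A := X)).2 this
  rw [GFF.trdeg] at h1
  exact one_ne_zero h1

theorem fd_adjoin {z : X} (hz : Transcendental F z) : FiniteDimensional F⟮z⟯ X := by
  have hi : AlgebraicIndependent F (fun _ : PUnit => z) :=
    algebraicIndependent_unique_type_iff.2 hz
  have hb : IsTranscendenceBasis F (fun _ : PUnit => z) :=
    hi.isTranscendenceBasis_of_trdeg_le_of_finite (by simp [GFF.trdeg (F := F) (X := X)])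
  have ha := hb.isAlgebraic_field
  rw [Set.range_const] at ha
  have := GFF.ess (F := F) (X := X)
  have : Algebra.EssFiniteType F⟮z⟯ X := Algebra.EssFiniteType.of_comp F _ _
  exact Algebra.finite_of_essFiniteType_of_isAlgebraic

/-- degree of `X` over `F(z)` -/
noncomputable def dg (F : Type*) {X : Type*} [Field F] [Field X] [Algebra F X] (z : X) : ℕ :=
  Module.finrank F⟮z⟯ X

theorem polyrel0 {z : X} (hz : Transcendental F z) {ι : Type*} [Fintype ι] (u : ι → X)
    (h : dg F z < Fintype.card ι) :
    ∃ p : ι → F[X], p ≠ 0 ∧ ∑ i, aeval z (p i) * u i = 0 := by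
  have := fd_adjoin hz
  have hl : ¬ LinearIndependent F⟮z⟯ u := fun hl => by
    have := hl.fintype_card_le_finrank
    rw [dg] at h; omega
  rw [Fintype.linearIndependent_iff] at hl
  push Not at hl
  obtain ⟨g, hg, i0, hi0⟩ := hl
  have h2 : ∀ i, ∃ r s : F[X], s ≠ 0 ∧ (g i : X) * aeval z s = aeval z r := by
    intro i
    obtain ⟨r, s, h⟩ := (mem_adjoin_simple_iff F _).1 (g i).2
    by_cases hs : s = 0
    · refine ⟨0, 1, one_ne_zero, ?_⟩
      simp [h, hs]
    · refine ⟨r, s, hs, ?_⟩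
      have : aeval z s ≠ 0 := fun h0 => hs ((transcendental_iff.1 hz) s h0)
      rw [h, div_mul_cancel₀ _ this]
  choose r s hs hrs using h2
  classical
  refine ⟨fun i => r i * ∏ j ∈ Finset.univ.erase i, s j, ?_, ?_⟩
  · intro h0
    have := congrFun h0 i0
    simp only [Pi.zero_apply, mul_eq_zero, Finset.prod_eq_zero_iff] at this
    rcases this with h | ⟨j, -, h⟩
    · have := hrs i0
      rw [h, map_zero, mul_eq_zero] at this
      rcases this with h | h
      · exact hi0 (by exact_mod_cast h)
      · exact hs _ ((transcendental_iff.1 hz) _ h)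
    · exact hs _ h
  · have : ∀ i, aeval z (r i * ∏ j ∈ Finset.univ.erase i, s j) * u i =
        (aeval z (∏ j, s j)) * (g i • u i) := by
      intro i
      rw [← Finset.mul_prod_erase _ _ (Finset.mem_univ i), map_mul, map_mul, ← hrs,
        IntermediateField.smul_def, smul_eq_mul]
      ring
    rw [Finset.sum_congr rfl (fun i _ => this i), ← Finset.mul_sum, hg, mul_zero]

/-- A polynomial relation with some nonzero constant coefficient. -/
theorem polyrel {z : X} (hz : Transcendental F z) {ι : Type*} [Fintype ι] (u : ι → X)
    (h : dg F z < Fintype.card ι) :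
    ∃ p : ι → F[X], (∃ i, (p i).coeff 0 ≠ 0) ∧ ∑ i, aeval z (p i) * u i = 0 := by
  obtain ⟨p, hp, hs⟩ := polyrel0 hz u h
  have hz0 : z ≠ 0 := by rintro rfl; exact hz (isAlgebraic_zero)
  -- induct on the total degree
  induction hn : ∑ i, (p i).natDegree using Nat.strong_induction_on generalizing p with
  | _ n ih =>
    by_cases hc : ∃ i, (p i).coeff 0 ≠ 0
    · exact ⟨p, hc, hs⟩
    · push Not at hc
      have hd : ∀ i, p i = Polynomial.X * (p i).divX := fun i => by
        conv_lhs => rw [← Polynomial.X_mul_divX_add (p i), hc i]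
        simp
      refine ih _ ?_ (fun i => (p i).divX) ?_ ?_ rfl
      · rw [← hn]
        obtain ⟨i, hi⟩ := Function.ne_iff.1 hp
        refine Finset.sum_lt_sum (fun i _ => ?_) ⟨i, Finset.mem_univ _, ?_⟩
        · rw [Polynomial.natDegree_divX_eq_natDegree_tsub_one]; omega
        · rw [Polynomial.natDegree_divX_eq_natDegree_tsub_one]
          have : (p i).natDegree ≠ 0 := fun h0 => hi (by
            rw [Polynomial.eq_C_of_natDegree_eq_zero h0, hc i]; simp)
          omega
      · intro h0
        apply hp
        ext1 i
        rw [hd i, congrFun h0 i]; simp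
      · have : z * ∑ i, aeval z ((p i).divX) * u i = 0 := by
          rw [← hs, Finset.mul_sum]
          refine Finset.sum_congr rfl fun i _ => ?_
          conv_rhs => rw [hd i]
          simp; ring
        exact (mul_eq_zero.1 this).resolve_left hz0

/-- linear independence passing from reduction -/
theorem card_le_of_indep {z : X} (hz : Transcendental F z) {ι : Type*} [Fintype ι] (u : ι → X)
    (A : Subalgebra F X) (hzA : z ∈ A) (hu : ∀ i, u i ∈ A)
    (hind : ∀ c : ι → F, (∃ w ∈ A, ∑ i, c i • u i = z * w) → c = 0) :
    Fintype.card ι ≤ dg F z := by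
  by_contra! h
  obtain ⟨p, ⟨i, hi⟩, hs⟩ := polyrel hz u h
  refine hi (congrFun (hind (fun i => (p i).coeff 0) ⟨- ∑ i, aeval z (p i).divX * u i, ?_, ?_⟩) i)
  · refine neg_mem (sum_mem fun i _ => mul_mem ?_ (hu i))
    exact Algebra.adjoin_le (Set.singleton_subset_iff.2 hzA) (aeval_mem_adjoin_singleton F z)
  · rw [mul_neg, ← sub_eq_zero, sub_neg_eq_add, ← hs, Finset.mul_sum, ← Finset.sum_add_distrib]
    refine Finset.sum_congr rfl fun i _ => ?_
    have := congrArg (aeval z) (Polynomial.X_mul_divX_add (p i))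
    rw [map_add, map_mul, aeval_X, aeval_C] at this
    rw [← this, Algebra.smul_def]; ring
end
end FF
end

section
open IntermediateField Polynomial
namespace FF
section
variable {F X : Type*} [Field F] [Field X] [Algebra F X]

theorem exists_pow_eq_one [Finite F] {x : X} (hx : IsAlgebraic F x) (h0 : x ≠ 0) :
    ∃ n : ℕ, 0 < n ∧ x ^ n = 1 := by
  have : FiniteDimensional F F⟮x⟯ := adjoin.finiteDimensional hx.isIntegral
  have : Finite F⟮x⟯ := Module.finite_of_finite F
  let u : (F⟮x⟯)ˣ := Units.mk0 ⟨x, mem_adjoin_simple_self F x⟩ (by simpa [Subtype.ext_iff] using h0)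
  refine ⟨orderOf u, orderOf_pos u, ?_⟩
  have := congrArg (fun y : (F⟮x⟯)ˣ => ((y : F⟮x⟯) : X)) (pow_orderOf_eq_one u)
  simp only [Units.val_pow_eq_pow_val, SubmonoidClass.coe_pow] at this
  exact this

theorem mem_of_pow_eq_one (A : ValuationSubring X) {x : X} {n : ℕ} (hn : 0 < n) (h : x ^ n = 1) :
    x ∈ A := by
  rcases A.mem_or_inv_mem x with h' | h'
  · exact h'
  · have hx : x ≠ 0 := by rintro rfl; rw [zero_pow hn.ne'] at h; exact zero_ne_one h
    have : x = (x⁻¹) ^ (n - 1) := by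
      rw [inv_pow]
      refine eq_inv_of_mul_eq_one_left ?_
      rw [← pow_succ', Nat.sub_add_cancel hn, h]
    rw [this]
    exact pow_mem h' _

theorem mem_of_isAlgebraic [Finite F] (A : ValuationSubring X) {x : X} (hx : IsAlgebraic F x) :
    x ∈ A := by
  by_cases h0 : x = 0
  · rw [h0]; exact A.zero_mem
  · obtain ⟨n, hn, h⟩ := exists_pow_eq_one hx h0
    exact mem_of_pow_eq_one A hn h

theorem algebraMap_mem [Finite F] (A : ValuationSubring X) (c : F) : algebraMap F X c ∈ A :=
  mem_of_isAlgebraic A (isAlgebraic_algebraMap c)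

theorem transcendental_of_nonunit [Finite F] (A : ValuationSubring X) {z : X}
    (h : z⁻¹ ∉ A) : Transcendental F z := by
  intro hz'
  exact h (mem_of_isAlgebraic A (F := F) hz'.inv)

noncomputable instance instAlg [Finite F] (A : ValuationSubring X) : Algebra F A :=
  RingHom.toAlgebra
  { toFun := fun c => ⟨algebraMap F X c, algebraMap_mem A c⟩
    map_one' := by ext; simp
    map_mul' := by intros; ext; simp
    map_zero' := by ext; simp
    map_add' := by intros; ext; simp }

theorem coe_algebraMap [Finite F] (A : ValuationSubring X) (c : F) :
    ((algebraMap F A c : A) : X) = algebraMap F X c := rfl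

instance [Finite F] (A : ValuationSubring X) : IsScalarTower F A X :=
  IsScalarTower.of_algebraMap_eq (fun _ => rfl)

theorem coe_smul' [Finite F] (A : ValuationSubring X) (c : F) (a : A) :
    ((c • a : A) : X) = c • (a : X) := by
  rw [Algebra.smul_def, Algebra.smul_def]; rfl

/-- a valuation ring as a subalgebra -/
def asSub (F : Type*) {X : Type*} [Field F] [Field X] [Algebra F X] [Finite F]
    (A : ValuationSubring X) : Subalgebra F X :=
  { A.toSubring with algebraMap_mem' := algebraMap_mem A }

theorem mem_asSub [Finite F] {A : ValuationSubring X} {x : X} : x ∈ asSub F A ↔ x ∈ A := Iff.rfl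

theorem finite_quot [GFF F X] [Finite F] (A : ValuationSubring X) (z : A) (hz : (z : X) ≠ 0)
    (h : (z : X)⁻¹ ∉ A) : Module.Finite F (A ⧸ Ideal.span {z}) := by
  have ht : Transcendental F (z : X) := transcendental_of_nonunit A h
  have : Module.rank F (A ⧸ Ideal.span {z}) ≤ dg F (z : X) := by
    refine rank_le fun s hs => ?_
    choose u hu using fun i : s => Ideal.Quotient.mk_surjective (i : A ⧸ Ideal.span {z})
    rw [← Fintype.card_coe]
    refine card_le_of_indep ht (fun i => (u i : X)) (asSub F A) z.2 (fun i => (u i).2) ?_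
    rintro c ⟨w, hw, hc⟩
    rw [Fintype.linearIndependent_iff] at hs
    refine funext (hs c ?_)
    have h1 : ∑ i, c i • u i = z * ⟨w, hw⟩ := by
      apply Subtype.ext
      have : ((∑ i, c i • u i : A) : X) = ∑ i, c i • (u i : X) := by
        rw [AddSubmonoidClass.coe_finsetSum]
        exact Finset.sum_congr rfl fun i _ => coe_smul' A _ _
      rw [this, hc]; rfl
    have h2 := congrArg (Ideal.Quotient.mkₐ F (Ideal.span {z})) h1
    rw [map_sum] at h2
    have h3 : (Ideal.Quotient.mkₐ F (Ideal.span {z})) (z * ⟨w, hw⟩) = 0 := by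
      rw [Ideal.Quotient.mkₐ_eq_mk, Ideal.Quotient.eq_zero_iff_mem]
      exact Ideal.mul_mem_right _ _ (Ideal.mem_span_singleton_self z)
    rw [h3] at h2
    rw [← h2]
    refine Finset.sum_congr rfl fun i _ => ?_
    rw [map_smul, Ideal.Quotient.mkₐ_eq_mk, hu i]
  rw [← Module.rank_lt_aleph0_iff]
  exact this.trans_lt (Cardinal.natCast_lt_aleph0)

variable (F) in
theorem dvr_of_ne_top [GFF F X] [Finite F] (A : ValuationSubring X) (h : A ≠ ⊤) :
    IsDiscreteValuationRing A := by
  have : Ring.HasFiniteQuotients A := by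
    refine ⟨fun {I} hI => ?_⟩
    obtain ⟨z, hzI, hz⟩ := Submodule.exists_mem_ne_zero_of_ne_bot hI
    by_cases hu : (z : X)⁻¹ ∈ A
    · have : I = ⊤ := by
        refine Ideal.eq_top_of_isUnit_mem _ hzI (IsUnit.of_mul_eq_one ⟨_, hu⟩ ?_)
        apply Subtype.ext
        exact mul_inv_cancel₀ (by simpa using hz)
      rw [this]
      infer_instance
    · have := finite_quot (F := F) A z (by simpa using hz) hu
      have : Finite (A ⧸ Ideal.span {z}) := Module.finite_of_finite F
      have hle : Ideal.span {z} ≤ I := (Ideal.span_singleton_le_iff_mem _).2 hzI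
      exact Finite.of_surjective _ (Ideal.Quotient.factor_surjective hle)
  have hf : ¬ IsField A := by
    intro hf
    apply h
    rw [eq_top_iff]
    intro x _
    rcases A.mem_or_inv_mem x with h' | h'
    · exact h'
    · by_cases hx : x = 0
      · rw [hx]; exact A.zero_mem
      obtain ⟨y, hy⟩ := hf.mul_inv_cancel (a := (⟨_, h'⟩ : A)) (by simpa [Subtype.ext_iff] using hx)
      have := congrArg Subtype.val hy
      have h1 : x⁻¹ * (y : X) = 1 := this
      have : x = y := by
        field_simp at h1
        exact h1.symm
      rw [this]; exact y.2
  have hv : ValuationRing A := inferInstance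
  have hT := (IsDiscreteValuationRing.TFAE A hf).out 0 1
  exact hT.2 hv
end

/-- places of a field: discrete valuation subrings -/
@[ext] structure Place (X : Type*) [Field X] where
  A : ValuationSubring X
  dvr : IsDiscreteValuationRing A

attribute [instance] Place.dvr

namespace Place
variable {X : Type*} [Field X]

noncomputable def val (V : Place X) : Valuation X (WithZero (Multiplicative ℤ)) :=
  (IsDiscreteValuationRing.maximalIdeal V.A).valuation X

noncomputable def ord (V : Place X) (x : X) : ℤ := - WithZero.log (V.val x)

/-- `x = 0` or `n ≤ ord x` -/
def G (V : Place X) (n : ℤ) (x : X) : Prop := V.val x ≤ WithZero.exp (-n)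

variable (V : Place X) {x y : X} {m n : ℤ}

theorem val_ne (hx : x ≠ 0) : V.val x ≠ 0 := (Valuation.ne_zero_iff _).2 hx

theorem ord_zero : V.ord 0 = 0 := by simp [ord]
theorem ord_one : V.ord 1 = 0 := by simp [ord]
theorem ord_mul (hx : x ≠ 0) (hy : y ≠ 0) : V.ord (x * y) = V.ord x + V.ord y := by
  rw [ord, map_mul, WithZero.log_mul (V.val_ne hx) (V.val_ne hy), ord, ord]; ring
theorem ord_inv : V.ord x⁻¹ = - V.ord x := by
  rw [ord, map_inv₀, WithZero.log_inv, ord]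
theorem ord_pow (k : ℕ) : V.ord (x ^ k) = k * V.ord x := by
  rw [ord, map_pow, WithZero.log_pow, ord]; simp
theorem ord_zpow (k : ℤ) : V.ord (x ^ k) = k * V.ord x := by
  rw [ord, map_zpow₀, WithZero.log_zpow, ord]; simp
theorem ord_div (hx : x ≠ 0) (hy : y ≠ 0) : V.ord (x / y) = V.ord x - V.ord y := by
  rw [div_eq_mul_inv, ord_mul V hx (inv_ne_zero hy), ord_inv]; ring
theorem ord_neg : V.ord (-x) = V.ord x := by rw [ord, Valuation.map_neg, ord]

theorem G_iff (hx : x ≠ 0) : V.G n x ↔ n ≤ V.ord x := by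
  rw [G, ord, ← WithZero.log_le_iff_le_exp (V.val_ne hx)]; omega
theorem G_zero : V.G n 0 := by simp [G]
theorem G_iff' : V.G n x ↔ x = 0 ∨ n ≤ V.ord x := by
  by_cases h : x = 0
  · simp [h, G_zero]
  · simp [V.G_iff h, h]
theorem G_add (hx : V.G n x) (hy : V.G n y) : V.G n (x + y) :=
  Valuation.map_add_le _ hx hy
theorem G_neg (hx : V.G n x) : V.G n (-x) := by rwa [G, Valuation.map_neg]
theorem G_sub (hx : V.G n x) (hy : V.G n y) : V.G n (x - y) := by
  rw [sub_eq_add_neg]; exact V.G_add hx (V.G_neg hy)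
theorem G_mul (hx : V.G m x) (hy : V.G n y) : V.G (m + n) (x * y) := by
  rw [G, map_mul, neg_add, WithZero.exp_add]
  exact mul_le_mul' hx hy
theorem G_mono (h : m ≤ n) (hx : V.G n x) : V.G m x :=
  hx.trans (WithZero.exp_le_exp.2 (by omega))
theorem G_sum {ι : Type*} (s : Finset ι) (f : ι → X) (h : ∀ i ∈ s, V.G n (f i)) :
    V.G n (∑ i ∈ s, f i) := by
  classical
  induction s using Finset.induction_on with
  | empty => simpa using V.G_zero
  | insert a s ha ih =>
    rw [Finset.sum_insert ha]
    exact V.G_add (h _ (Finset.mem_insert_self _ _))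
      (ih fun i hi => h i (Finset.mem_insert_of_mem hi))
theorem G_ord : V.G (V.ord x) x := by
  rw [G_iff']; right; exact le_rfl

theorem mem_iff : x ∈ V.A ↔ V.G 0 x := by
  constructor
  · intro h
    simpa [G, val] using
      (IsDiscreteValuationRing.maximalIdeal V.A).valuation_le_one (K := X) ⟨x, h⟩
  · intro h
    have h' : V.val x ≤ 1 := by simpa [G] using h
    obtain ⟨a, ha⟩ := IsDiscreteValuationRing.exists_lift_of_le_one (A := V.A) h'
    rw [← ha]; exact a.2

theorem exists_uniformizer : ∃ p : X, p ≠ 0 ∧ V.ord p = 1 := by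
  obtain ⟨p, hp⟩ := (IsDiscreteValuationRing.maximalIdeal V.A).valuation_exists_uniformizer X
  have h1 : V.ord p = 1 := by rw [ord, val, hp]; rfl
  refine ⟨p, ?_, h1⟩
  rintro rfl
  rw [ord_zero] at h1; omega

theorem mem_max_iff (a : V.A) : a ∈ IsLocalRing.maximalIdeal V.A ↔ V.G 1 (a : X) := by
  have := (IsDiscreteValuationRing.maximalIdeal V.A).valuation_lt_one_iff_mem (K := X) a
  have h2 : (IsDiscreteValuationRing.maximalIdeal V.A).asIdeal = IsLocalRing.maximalIdeal V.A := rfl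
  rw [← h2, ← this]
  by_cases h0 : (a : X) = 0
  · have : a = 0 := Subtype.ext h0
    simp [this, G_zero]
  rw [V.G_iff h0]
  have h3 : V.val a < 1 ↔ 1 ≤ V.ord a := by
    rw [ord, ← WithZero.exp_zero, ← WithZero.log_lt_iff_lt_exp (V.val_ne h0)]; omega
  exact h3

theorem not_mem_inv (hx : 0 < V.ord x) : x⁻¹ ∉ V.A := by
  have h0 : x ≠ 0 := by rintro rfl; rw [ord_zero] at hx; omega
  rw [mem_iff, G_iff _ (inv_ne_zero h0), ord_inv]; omega

theorem ord_add_eq (hx : x ≠ 0) (hy : V.G (V.ord x + 1) y) : V.ord (x + y) = V.ord x ∧ x + y ≠ 0 := by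
  have h0 : x + y ≠ 0 := by
    intro h
    have : y = -x := by linear_combination h
    rw [this, G_iff _ (neg_ne_zero.2 hx), ord_neg] at hy; omega
  refine ⟨le_antisymm ?_ ?_, h0⟩
  · by_contra! h
    have h1 : V.G (V.ord x + 1) (x + y) := (V.G_iff h0).2 (by omega)
    have := V.G_sub h1 hy
    rw [add_sub_cancel_right, G_iff _ hx] at this; omega
  · exact (V.G_iff h0).1 (V.G_add V.G_ord (V.G_mono (by omega) hy))

theorem eq_of_le {V W : Place X} (h : V.A ≤ W.A) : V = W := by
  have hx : ∀ x, V.G 0 x → W.G 0 x := fun x hx => W.mem_iff.1 (h (V.mem_iff.2 hx))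
  ext x
  refine ⟨fun hx => h hx, fun hx' => ?_⟩
  by_contra hxV
  have h0 : x ≠ 0 := by rintro rfl; exact hxV V.A.zero_mem
  rw [mem_iff, G_iff _ h0] at hxV hx'
  -- ord_V x < 0 ≤ ord_W x
  obtain ⟨p, hp0, hp⟩ := W.exists_uniformizer
  -- p⁻¹ * x ^ k  with k large is in ... 
  have h1 : V.G 0 (p⁻¹ * (x⁻¹) ^ (V.ord p).natAbs) := by
    rw [G_iff _ (by positivity), ord_mul _ (by positivity) (by positivity), ord_pow, ord_inv,
      ord_inv]
    have : (V.ord p) ≤ (V.ord p).natAbs := Int.le_natAbs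
    nlinarith
  have h2 := hx _ h1
  rw [G_iff _ (by positivity), ord_mul _ (by positivity) (by positivity), ord_pow, ord_inv,
      ord_inv, hp] at h2
  have : (0:ℤ) ≤ (V.ord p).natAbs := by positivity
  nlinarith

theorem exists_mem_not_mem {V W : Place X} (h : V ≠ W) :
    ∃ x, x ≠ 0 ∧ 0 ≤ V.ord x ∧ W.ord x < 0 := by
  by_contra! h'
  apply h
  apply eq_of_le
  intro x hx
  by_cases h0 : x = 0
  · rw [h0]; exact zero_mem _
  rw [mem_iff, G_iff _ h0] at *
  exact h' x h0 hx
end Place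
end FF
end

section
open IntermediateField Polynomial
namespace FF
namespace Place
section approx
variable {X : Type*} [Field X]

theorem exists_sep {V W : Place X} (h : V ≠ W) : ∃ x, x ≠ 0 ∧ 0 < V.ord x ∧ W.ord x < 0 := by
  obtain ⟨x, hx, h1, h2⟩ := exists_mem_not_mem h
  obtain ⟨y, hy, h3, h4⟩ := exists_mem_not_mem h.symm
  refine ⟨x / y, div_ne_zero hx hy, ?_, ?_⟩
  · rw [ord_div _ hx hy]; omega
  · rw [ord_div _ hx hy]; omega

theorem exists_sep_finset (V : Place X) (S : Finset (Place X)) :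
    ∃ u, u ≠ 0 ∧ 0 < V.ord u ∧ ∀ W ∈ S, W ≠ V → W.ord u < 0 := by
  classical
  induction S using Finset.induction_on with
  | empty =>
    obtain ⟨p, hp, h⟩ := V.exists_uniformizer
    exact ⟨p, hp, by omega, by simp⟩
  | insert W S hW ih =>
    obtain ⟨u, hu, hu1, hu2⟩ := ih
    by_cases hWV : W = V
    · refine ⟨u, hu, hu1, fun W' hW' hne => ?_⟩
      rcases Finset.mem_insert.1 hW' with h | h
      · exact absurd (h.trans hWV) hne
      · exact hu2 _ h hne
    by_cases hWu : W.ord u < 0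
    · refine ⟨u, hu, hu1, fun W' hW' hne => ?_⟩
      rcases Finset.mem_insert.1 hW' with h | h
      · rwa [h]
      · exact hu2 _ h hne
    obtain ⟨w, hw, hw1, hw2⟩ := exists_sep (Ne.symm hWV)
    set r : ℕ := 1 + ∑ W' ∈ S, (W'.ord u).natAbs with hr
    have key : ∀ W' ∈ S, (W'.ord u).natAbs < r := fun W' h => by
      have := Finset.single_le_sum (f := fun W' : Place X => (W'.ord u).natAbs)
        (fun _ _ => Nat.zero_le _) h
      omega
    have hwr : w ^ r ≠ 0 := pow_ne_zero _ hw
    have hW1 : W.ord (w ^ r + u) < 0 ∧ w ^ r + u ≠ 0 := by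
      have h1 : W.ord (w ^ r) < 0 := by
        rw [ord_pow]
        have : (1 : ℤ) ≤ r := by omega
        nlinarith
      have := W.ord_add_eq hwr (y := u) ((W.G_iff hu).2 (by omega))
      exact ⟨by omega, this.2⟩
    refine ⟨w ^ r + u, hW1.2, ?_, ?_⟩
    · have h1 : V.G 1 (w ^ r) := (V.G_iff hwr).2 (by
        rw [ord_pow]
        have : (1 : ℤ) ≤ r := by omega
        nlinarith)
      have h2 : V.G 1 u := (V.G_iff hu).2 (by omega)
      have := (V.G_iff hW1.2).1 (V.G_add h1 h2)
      omega
    · intro W' hW' hne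
      rcases Finset.mem_insert.1 hW' with h | h
      · rw [h]; exact hW1.1
      · have h3 := hu2 _ h hne
        have h4 := key _ h
        by_cases h5 : W'.ord w < 0
        · have h6 : W'.ord (w ^ r) < W'.ord u := by
            rw [ord_pow]
            have h7 : (r : ℤ) > - W'.ord u := by omega
            nlinarith
          have := W'.ord_add_eq hwr (y := u) ((W'.G_iff hu).2 (by omega))
          omega
        · have h6 : 0 ≤ W'.ord (w ^ r) := by
            rw [ord_pow]
            exact mul_nonneg (Int.natCast_nonneg r) (not_lt.1 h5)
          have := W'.ord_add_eq hu (y := w ^ r) ((W'.G_iff hwr).2 (by omega))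
          rw [add_comm]; omega

theorem exists_idem (V : Place X) (S : Finset (Place X)) (N : ℕ) :
    ∃ e, V.G N (e - 1) ∧ ∀ W ∈ S, W ≠ V → W.G N e := by
  obtain ⟨u, hu, h1, h2⟩ := exists_sep_finset V S
  set M := N + 1
  have huM : u ^ M ≠ 0 := pow_ne_zero _ hu
  have hN : (N : ℤ) ≤ V.ord (u ^ M) ∧ 1 ≤ V.ord (u ^ M) := by
    rw [ord_pow]
    have : (M : ℤ) = N + 1 := by simp [M]
    rw [this]
    constructor <;> nlinarith
  have h3 := V.ord_add_eq one_ne_zero (y := u ^ M) ((V.G_iff huM).2 (by rw [ord_one]; omega))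
  rw [ord_one] at h3
  refine ⟨(1 + u ^ M)⁻¹, ?_, fun W hW hne => ?_⟩
  · have : (1 + u ^ M)⁻¹ - 1 = - (u ^ M / (1 + u ^ M)) := by
      field_simp [h3.2]; ring
    rw [this]
    apply G_neg
    rw [G_iff _ (div_ne_zero huM h3.2), ord_div _ huM h3.2, h3.1]
    omega
  · have h4 := h2 W hW hne
    have h5 : W.ord (u ^ M) ≤ - N ∧ W.ord (u ^ M) ≤ -1 := by
      rw [ord_pow]
      have : (M : ℤ) = N + 1 := by simp [M]
      rw [this]
      constructor <;> nlinarith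
    have h6 := W.ord_add_eq huM (y := 1) ((W.G_iff one_ne_zero).2 (by rw [ord_one]; omega))
    rw [add_comm] at h6
    rw [G_iff _ (inv_ne_zero h3.2), ord_inv, h6.1]
    omega

theorem approx (S : Finset (Place X)) (x : Place X → X) (n : ℤ) :
    ∃ y, ∀ W ∈ S, W.G n (y - x W) := by
  classical
  set N : ℕ := n.natAbs + ∑ V ∈ S, ∑ W ∈ S, (W.ord (x V)).natAbs
  have key : ∀ V ∈ S, ∀ W ∈ S, n - W.ord (x V) ≤ N := by
    intro V hV W hW
    have h1 := Finset.single_le_sum (f := fun V : Place X => ∑ W ∈ S, (W.ord (x V)).natAbs)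
        (fun _ _ => Nat.zero_le _) hV
    have h2 := Finset.single_le_sum (f := fun W : Place X => (W.ord (x V)).natAbs)
        (fun _ _ => Nat.zero_le _) hW
    omega
  choose e he1 he2 using fun V : Place X => exists_idem V S N
  refine ⟨∑ V ∈ S, e V * x V, fun W hW => ?_⟩
  have : ∑ V ∈ S, e V * x V - x W = (e W - 1) * x W + ∑ V ∈ S.erase W, e V * x V := by
    rw [← Finset.add_sum_erase _ _ hW]; ring
  rw [this]
  apply G_add
  · exact W.G_mono (by have := key W hW W hW; omega) (W.G_mul (he1 W) W.G_ord)
  · refine W.G_sum _ _ fun V hV => ?_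
    rw [Finset.mem_erase] at hV
    exact W.G_mono (by have := key V hV.2 W hW; omega)
      (W.G_mul (he2 V W hW (Ne.symm hV.1)) W.G_ord)

end approx

section res
variable (F : Type*) {X : Type*} [Field F] [Field X] [Algebra F X] [Finite F]

theorem ord_algebraMap (V : Place X) (c : F) : V.ord (algebraMap F X c) = 0 := by
  by_cases h : c = 0
  · rw [h, map_zero, ord_zero]
  have h1 := V.mem_iff.1 (algebraMap_mem V.A c)
  have h2 := V.mem_iff.1 (algebraMap_mem V.A c⁻¹)
  have hc : algebraMap F X c ≠ 0 := by simpa using h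
  rw [map_inv₀, G_iff _ (inv_ne_zero hc), ord_inv] at h2
  rw [G_iff _ hc] at h1
  omega

/-- filtration of the field by a place -/
def fil (V : Place X) (n : ℤ) : Submodule F X where
  carrier := {x | V.G n x}
  add_mem' := V.G_add
  zero_mem' := V.G_zero
  smul_mem' c x hx := by
    rw [Algebra.smul_def]
    have := V.G_mul (V.mem_iff.1 (algebraMap_mem V.A c)) hx
    rwa [zero_add] at this

theorem mem_fil {V : Place X} {n : ℤ} {x : X} : x ∈ V.fil F n ↔ V.G n x := Iff.rfl

noncomputable def pi (V : Place X) : X := Classical.choose V.exists_uniformizer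
theorem pi_ne (V : Place X) : V.pi ≠ 0 := (Classical.choose_spec V.exists_uniformizer).1
theorem ord_pi (V : Place X) : V.ord V.pi = 1 := (Classical.choose_spec V.exists_uniformizer).2

abbrev res (V : Place X) := IsLocalRing.ResidueField V.A

theorem lead_aux {V : Place X} {n : ℤ} {x : X} : V.G 0 (x * V.pi ^ (-n)) ↔ V.G n x := by
  by_cases h : x = 0
  · simp [h, G_zero]
  have hp := zpow_ne_zero (-n) V.pi_ne
  rw [G_iff _ (mul_ne_zero h hp), G_iff _ h, ord_mul _ h hp, ord_zpow, ord_pi]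
  omega

theorem lead_aux' {V : Place X} {n : ℤ} {x : X} : V.G 1 (x * V.pi ^ (-n)) ↔ V.G (n+1) x := by
  by_cases h : x = 0
  · simp [h, G_zero]
  have hp := zpow_ne_zero (-n) V.pi_ne
  rw [G_iff _ (mul_ne_zero h hp), G_iff _ h, ord_mul _ h hp, ord_zpow, ord_pi]
  omega

theorem residue_smul (V : Place X) (c : F) (a : V.A) :
    IsLocalRing.residue V.A (c • a) = c • IsLocalRing.residue V.A a := by
  rw [Algebra.smul_def, map_mul, Algebra.smul_def]; rfl

/-- leading coefficient map -/
noncomputable def lead (V : Place X) (n : ℤ) : V.fil F n →ₗ[F] V.res where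
  toFun x := IsLocalRing.residue V.A ⟨x * V.pi ^ (-n), V.mem_iff.2 (lead_aux.2 x.2)⟩
  map_add' x y := by
    rw [← map_add]; congr 1
    apply Subtype.ext
    simp [add_mul]
  map_smul' c x := by
    rw [RingHom.id_apply, ← residue_smul]; congr 1
    apply Subtype.ext
    rw [coe_smul']
    simp

theorem lead_eq_zero {V : Place X} {n : ℤ} (x : V.fil F n) :
    V.lead F n x = 0 ↔ V.G (n + 1) (x : X) := by
  rw [← lead_aux']
  change IsLocalRing.residue V.A _ = 0 ↔ _
  rw [IsLocalRing.residue_eq_zero_iff, mem_max_iff]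

theorem lead_surjective (V : Place X) (n : ℤ) : Function.Surjective (V.lead F n) := by
  intro r
  obtain ⟨a, rfl⟩ := IsLocalRing.residue_surjective r
  have hp := V.pi_ne
  have h : (a * V.pi ^ n : X) * V.pi ^ (-n) = a := by
    rw [mul_assoc, ← zpow_add₀ hp]; simp
  refine ⟨⟨a * V.pi ^ n, ?_⟩, ?_⟩
  · rw [mem_fil, ← lead_aux, h, ← mem_iff]; exact a.2
  · change IsLocalRing.residue V.A _ = _
    congr 1
    exact Subtype.ext h

noncomputable def deg (V : Place X) : ℕ := Module.finrank F V.res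

variable [GFF F X]

instance finite_res (V : Place X) : Module.Finite F V.res := by
  have hp : V.pi ∈ V.A := V.mem_iff.2 ((V.G_iff V.pi_ne).2 (by rw [ord_pi]; omega))
  have := finite_quot (F := F) V.A ⟨V.pi, hp⟩ V.pi_ne (V.not_mem_inv (by rw [ord_pi]; omega))
  have hle : Ideal.span {(⟨V.pi, hp⟩ : V.A)} ≤ IsLocalRing.maximalIdeal V.A := by
    rw [Ideal.span_singleton_le_iff_mem, mem_max_iff, G_iff _ V.pi_ne, ord_pi]
  exact Module.Finite.of_surjective (Ideal.Quotient.factorₐ F hle).toLinearMap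
    (Ideal.Quotient.factor_surjective hle)

include F in
theorem finite_res' (V : Place X) : Finite V.res :=
  @Module.finite_of_finite F V.res _ _ _ _ (finite_res F V)

theorem deg_pos (V : Place X) : 0 < V.deg F := by
  have := finite_res F V
  exact Module.finrank_pos

theorem card_res (V : Place X) : Nat.card V.res = Nat.card F ^ V.deg F := by
  have := finite_res F V
  exact Module.natCard_eq_pow_finrank

theorem exists_zero {z : X} (hz : Transcendental F z) : ∃ V : Place X, 0 < V.ord z := by
  let A := (Algebra.adjoin F {z}).toSubring
  have hzA : z ∈ A := Algebra.self_mem_adjoin_singleton F z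
  have hI : Ideal.span {(⟨z, hzA⟩ : A)} ≠ ⊤ := by
    intro h
    rw [Ideal.span_singleton_eq_top] at h
    obtain ⟨w, hw⟩ := h.exists_right_inv
    obtain ⟨p, hp⟩ : ∃ p : F[X], aeval z p = (w : X) := by
      have h1 : (w : X) ∈ Algebra.adjoin F {z} := w.2
      rw [Algebra.adjoin_singleton_eq_range_aeval] at h1
      exact h1
    have h2 : aeval z (Polynomial.X * p - 1) = 0 := by
      have := congrArg Subtype.val hw
      rw [map_sub, map_mul, aeval_X, hp, map_one, sub_eq_zero]
      exact this
    have h3 := (transcendental_iff.1 hz) _ h2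
    have := congrArg (Polynomial.coeff · 0) h3
    simp at this
  obtain ⟨B, hB, hB2⟩ := Ideal.image_subset_nonunits_valuationSubring _ hI
  have hz1 : z ∈ B.nonunits := hB2 ⟨⟨z, hzA⟩, Ideal.mem_span_singleton_self _, rfl⟩
  have hz0 : z ≠ 0 := by rintro rfl; exact hz (isAlgebraic_zero)
  have hz2 : z⁻¹ ∉ B := ((ValuationSubring.mem_nonunits_iff_or B).1 hz1).resolve_left hz0
  have hne : B ≠ ⊤ := by rintro rfl; exact hz2 (ValuationSubring.mem_top _)
  refine ⟨⟨B, dvr_of_ne_top F B hne⟩, ?_⟩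
  by_contra h
  apply hz2
  refine (mem_iff (⟨B, dvr_of_ne_top F B hne⟩ : Place X)).2 ((G_iff _ (inv_ne_zero hz0)).2 ?_)
  rw [ord_inv]; omega

end res
end Place
end FF
end

section
open IntermediateField Polynomial
namespace FF
set_option linter.unusedSectionVars false
set_option linter.unusedVariables false
section
variable (F : Type*) {X : Type*} [Field F] [Field X] [Algebra F X] [Finite F] [GFF F X]

include F

theorem exists_local (V : Place X) (S : Finset (Place X)) (n N : ℤ) (r : V.res) :
    ∃ u : X, ∃ h : V.G n u, V.lead F n ⟨u, h⟩ = r ∧ ∀ W ∈ S, W ≠ V → W.G N u := by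
  classical
  obtain ⟨⟨x, hx⟩, hxr⟩ := V.lead_surjective F n r
  obtain ⟨y, hy⟩ := Place.approx (insert V S) (fun W => if W = V then x else 0) (max N (n+1))
  have h1 := hy V (Finset.mem_insert_self _ _)
  simp only [if_true] at h1
  have h1' : V.G (n+1) (y - x) := V.G_mono (le_max_right _ _) h1
  have h2 : V.G n y := by
    have := V.G_add (V.G_mono (by omega) h1') hx
    simpa using this
  refine ⟨y, h2, ?_, ?_⟩
  · rw [← hxr, ← sub_eq_zero, ← map_sub, Place.lead_eq_zero]
    exact h1'
  · intro W hW hne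
    have := hy W (Finset.mem_insert_of_mem hW)
    simp only [if_neg hne, sub_zero] at this
    exact W.G_mono (le_max_left _ _) this

variable {F} in
theorem fund_ineq {z : X} (hz : Transcendental F z) (S : Finset (Place X))
    (hS : ∀ V ∈ S, 0 < V.ord z) : ∑ V ∈ S, (V.ord z).toNat * V.deg F ≤ dg F z := by
  classical
  have hz0 : z ≠ 0 := by rintro rfl; exact hz (isAlgebraic_zero)
  let ι := Σ V : S, Fin ((V : Place X).ord z).toNat × Fin ((V : Place X).deg F)
  let N : ℤ := ∑ V ∈ S, V.ord z
  have hN : ∀ V ∈ S, V.ord z ≤ N := fun V hV =>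
    Finset.single_le_sum (f := fun V : Place X => V.ord z) (fun W hW => (hS W hW).le) hV
  have hN0 : 0 ≤ N := Finset.sum_nonneg (fun W hW => (hS W hW).le)
  let b : ∀ V : Place X, Module.Basis (Fin (V.deg F)) F V.res := fun V => Module.finBasis F V.res
  choose u hu1 hu2 hu3 using fun i : ι => exists_local F (i.1 : Place X) S (i.2.1 : ℕ) N (b i.1 i.2.2)
  let A : Subalgebra F X := ⨅ V : S, asSub F (V : Place X).A
  have hA : ∀ x, x ∈ A ↔ ∀ V ∈ S, V.G 0 x := by
    intro x
    simp only [A, Algebra.mem_iInf, mem_asSub, Place.mem_iff, Subtype.forall]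
  have key := card_le_of_indep hz u A ?_ ?_ ?_
  · refine le_trans (le_of_eq ?_) key
    simp only [ι, Fintype.card_sigma, Fintype.card_prod, Fintype.card_fin]
    exact (Finset.sum_coe_sort S (fun V => (V.ord z).toNat * V.deg F)).symm
  · rw [hA]; intro V hV; exact (V.G_iff hz0).2 (hS V hV).le
  · intro i
    rw [hA]; intro V hV
    by_cases h : V = i.1
    · subst h; exact Place.G_mono _ (by positivity) (hu1 i)
    · exact V.G_mono hN0 (hu3 i V hV h)
  · rintro c ⟨w, hw, hcw⟩
    rw [hA] at hw
    have hV : ∀ V : S, ∀ k : ℕ, ∀ j : Fin ((V : Place X).ord z).toNat, (j : ℕ) < k → ∀ l, c ⟨V, j, l⟩ = 0 := by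
      intro V k
      induction k with
      | zero => intro j hj; omega
      | succ k ih =>
        intro j hj
        rcases Nat.lt_succ_iff_lt_or_eq.1 hj with h | h
        · exact ih j h
        have hsum : V.1.G ((j : ℕ) + 1) (∑ i : ι, c i • u i) := by
          rw [hcw]
          have := V.1.G_mul (V.1.G_ord (x := z)) (hw V V.2)
          refine V.1.G_mono ?_ this
          have := j.2; have := hS V V.2; omega
        have hsm : ∀ (n : ℤ) (c : F) (x : X), V.1.G n x → V.1.G n (c • x) := fun n c x hx =>
          (V.1.fil F n).smul_mem c hx
        rw [Fintype.sum_sigma, Fintype.sum_eq_add_sum_compl V] at hsum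
        have h1 : V.1.G ((j : ℕ) + 1) (∑ y : Fin (V.1.ord z).toNat × Fin (V.1.deg F), c ⟨V, y⟩ • u ⟨V, y⟩) := by
          have h2 := V.1.G_sub hsum (y := ∑ x ∈ {V}ᶜ, ∑ y, c ⟨x, y⟩ • u ⟨x, y⟩) ?_
          · simpa using h2
          · refine V.1.G_sum _ _ fun x hx => V.1.G_sum _ _ fun y _ => hsm _ _ _ ?_
            have hne : V ≠ x := by rintro rfl; simp at hx
            refine V.1.G_mono ?_ (hu3 ⟨x, y⟩ V V.2 (fun h => hne (Subtype.ext h)))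
            have := j.2; have := hN V V.2; omega
        rw [Fintype.sum_prod_type, Fintype.sum_eq_add_sum_compl j] at h1
        have h3 : V.1.G ((j : ℕ) + 1) (∑ l : Fin (V.1.deg F), c ⟨V, j, l⟩ • u ⟨V, j, l⟩) := by
          have h2 := V.1.G_sub h1 (y := ∑ x ∈ {j}ᶜ, ∑ l, c ⟨V, x, l⟩ • u ⟨V, x, l⟩) ?_
          · simpa using h2
          · refine V.1.G_sum _ _ fun x hx => V.1.G_sum _ _ fun l _ => ?_
            have hne : j ≠ x := by rintro rfl; simp at hx
            have hne' : (j : ℕ) ≠ x := fun h => hne (Fin.ext h)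
            by_cases hlt : (x : ℕ) < k
            · rw [ih x hlt, zero_smul]; exact V.1.G_zero
            · refine hsm _ _ _ (V.1.G_mono ?_ (hu1 ⟨V, x, l⟩))
              simp only; omega
        have h4 : (∑ l : Fin (V.1.deg F), c ⟨V, j, l⟩ • b V.1 l) = 0 := by
          have h5 : V.1.lead F (j : ℕ) (∑ l : Fin (V.1.deg F), c ⟨V, j, l⟩ • ⟨u ⟨V, j, l⟩, hu1 ⟨V, j, l⟩⟩) = 0 := by
            rw [Place.lead_eq_zero]
            simpa using h3
          rw [map_sum] at h5
          rw [← h5]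
          refine Finset.sum_congr rfl fun l _ => ?_
          rw [map_smul]
          exact congrArg _ (hu2 ⟨V, j, l⟩).symm
        intro l
        exact Fintype.linearIndependent_iff.1 (b V.1).linearIndependent _ h4 l
    funext ⟨V, j, l⟩
    exact hV V (j+1) j (by omega) l

theorem ord_of_alg {x : X} (hx : IsAlgebraic F x) (V : Place X) : V.ord x = 0 := by
  by_cases h0 : x = 0
  · rw [h0, Place.ord_zero]
  have h1 := (V.G_iff h0).1 (V.mem_iff.1 (mem_of_isAlgebraic V.A hx))
  have h2 := (V.G_iff (inv_ne_zero h0)).1 (V.mem_iff.1 (mem_of_isAlgebraic V.A hx.inv))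
  rw [Place.ord_inv] at h2
  omega

theorem finite_zeros (z : X) : {V : Place X | 0 < V.ord z}.Finite := by
  classical
  by_cases hz : Transcendental F z
  · by_contra h
    obtain ⟨T, hT, hc⟩ := Set.Infinite.exists_subset_card_eq h (dg F z + 1)
    have := fund_ineq hz T (fun V hV => hT hV)
    have h2 : ∑ V ∈ T, 1 ≤ ∑ V ∈ T, (V.ord z).toNat * V.deg F := by
      refine Finset.sum_le_sum fun V hV => ?_
      have h3 : 0 < V.ord z := hT hV
      exact Nat.mul_pos (by omega) (V.deg_pos F)
    simp at h2; omega
  · have : {V : Place X | 0 < V.ord z} = ∅ := by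
      ext V
      simp [ord_of_alg F (not_not.1 hz) V]
    rw [this]; exact Set.finite_empty

theorem finite_supp (z : X) : (Function.support fun V : Place X => V.ord z).Finite := by
  refine ((finite_zeros F z).union (finite_zeros F z⁻¹)).subset ?_
  intro V hV
  simp only [Function.mem_support] at hV
  simp only [Set.mem_union, Set.mem_setOf_eq, Place.ord_inv]
  omega

noncomputable def dv (z : X) : Place X →₀ ℤ := Finsupp.ofSupportFinite _ (finite_supp F z)
theorem dv_apply (z : X) (V : Place X) : dv F z V = V.ord z := rfl

omit [Finite F] [GFF F X] in
theorem dg_inv (z : X) : dg F z⁻¹ = dg F z := by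
  have : F⟮z⁻¹⟯ = F⟮z⟯ := by
    apply le_antisymm
    · rw [adjoin_simple_le_iff]; exact inv_mem (mem_adjoin_simple_self F z)
    · rw [adjoin_simple_le_iff]
      have := inv_mem (mem_adjoin_simple_self F z⁻¹)
      rwa [inv_inv] at this
  unfold dg
  rw [this]

noncomputable def degD : (Place X →₀ ℤ) →ₗ[ℤ] ℤ :=
  Finsupp.linearCombination ℤ (fun V : Place X => (V.deg F : ℤ))

theorem degD_single (V : Place X) (n : ℤ) : degD F (Finsupp.single V n) = n * V.deg F := by
  simp [degD]

theorem degD_eq (D : Place X →₀ ℤ) : degD F D = ∑ V ∈ D.support, D V * V.deg F := by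
  simp [degD, Finsupp.linearCombination_apply, Finsupp.sum]

theorem degD_nonneg {D : Place X →₀ ℤ} (h : 0 ≤ D) : 0 ≤ degD F D := by
  rw [degD_eq]
  exact Finset.sum_nonneg fun V _ => mul_nonneg (h V) (by positivity)

def Ls (D : Place X →₀ ℤ) : Submodule F X where
  carrier := {x | ∀ V : Place X, V.G (- D V) x}
  zero_mem' := fun V => V.G_zero
  add_mem' := fun hx hy V => V.G_add (hx V) (hy V)
  smul_mem' := fun c x hx V => (V.fil F _).smul_mem c (hx V)

variable {F} in
theorem mem_Ls {D : Place X →₀ ℤ} {x : X} : x ∈ Ls F D ↔ ∀ V : Place X, V.G (- D V) x := Iff.rfl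

theorem Ls_mono {D E : Place X →₀ ℤ} (h : D ≤ E) : Ls F D ≤ Ls F E := fun x hx V =>
  V.G_mono (neg_le_neg (h V)) (hx V)

theorem eff_induction {P : (Place X →₀ ℤ) → Prop} (h0 : P 0)
    (hs : ∀ D V, 0 ≤ D → P D → P (D + Finsupp.single V 1)) (D : Place X →₀ ℤ) (hD : 0 ≤ D) : P D := by
  classical
  induction hn : (degD F D).toNat using Nat.strong_induction_on generalizing D with
  | _ n ih =>
    by_cases h : D = 0
    · rw [h]; exact h0
    obtain ⟨V, hV⟩ := Finsupp.ne_iff.1 h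
    have hV1 : 0 ≤ D V := hD V
    simp only [Finsupp.coe_zero, Pi.zero_apply] at hV
    have h2 : 0 ≤ D - Finsupp.single V 1 := by
      intro W
      have := hD W
      by_cases hW : V = W
      · subst hW; simp; omega
      · simpa [Finsupp.single_apply, hW] using this
    have h3 := ih (degD F (D - Finsupp.single V 1)).toNat ?_ _ h2 rfl
    · simpa using hs _ V h2 h3
    · have := degD_nonneg F h2
      rw [map_sub, degD_single] at this ⊢
      have := V.deg_pos F
      omega

noncomputable def ell (D : Place X →₀ ℤ) : ℕ := Module.finrank F (Ls F D)

noncomputable def leadL (D : Place X →₀ ℤ) (V : Place X) : Ls F (D + Finsupp.single V 1) →ₗ[F] V.res :=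
  (V.lead F (-(D V + 1))).comp (Submodule.inclusion (fun x hx => by
    have := hx V
    rw [Place.mem_fil]
    simpa using this))

theorem leadL_ker (D : Place X →₀ ℤ) (V : Place X) :
    LinearMap.ker (leadL F D V) = (Ls F D).submoduleOf (Ls F (D + Finsupp.single V 1)) := by
  classical
  ext x
  rw [LinearMap.mem_ker]
  change V.lead F _ _ = 0 ↔ (x : X) ∈ Ls F D
  rw [Place.lead_eq_zero, mem_Ls]
  simp only [Submodule.coe_inclusion]
  constructor
  · intro h W
    by_cases hW : V = W
    · subst hW; exact V.G_mono (by omega) h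
    · have := x.2 W
      simpa [Finsupp.single_apply, hW] using this
  · intro h
    exact V.G_mono (by omega) (h V)

theorem le_add_single (D : Place X →₀ ℤ) (V : Place X) : D ≤ D + Finsupp.single V 1 := by
  classical
  intro W
  simp only [Finsupp.add_apply, Finsupp.single_apply]
  split <;> omega

theorem finite_add_single (D : Place X →₀ ℤ) (V : Place X) (h : Module.Finite F (Ls F D)) :
    Module.Finite F (Ls F (D + Finsupp.single V 1)) ∧
    ell F (D + Finsupp.single V 1) ≤ ell F D + V.deg F := by
  have hle := Ls_mono F (le_add_single F D V)
  let e := Submodule.submoduleOfEquivOfLe hle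
  have hk : Module.Finite F (LinearMap.ker (leadL F D V)) := by
    rw [leadL_ker]; exact Module.Finite.equiv e.symm
  have hr : Module.Finite F (LinearMap.range (leadL F D V)) := inferInstance
  have hfin : Module.Finite F (Ls F (D + Finsupp.single V 1)) := by
    have := Module.Finite.equiv (leadL F D V).quotKerEquivRange.symm
    exact Module.Finite.of_submodule_quotient (LinearMap.ker (leadL F D V))
  refine ⟨hfin, ?_⟩
  have h1 := LinearMap.finrank_range_add_finrank_ker (leadL F D V)
  have h2 : Module.finrank F (LinearMap.ker (leadL F D V)) = ell F D := by
    rw [leadL_ker]; exact e.finrank_eq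
  have h3 : Module.finrank F (LinearMap.range (leadL F D V)) ≤ V.deg F := Submodule.finrank_le _
  unfold ell at *
  omega

theorem Ls_neg (V : Place X) : Ls F (- Finsupp.single V 1) = ⊥ := by
  classical
  rw [eq_bot_iff]
  intro x hx
  rw [Submodule.mem_bot]
  by_contra h0
  have hV := (V.G_iff h0).1 (hx V)
  simp at hV
  have hx1 : Transcendental F x := by
    intro h; rw [ord_of_alg F h V] at hV; omega
  have hx2 : Transcendental F x⁻¹ := fun h => hx1 (by simpa using h.inv)
  obtain ⟨W, hW⟩ := Place.exists_zero F hx2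
  have hW2 := (W.G_iff h0).1 (hx W)
  rw [Place.ord_inv] at hW
  by_cases h : V = W
  · subst h; omega
  · simp [Finsupp.single_apply, h] at hW2; omega

theorem finite_ge_neg (V : Place X) (D : Place X →₀ ℤ) (hD : 0 ≤ D) :
    Module.Finite F (Ls F (D - Finsupp.single V 1)) ∧
      (ell F (D - Finsupp.single V 1) : ℤ) ≤ degD F D := by
  refine eff_induction F (P := fun D => Module.Finite F (Ls F (D - Finsupp.single V 1)) ∧
      (ell F (D - Finsupp.single V 1) : ℤ) ≤ degD F D) ?_ ?_ D hD
  · rw [zero_sub, ell, Ls_neg]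
    refine ⟨inferInstance, ?_⟩
    simp
  · rintro D W hD ⟨h1, h2⟩
    obtain ⟨h3, h4⟩ := finite_add_single F (D - Finsupp.single V 1) W h1
    rw [show D + Finsupp.single W 1 - Finsupp.single V 1 = D - Finsupp.single V 1 + Finsupp.single W 1 by abel]
    refine ⟨h3, ?_⟩
    rw [map_add, degD_single]
    push_cast at *
    omega

theorem exists_place : Nonempty (Place X) := by
  obtain ⟨z, hz⟩ := exists_transcendental F X
  exact ⟨(Place.exists_zero F hz).choose⟩

instance finite_Ls (D : Place X →₀ ℤ) : Module.Finite F (Ls F D) := by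
  classical
  obtain ⟨V⟩ := exists_place F (X := X)
  have h : D + Finsupp.single V 1 ≤ (D + Finsupp.single V 1) ⊔ 0 := le_sup_left
  have h1 := (finite_ge_neg F V ((D + Finsupp.single V 1) ⊔ 0) le_sup_right).1
  have h2 : Ls F D ≤ Ls F (((D + Finsupp.single V 1) ⊔ 0) - Finsupp.single V 1) :=
    Ls_mono F (le_sub_iff_add_le.2 h)
  exact Module.Finite.of_injective (Submodule.inclusion h2) (Submodule.inclusion_injective h2)

theorem ell_mono {D E : Place X →₀ ℤ} (h : D ≤ E) : ell F D ≤ ell F E :=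
  Submodule.finrank_mono (Ls_mono F h)

theorem sub_ell_mono {D E : Place X →₀ ℤ} (h : D ≤ E) :
    degD F D - ell F D ≤ degD F E - ell F E := by
  have := eff_induction F (P := fun E => degD F D - ell F D ≤ degD F (D + E) - ell F (D + E)) (by simp)
    ?_ (E - D) (sub_nonneg.2 h)
  · simpa using this
  · intro E V hE ih
    have := (finite_add_single F (D + E) V inferInstance).2
    rw [← add_assoc, map_add, degD_single]
    push_cast at *
    omega

end
end FF
end

section
open IntermediateField Polynomial
namespace FF
set_option linter.unusedSectionVars false
set_option linter.unusedVariables false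
section
variable (F : Type*) {X : Type*} [Field F] [Field X] [Algebra F X] [Finite F] [GFF F X]
include F

noncomputable def poles (z : X) : Place X →₀ ℤ := dv F z⁻¹ ⊔ 0

theorem poles_apply (z : X) (V : Place X) : poles F z V = max (- V.ord z) 0 := by
  simp [poles, dv_apply, Place.ord_inv]

theorem poles_nonneg (z : X) : 0 ≤ poles F z := le_sup_right

theorem dv_eq (z : X) : dv F z = poles F z⁻¹ - poles F z := by
  ext V
  simp only [Finsupp.sub_apply, poles_apply, dv_apply, Place.ord_inv]
  omega

theorem degD_poles_le {z : X} (hz : Transcendental F z) : degD F (poles F z) ≤ dg F z := by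
  classical
  have hz2 : Transcendental F z⁻¹ := fun h => hz (by simpa using h.inv)
  have h := fund_ineq hz2 (poles F z).support ?_
  · rw [dg_inv] at h
    rw [degD_eq]
    refine le_trans (le_of_eq ?_) (Nat.cast_le.2 h)
    push_cast
    refine Finset.sum_congr rfl fun V _ => ?_
    rw [poles_apply, Place.ord_inv, Int.toNat_eq_max]
  · intro V hV
    rw [Finsupp.mem_support_iff, poles_apply] at hV
    rw [Place.ord_inv]; omega

theorem ell_le (D : Place X →₀ ℤ) (hD : 0 ≤ D) : ∃ c : ℤ, ∀ E, 0 ≤ E → (ell F (E + D) : ℤ) ≤ degD F E + c := by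
  obtain ⟨V⟩ := exists_place F (X := X)
  have hs : (0 : Place X →₀ ℤ) ≤ Finsupp.single V 1 := by simpa using le_add_single F 0 V
  refine ⟨degD F (D + Finsupp.single V 1), fun E hE => ?_⟩
  have := (finite_ge_neg F V (E + D + Finsupp.single V 1) (add_nonneg (add_nonneg hE hD) hs)).2
  rw [add_sub_cancel_right, add_assoc, map_add] at this
  exact this

/-- the space `L(nB + C)` is large -/
theorem exists_large {z : X} (hz : Transcendental F z) : ∃ C : Place X →₀ ℤ, 0 ≤ C ∧
    ∀ n : ℕ, dg F z * (n + 1) ≤ ell F (n • poles F z + C) := by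
  classical
  have hz0 : z ≠ 0 := by rintro rfl; exact hz (isAlgebraic_zero)
  have := fd_adjoin hz
  let b := Module.finBasis F⟮z⟯ X
  let C : Place X →₀ ℤ := ∑ i, poles F (b i)
  have hC : 0 ≤ C := Finset.sum_nonneg fun i _ => poles_nonneg F _
  refine ⟨C, hC, fun n => ?_⟩
  let u : Fin (Module.finrank F⟮z⟯ X) × Fin (n+1) → X := fun i => z ^ (i.2 : ℕ) * b i.1
  have hu : ∀ i, u i ∈ Ls F (n • poles F z + C) := by
    intro i V
    have h1 : V.G (V.ord (b i.1)) (b i.1) := V.G_ord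
    have h2 : V.G (V.ord (z ^ (i.2 : ℕ))) (z ^ (i.2 : ℕ)) := V.G_ord
    refine V.G_mono ?_ (V.G_mul h2 h1)
    rw [Place.ord_pow]
    have h3 : poles F (b i.1) V ≤ C V := by
      have : poles F (b i.1) ≤ C := Finset.single_le_sum (f := fun i => poles F (b i)) (fun j _ => poles_nonneg F _) (Finset.mem_univ i.1)
      exact this V
    rw [poles_apply] at h3
    simp only [Finsupp.add_apply, Finsupp.smul_apply, poles_apply, nsmul_eq_mul]
    have hi : ((i.2 : ℕ) : ℤ) ≤ n := by have := i.2.2; omega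
    have h4 : -((i.2 : ℕ) : ℤ) * V.ord z ≤ n * max (- V.ord z) 0 := by
      calc -((i.2 : ℕ) : ℤ) * V.ord z = ((i.2 : ℕ) : ℤ) * (- V.ord z) := by ring
        _ ≤ ((i.2 : ℕ) : ℤ) * max (- V.ord z) 0 := by gcongr; exact le_max_left _ _
        _ ≤ n * max (- V.ord z) 0 := by gcongr
    have := le_max_left (- V.ord (b i.1)) 0
    linarith
  have hli : LinearIndependent F u := by
    rw [Fintype.linearIndependent_iff]
    intro c hc
    have h1 : ∑ i, (∑ j : Fin (n+1), algebraMap F F⟮z⟯ (c (i, j)) * (AdjoinSimple.gen F z) ^ (j : ℕ)) • b i = 0 := by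
      rw [← hc, Fintype.sum_prod_type]
      refine Finset.sum_congr rfl fun i _ => ?_
      rw [Finset.sum_smul]
      refine Finset.sum_congr rfl fun j _ => ?_
      simp only [u, Algebra.smul_def, map_mul, map_pow]
      rw [AdjoinSimple.algebraMap_gen, ← IsScalarTower.algebraMap_apply, mul_assoc]
    have h2 := Fintype.linearIndependent_iff.1 b.linearIndependent _ h1
    rintro ⟨i, j⟩
    have h3 := h2 i
    have h4 : aeval z (∑ j : Fin (n+1), Polynomial.C (c (i, j)) * Polynomial.X ^ (j : ℕ)) = 0 := by
      have := congrArg (algebraMap F⟮z⟯ X) h3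
      simp only [map_sum, map_mul, map_pow, map_zero] at this
      rw [← this]
      simp only [map_sum, map_mul, map_pow, aeval_C, aeval_X]
      rfl
    have h5 := (transcendental_iff.1 hz) _ h4
    have h6 := congrArg (fun p => p.coeff (j : ℕ)) h5
    simp only [finset_sum_coeff, coeff_C_mul, coeff_X_pow, coeff_zero] at h6
    rw [Finset.sum_eq_single j] at h6
    · simpa using h6
    · intro k _ hk
      have : (j : ℕ) ≠ k := fun h => hk (Fin.ext h.symm)
      simp [this]
    · simp
  have hli2 : LinearIndependent F (fun i => (⟨u i, hu i⟩ : Ls F (n • poles F z + C))) :=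
    LinearIndependent.of_comp (Ls F (n • poles F z + C)).subtype hli
  have := hli2.fintype_card_le_finrank
  simpa [dg, ell] using this

theorem degD_poles {z : X} (hz : Transcendental F z) : degD F (poles F z) = dg F z := by
  refine le_antisymm (degD_poles_le F hz) ?_
  obtain ⟨C, hC, h⟩ := exists_large F hz
  obtain ⟨c, hc⟩ := ell_le F C hC
  have h2 : ∀ n : ℕ, (dg F z * (n + 1) : ℤ) ≤ n * degD F (poles F z) + c := fun n => by
    have h3 := hc (n • poles F z) (nsmul_nonneg (poles_nonneg F z) n)
    have h4 := h n
    rw [map_nsmul, nsmul_eq_mul] at h3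
    refine le_trans ?_ h3
    exact_mod_cast h4
  by_contra! hlt
  have h5 := h2 c.toNat
  have h6 : c ≤ c.toNat := Int.self_le_toNat c
  have h7 : (0 : ℤ) ≤ c.toNat := by positivity
  nlinarith [degD_nonneg F (poles_nonneg F z)]

theorem degD_dv (z : X) : degD F (dv F z) = 0 := by
  by_cases hz : Transcendental F z
  · have hz2 : Transcendental F z⁻¹ := fun h => hz (by simpa using h.inv)
    rw [dv_eq, map_sub, degD_poles F hz, degD_poles F hz2, dg_inv, sub_self]
  · have : dv F z = 0 := by
      ext V
      rw [dv_apply, ord_of_alg F (not_not.1 hz) V]; rfl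
    rw [this, map_zero]

theorem mul_mem_Ls {z x : X} (hz : z ≠ 0) (D : Place X →₀ ℤ) : x * z ∈ Ls F (D - dv F z) ↔ x ∈ Ls F D := by
  rw [mem_Ls, mem_Ls]
  refine forall_congr' fun V => ?_
  by_cases hx : x = 0
  · simp [hx, Place.G_zero]
  rw [V.G_iff (mul_ne_zero hx hz), V.G_iff hx, V.ord_mul hx hz, Finsupp.sub_apply, dv_apply]
  constructor <;> intro h <;> linarith

theorem ell_sub_dv {z : X} (hz : z ≠ 0) (D : Place X →₀ ℤ) : ell F (D - dv F z) = ell F D := by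
  have e : Ls F D ≃ₗ[F] Ls F (D - dv F z) :=
    LinearEquiv.ofBijective
      (LinearMap.codRestrict _ ((LinearMap.mulRight F z).comp (Ls F D).subtype)
        (fun x => (mul_mem_Ls F hz D).2 x.2)) ⟨by
          intro a b h
          have : (a : X) * z = b * z := congrArg Subtype.val h
          exact Subtype.ext (mul_right_cancel₀ hz this), by
          rintro ⟨y, hy⟩
          have : y = y * z⁻¹ * z := by field_simp
          rw [this] at hy
          refine ⟨⟨y * z⁻¹, (mul_mem_Ls F hz D).1 hy⟩, ?_⟩
          apply Subtype.ext
          exact this.symm⟩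
  exact e.finrank_eq.symm

theorem residue_pow (V : Place X) (x : X) (hx : V.G 0 x) : V.G 1 (x ^ (Nat.card V.res) - x) := by
  have := Place.finite_res' F V
  let a : V.A := ⟨x, V.mem_iff.2 hx⟩
  have h : IsLocalRing.residue V.A (a ^ Nat.card V.res - a) = 0 := by
    have := Fintype.ofFinite V.res
    rw [map_sub, map_pow, Nat.card_eq_fintype_card, FiniteField.pow_card, sub_self]
  rw [IsLocalRing.residue_eq_zero_iff, Place.mem_max_iff] at h
  exact h

/-- every divisor is dominated, up to principal divisors, by a multiple of the pole divisor -/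
theorem exists_dominate {z : X} (hz : Transcendental F z) (D : Place X →₀ ℤ) :
    ∃ t : X, t ≠ 0 ∧ ∃ n : ℕ, D - dv F t ≤ n • poles F z := by
  classical
  have hz0 : z ≠ 0 := by rintro rfl; exact hz (isAlgebraic_zero)
  let S := D.support.filter (fun V => 0 ≤ V.ord z)
  let M : ℕ := ∑ V ∈ D.support, (D V).natAbs
  have hM : ∀ V, D V ≤ M := by
    intro V
    by_cases hV : V ∈ D.support
    · have : (D V).natAbs ≤ M := Finset.single_le_sum (f := fun V => (D V).natAbs) (fun _ _ => Nat.zero_le _) hV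
      omega
    · rw [Finsupp.notMem_support_iff.1 hV]; positivity
  let c : Place X → ℕ := fun V => Nat.card V.res
  have hc : ∀ V, 1 < c V := fun V => by
    have := Place.finite_res' F V
    exact Finite.one_lt_card
  let p : F[X] := ∏ V ∈ S, (Polynomial.X ^ c V - Polynomial.X) ^ M
  have hp : p ≠ 0 := Finset.prod_ne_zero_iff.2 fun V _ => pow_ne_zero _ (FiniteField.X_pow_card_sub_X_ne_zero F (hc V))
  have ht : aeval z p ≠ 0 := fun h => hp ((transcendental_iff.1 hz) _ h)
  have hG : ∀ V : Place X, 0 ≤ V.ord z → ∀ q : F[X], V.G 0 (aeval z q) := by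
    intro V hV q
    have h1 : z ∈ asSub F V.A := mem_asSub.2 (V.mem_iff.2 ((V.G_iff hz0).2 hV))
    have h2 : aeval z q ∈ asSub F V.A :=
      Algebra.adjoin_le (Set.singleton_subset_iff.2 h1) (aeval_mem_adjoin_singleton F z)
    exact V.mem_iff.1 h2
  refine ⟨aeval z p, ht, p.natDegree + M, fun V => ?_⟩
  simp only [Finsupp.sub_apply, dv_apply, Finsupp.smul_apply, poles_apply, nsmul_eq_mul]
  have hMV := hM V
  by_cases hV : 0 ≤ V.ord z
  · rw [max_eq_right (by omega), mul_zero]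
    have h0 := (V.G_iff ht).1 (hG V hV p)
    by_cases hVS : V ∈ D.support
    · have hVS2 : V ∈ S := Finset.mem_filter.2 ⟨hVS, hV⟩
      have h1 : V.G M (aeval z p) := by
        have : p = (Polynomial.X ^ c V - Polynomial.X) ^ M * ∏ V ∈ S.erase V, (Polynomial.X ^ c V - Polynomial.X) ^ M :=
          (Finset.mul_prod_erase S _ hVS2).symm
        rw [this, map_mul]
        have h2 : V.G M (aeval z ((Polynomial.X ^ c V - Polynomial.X : F[X]) ^ M)) := by
          simp only [map_pow, map_sub, aeval_X]
          have h3 := residue_pow F V z ((V.G_iff hz0).2 hV)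
          have h4 : z ^ c V - z ≠ 0 := by
            intro h
            apply FiniteField.X_pow_card_sub_X_ne_zero F (hc V)
            apply (transcendental_iff.1 hz)
            simpa using h
          rw [V.G_iff (pow_ne_zero _ h4), V.ord_pow]
          have := (V.G_iff h4).1 h3
          nlinarith
        have := V.G_mul h2 (hG V hV (∏ V ∈ S.erase V, (Polynomial.X ^ c V - Polynomial.X) ^ M))
        rwa [add_zero] at this
      have := (V.G_iff ht).1 h1
      omega
    · rw [Finsupp.notMem_support_iff.1 hVS]; omega
  · rw [max_eq_left (by omega)]
    have h1 : V.G (p.natDegree * V.ord z) (aeval z p) := by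
      rw [aeval_eq_sum_range]
      refine V.G_sum _ _ fun i hi => (V.fil F _).smul_mem _ ?_
      rw [Place.mem_fil, V.G_iff (pow_ne_zero _ hz0), V.ord_pow]
      have : (i : ℤ) ≤ p.natDegree := by have := Finset.mem_range.1 hi; omega
      nlinarith
    have := (V.G_iff ht).1 h1
    push_cast
    nlinarith

theorem riemann_bound : ∃ γ : ℤ, ∀ D : Place X →₀ ℤ, degD F D - ell F D ≤ γ := by
  obtain ⟨z, hz⟩ := exists_transcendental F X
  obtain ⟨C, hC, hl⟩ := exists_large F hz
  refine ⟨degD F C - dg F z, fun D => ?_⟩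
  obtain ⟨t, ht, n, hn⟩ := exists_dominate F hz D
  have h1 := sub_ell_mono F (le_trans hn (le_add_of_nonneg_right hC))
  rw [map_sub, degD_dv, ell_sub_dv F ht, sub_zero, map_add, map_nsmul, degD_poles F hz, nsmul_eq_mul] at h1
  have h2 : ((dg F z * (n + 1) : ℕ) : ℤ) ≤ _ := Nat.cast_le.2 (hl n)
  push_cast at h2
  linarith

theorem exists_pos {D : Place X →₀ ℤ} (h : 0 < ell F D) : ∃ z : X, z ≠ 0 ∧ 0 ≤ D + dv F z := by
  obtain ⟨x, hx⟩ := Module.finrank_pos_iff_exists_ne_zero.1 h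
  have hx0 : (x : X) ≠ 0 := fun h => hx (Subtype.ext h)
  refine ⟨x, hx0, fun V => ?_⟩
  have := (V.G_iff hx0).1 (x.2 V)
  simp only [Finsupp.coe_zero, Pi.zero_apply, Finsupp.add_apply, dv_apply]
  linarith

theorem dv_inv (z : X) : dv F z⁻¹ = - dv F z := by
  ext V; simp [dv_apply, Place.ord_inv]

theorem dv_mul {z w : X} (hz : z ≠ 0) (hw : w ≠ 0) : dv F (z * w) = dv F z + dv F w := by
  ext V; simp [dv_apply, Place.ord_mul V hz hw]

theorem ell_add_dv {z : X} (hz : z ≠ 0) (D : Place X →₀ ℤ) : ell F (D + dv F z) = ell F D := by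
  have := ell_sub_dv F (inv_ne_zero hz) D
  rwa [dv_inv, sub_neg_eq_add] at this

theorem riemann : ∃ γ c : ℤ, ∀ D : Place X →₀ ℤ, c ≤ degD F D → (ell F D : ℤ) = degD F D - γ := by
  obtain ⟨γ, hγ⟩ := riemann_bound F (X := X)
  obtain ⟨γ', ⟨D0, hD0⟩, hmax⟩ := Int.exists_greatest_of_bdd
    (P := fun n => ∃ D : Place X →₀ ℤ, degD F D - ell F D = n)
    ⟨γ, by rintro n ⟨D, rfl⟩; exact hγ D⟩ ⟨_, 0, rfl⟩
  refine ⟨γ', γ' + 1 + degD F D0, fun D hD => ?_⟩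
  have h1 := hmax _ ⟨D, rfl⟩
  have h2 := hmax _ ⟨D - D0, rfl⟩
  rw [map_sub] at h2
  obtain ⟨z, hz, hpos⟩ := exists_pos F (D := D - D0) (by omega)
  have h3 : D0 ≤ D + dv F z := by
    have : D + dv F z - D0 = D - D0 + dv F z := by abel
    rw [← sub_nonneg, this]; exact hpos
  have h4 := sub_ell_mono F h3
  rw [map_add, degD_dv, ell_add_dv F hz] at h4
  omega

end
end FF
end

section
open IntermediateField Polynomial
namespace FF
set_option linter.unusedSectionVars false
set_option linter.unusedVariables false
section
variable (F : Type*) {X : Type*} [Field F] [Field X] [Algebra F X] [Finite F] [GFF F X]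
include F

theorem single_nonneg (V : Place X) (n : ℕ) : (0 : Place X →₀ ℤ) ≤ Finsupp.single V (n : ℤ) := by
  classical
  intro W
  simp only [Finsupp.single_apply, Finsupp.coe_zero, Pi.zero_apply]
  split <;> positivity

theorem exists_ell_gt (W : Place X) (B : ℕ) : ∃ n : ℕ, B < ell F (Finsupp.single W (n : ℤ)) := by
  obtain ⟨γ, hγ⟩ := riemann_bound F (X := X)
  refine ⟨(B + γ + 1).toNat, ?_⟩
  have := hγ (Finsupp.single W ((B + γ + 1).toNat : ℤ))
  rw [degD_single] at this
  have h1 := W.deg_pos F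
  have h2 : B + γ + 1 ≤ (B + γ + 1).toNat := Int.self_le_toNat _
  have h3 : ((B + γ + 1).toNat : ℤ) ≤ (B + γ + 1).toNat * W.deg F := by
    have : (0 : ℤ) ≤ (B + γ + 1).toNat := by positivity
    have : (1 : ℤ) ≤ W.deg F := by omega
    nlinarith
  omega

theorem finite_deg_le (B : ℕ) : {V : Place X | V.deg F ≤ B}.Finite := by
  classical
  obtain ⟨W⟩ := exists_place F (X := X)
  obtain ⟨n, hn⟩ := exists_ell_gt F W B
  have hfin : Finite (Ls F (Finsupp.single W (n : ℤ))) := Module.finite_of_finite F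
  refine Set.Finite.subset ((Set.finite_iUnion (fun f : Ls F (Finsupp.single W (n : ℤ)) =>
    finite_zeros F (f : X))).union (Set.finite_singleton W)) ?_
  intro V hV
  by_cases hVW : V = W
  · right; exact hVW
  left
  have hV : V.deg F ≤ B := hV
  let φ : Ls F (Finsupp.single W (n : ℤ)) →ₗ[F] V.res :=
    (V.lead F 0).comp (Submodule.inclusion (fun x hx => by
      have := hx V
      rw [Place.mem_fil]
      simpa [Finsupp.single_apply, Ne.symm hVW] using this))
  have hker : LinearMap.ker φ ≠ ⊥ := by
    apply LinearMap.ker_ne_bot_of_finrank_lt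
    exact lt_of_le_of_lt hV hn
  obtain ⟨f, hf, hf0⟩ := Submodule.exists_mem_ne_zero_of_ne_bot hker
  refine Set.mem_iUnion.2 ⟨f, ?_⟩
  have h1 := (Place.lead_eq_zero F _).1 (LinearMap.mem_ker.1 hf)
  have h0 : (f : X) ≠ 0 := fun h => hf0 (Subtype.ext h)
  have h2 := (V.G_iff h0).1 h1
  change 0 < V.ord (f : X)
  omega

theorem le_degD {D : Place X →₀ ℤ} (hD : 0 ≤ D) (V : Place X) : D V * V.deg F ≤ degD F D := by
  classical
  by_cases h : V ∈ D.support
  · rw [degD_eq]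
    exact Finset.single_le_sum (f := fun V => D V * (V.deg F : ℤ))
      (fun V _ => mul_nonneg (hD V) (by positivity)) h
  · rw [Finsupp.notMem_support_iff.1 h, zero_mul]; exact degD_nonneg F hD

theorem finite_eff (B : ℤ) : {D : Place X →₀ ℤ | 0 ≤ D ∧ degD F D ≤ B}.Finite := by
  classical
  let P := (finite_deg_le F (X := X) B.toNat).toFinset
  refine (Set.finite_Icc (0 : Place X →₀ ℤ) (∑ V ∈ P, Finsupp.single V B)).subset ?_
  rintro D ⟨hD, hB⟩
  refine ⟨hD, fun V => ?_⟩
  have h1 := le_degD F hD V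
  have h2 := hD V
  simp only [Finsupp.coe_zero, Pi.zero_apply] at h2
  have h3 := V.deg_pos F
  rw [Finsupp.finsetSum_apply]
  by_cases hV : D V = 0
  · rw [hV]
    refine Finset.sum_nonneg fun W _ => ?_
    have := degD_nonneg F hD
    simp only [Finsupp.single_apply]
    split <;> omega
  · have h4 : V ∈ P := by
      rw [Set.Finite.mem_toFinset]
      change V.deg F ≤ B.toNat
      have : (V.deg F : ℤ) ≤ D V * V.deg F := by
        have : 1 ≤ D V := by omega
        nlinarith
      omega
    rw [Finset.sum_eq_single V]
    · rw [Finsupp.single_eq_same]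
      have : (1 : ℤ) ≤ V.deg F := by omega
      nlinarith
    · intro W _ hW; rw [Finsupp.single_eq_of_ne (Ne.symm hW)]
    · intro h; exact absurd h4 h

/-- principal divisors -/
noncomputable def prin : AddSubgroup (Place X →₀ ℤ) where
  carrier := {D | ∃ z : X, z ≠ 0 ∧ D = dv F z}
  zero_mem' := ⟨1, one_ne_zero, by ext V; simp [dv_apply, Place.ord_one]⟩
  add_mem' := by
    rintro _ _ ⟨z, hz, rfl⟩ ⟨w, hw, rfl⟩
    exact ⟨z * w, mul_ne_zero hz hw, (dv_mul F hz hw).symm⟩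
  neg_mem' := by
    rintro _ ⟨z, hz, rfl⟩
    exact ⟨z⁻¹, inv_ne_zero hz, (dv_inv F z).symm⟩

variable {F} in
theorem mem_prin {D : Place X →₀ ℤ} : D ∈ prin F ↔ ∃ z : X, z ≠ 0 ∧ D = dv F z := Iff.rfl

variable (X) in
abbrev Cl := (Place X →₀ ℤ) ⧸ prin F (X := X)

noncomputable def cl (D : Place X →₀ ℤ) : Cl F X := QuotientAddGroup.mk D

theorem cl_eq {D E : Place X →₀ ℤ} : cl F D = cl F E ↔ ∃ z : X, z ≠ 0 ∧ E = D + dv F z := by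
  rw [cl, cl, QuotientAddGroup.eq, mem_prin]
  refine exists_congr fun z => and_congr_right fun _ => ?_
  rw [neg_add_eq_iff_eq_add]

noncomputable def degC : Cl F X →+ ℤ :=
  QuotientAddGroup.lift _ (degD F).toAddMonoidHom (by
    rintro _ ⟨z, hz, rfl⟩
    exact degD_dv F z)

theorem degC_cl (D : Place X →₀ ℤ) : degC F (cl F D) = degD F D := rfl

theorem cl_surj (c : Cl F X) : ∃ D, cl F D = c := QuotientAddGroup.mk_surjective c

theorem cl_add (D E : Place X →₀ ℤ) : cl F (D + E) = cl F D + cl F E := rfl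

/-- effective divisors in a class -/
def Eff (c : Cl F X) : Set (Place X →₀ ℤ) := {E | 0 ≤ E ∧ cl F E = c}

theorem finite_Eff (c : Cl F X) : (Eff F c).Finite := by
  refine (finite_eff F (degC F c)).subset ?_
  rintro E ⟨h, rfl⟩
  exact ⟨h, le_of_eq (degC_cl F E).symm⟩

theorem ord_of_L0 {x : X} (hx : x ∈ Ls F (0 : Place X →₀ ℤ)) (h0 : x ≠ 0) (V : Place X) : V.ord x = 0 := by
  have h : 0 ≤ dv F x := fun W => by
    have := (W.G_iff h0).1 (hx W)
    simpa [dv_apply] using this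
  have h1 := le_degD F h V
  rw [degD_dv, dv_apply] at h1
  have h2 := h V
  simp only [Finsupp.coe_zero, Pi.zero_apply, dv_apply] at h2
  have : (1 : ℤ) ≤ V.deg F := by have := V.deg_pos F; omega
  nlinarith

theorem dv_eq_iff {x y : X} (hx : x ≠ 0) (hy : y ≠ 0) :
    dv F x = dv F y ↔ y * x⁻¹ ∈ Ls F (0 : Place X →₀ ℤ) := by
  have hxy : y * x⁻¹ ≠ 0 := mul_ne_zero hy (inv_ne_zero hx)
  have h : dv F (y * x⁻¹) = dv F y - dv F x := by
    rw [dv_mul F hy (inv_ne_zero hx), dv_inv]; abel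
  constructor
  · intro he V
    rw [V.G_iff hxy, ← dv_apply F, h, he]; simp
  · intro hm
    ext V
    have := ord_of_L0 F hm hxy V
    rw [← dv_apply F, h, Finsupp.sub_apply] at this
    omega

theorem card_Ls (D : Place X →₀ ℤ) : Nat.card (Ls F D) = Nat.card F ^ ell F D :=
  Module.natCard_eq_pow_finrank

theorem card_Eff (D : Place X →₀ ℤ) :
    (Nat.card (Ls F (0 : Place X →₀ ℤ)) - 1) * (Eff F (cl F D)).ncard = Nat.card F ^ ell F D - 1 := by
  classical
  have hfinL : ∀ D : Place X →₀ ℤ, (Ls F D : Set X).Finite := fun D => by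
    have : Finite (Ls F D) := Module.finite_of_finite F
    exact Set.toFinite _
  let s := (hfinL D).toFinset.erase 0
  let s0 := (hfinL 0).toFinset.erase 0
  let t := (finite_Eff F (cl F D)).toFinset
  have hcard : ∀ D : Place X →₀ ℤ, ((hfinL D).toFinset.erase 0).card = Nat.card (Ls F D) - 1 := fun D => by
    rw [Finset.card_erase_of_mem (by simp), ← Set.ncard_eq_toFinset_card _ (hfinL D)]; rfl
  have hs : s.card = Nat.card F ^ ell F D - 1 := by rw [hcard, card_Ls]
  have hs0 : s0.card = Nat.card (Ls F (0 : Place X →₀ ℤ)) - 1 := hcard 0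
  have ht : t.card = (Eff F (cl F D)).ncard := (Set.ncard_eq_toFinset_card _ _).symm
  rw [← hs, ← hs0, ← ht]
  have hms : ∀ x, x ∈ s ↔ x ≠ 0 ∧ x ∈ Ls F D := by intro x; simp [s]
  have hms0 : ∀ x, x ∈ s0 ↔ x ≠ 0 ∧ x ∈ Ls F (0 : Place X →₀ ℤ) := by intro x; simp [s0]
  have hmt : ∀ E, E ∈ t ↔ 0 ≤ E ∧ cl F E = cl F D := by intro E; simp [t, Eff]
  have hnn : ∀ x : X, x ≠ 0 → (x ∈ Ls F D ↔ 0 ≤ D + dv F x) := by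
    intro x hx
    rw [mem_Ls]
    refine forall_congr' fun V => ?_
    rw [V.G_iff hx]
    simp only [Finsupp.coe_zero, Pi.zero_apply, Finsupp.add_apply, dv_apply]
    constructor <;> intro h <;> linarith
  have hmap : ∀ x ∈ s, D + dv F x ∈ t := by
    intro x hx
    rw [hms] at hx
    rw [hmt]
    exact ⟨(hnn x hx.1).1 hx.2, ((cl_eq F).2 ⟨x, hx.1, rfl⟩).symm⟩
  rw [Finset.card_eq_sum_card_fiberwise hmap, Finset.sum_const_nat (m := s0.card), mul_comm]
  intro E hE
  rw [hmt] at hE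
  obtain ⟨z, hz, rfl⟩ := (cl_eq F).1 hE.2.symm
  refine (Finset.card_bij (fun x _ => x * z) ?_ ?_ ?_).symm
  · intro x hx
    rw [hms0] at hx
    rw [Finset.mem_filter, hms]
    have hxz := mul_ne_zero hx.1 hz
    have h1 : dv F z = dv F (x * z) := by
      rw [dv_eq_iff F hz hxz]
      convert hx.2 using 1; field_simp
    refine ⟨⟨hxz, ?_⟩, ?_⟩
    · rw [hnn _ hxz, ← h1]; exact hE.1
    · rw [← h1]
  · intro a _ b _ h
    exact mul_right_cancel₀ hz h
  · intro y hy
    rw [Finset.mem_filter, hms] at hy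
    have h1 := add_left_cancel hy.2
    refine ⟨y * z⁻¹, ?_, ?_⟩
    · rw [hms0]
      exact ⟨mul_ne_zero hy.1.1 (inv_ne_zero hz), (dv_eq_iff F hz hy.1.1).1 h1.symm⟩
    · field_simp

theorem exists_eff_of_deg : ∃ M : ℤ, ∀ D : Place X →₀ ℤ, M ≤ degD F D → ∃ E, 0 ≤ E ∧ cl F E = cl F D := by
  obtain ⟨γ, hγ⟩ := riemann_bound F (X := X)
  refine ⟨γ + 1, fun D hD => ?_⟩
  have := hγ D
  obtain ⟨z, hz, h⟩ := exists_pos F (D := D) (by omega)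
  exact ⟨_, h, ((cl_eq F).2 ⟨z, hz, rfl⟩).symm⟩

variable (X) in
theorem finite_Cl : ∃ h : ℕ, ∀ n : ℤ, {c : Cl F X | degC F c = n}.Finite ∧
    {c : Cl F X | degC F c = n}.ncard ≤ h := by
  classical
  obtain ⟨M, hM⟩ := exists_eff_of_deg F (X := X)
  obtain ⟨W⟩ := exists_place F (X := X)
  have hw : (0 : ℤ) < W.deg F := by have := W.deg_pos F; omega
  let T := {D : Place X →₀ ℤ | 0 ≤ D ∧ degD F D ≤ M + W.deg F}
  have hT : T.Finite := finite_eff F _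
  refine ⟨T.ncard, fun n => ?_⟩
  let k := (n - M) / W.deg F
  have hk1 := Int.emod_nonneg (n - M) hw.ne'
  have hk2 := Int.emod_lt_of_pos (n - M) hw
  have hk3 := Int.emod_add_mul_ediv (n - M) (W.deg F)
  have hsub : {c : Cl F X | degC F c = n} ⊆ (fun E => cl F (E + Finsupp.single W k)) '' T := by
    intro c hc
    obtain ⟨D, rfl⟩ := cl_surj F c
    have hc : degD F D = n := hc
    have hdeg : degD F (D - Finsupp.single W k) = (n - M) % W.deg F + M := by
      rw [map_sub, degD_single, hc]
      simp only [k]; linarith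
    obtain ⟨E, hE, hcl⟩ := hM (D - Finsupp.single W k) (by omega)
    refine ⟨E, ⟨hE, ?_⟩, ?_⟩
    · rw [← degC_cl, hcl, degC_cl, hdeg]; omega
    · change cl F (E + _) = _
      rw [cl_add, hcl, ← cl_add, sub_add_cancel]
  exact ⟨(hT.image _).subset hsub, (Set.ncard_le_ncard hsub (hT.image _)).trans (Set.ncard_image_le hT)⟩

end
end FF
end

section
namespace FF
section
open Filter Topology

theorem box_sum {ι : Type*} (f : ι → ℝ) (S : Finset ι) (N : ℕ) :
    ∑ D ∈ S.finsupp (fun _ => Finset.range N), D.prod (fun i n => f i ^ n) =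
      ∏ i ∈ S, ∑ n ∈ Finset.range N, f i ^ n := by
  classical
  rw [Finset.prod_sum, Finset.finsupp, Finset.sum_map]
  refine Finset.sum_congr rfl fun p _ => ?_
  simp only [Function.Embedding.coeFn_mk]
  rw [Finsupp.prod_of_support_subset _ (Finsupp.support_indicator_subset _ _) _ (by simp),
    ← Finset.prod_attach]
  refine Finset.prod_congr rfl fun i _ => ?_
  rw [Finsupp.indicator_of_mem i.2]

theorem euler_tendsto {ι : Type*} (f : ι → ℝ) (hf : ∀ i, |f i| < 1)
    (hs : Summable (fun D : ι →₀ ℕ => D.prod (fun i n => f i ^ n))) :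
    Tendsto (fun S : Finset ι => ∏ i ∈ S, (1 - f i)⁻¹) atTop
      (𝓝 (∑' D : ι →₀ ℕ, D.prod (fun i n => f i ^ n))) := by
  classical
  have hL := hs.hasSum
  rw [Metric.tendsto_atTop]
  intro ε hε
  rw [HasSum, SummationFilter.unconditional_filter, Metric.tendsto_atTop] at hL
  obtain ⟨T0, hT0⟩ := hL (ε/2) (by positivity)
  refine ⟨T0.biUnion (fun D => D.support), fun S hS => ?_⟩
  let N0 : ℕ := ∑ D ∈ T0, ∑ i ∈ D.support, D i
  have hbox : ∀ N, N0 + 1 ≤ N → T0 ⊆ S.finsupp (fun _ => Finset.range N) := by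
    intro N hN D hD
    rw [Finset.mem_finsupp_iff]
    refine ⟨(Finset.subset_biUnion_of_mem (fun D : ι →₀ ℕ => D.support) hD).trans hS, fun i hi => ?_⟩
    rw [Finset.mem_range]
    by_cases hi2 : i ∈ D.support
    · have h1 : D i ≤ ∑ i ∈ D.support, D i :=
        Finset.single_le_sum (f := fun i => D i) (fun _ _ => Nat.zero_le _) hi2
      have h2 : ∑ i ∈ D.support, D i ≤ N0 :=
        Finset.single_le_sum (f := fun D : ι →₀ ℕ => ∑ i ∈ D.support, D i) (fun _ _ => Nat.zero_le _) hD
      omega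
    · rw [Finsupp.notMem_support_iff.1 hi2]; omega
  have hlim : Tendsto (fun N : ℕ => ∏ i ∈ S, ∑ n ∈ Finset.range N, f i ^ n) atTop
      (𝓝 (∏ i ∈ S, (1 - f i)⁻¹)) :=
    tendsto_finsetProd _ fun i _ => (hasSum_geometric_of_abs_lt_one (hf i)).tendsto_sum_nat
  have hle : dist (∏ i ∈ S, (1 - f i)⁻¹) (∑' D : ι →₀ ℕ, D.prod (fun i n => f i ^ n)) ≤ ε / 2 := by
    refine le_of_tendsto (hlim.dist tendsto_const_nhds) ?_
    filter_upwards [eventually_ge_atTop (N0 + 1)] with N hN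
    rw [← box_sum]
    exact (hT0 _ (hbox N hN)).le
  linarith

end
end FF
end

section
namespace FF
section
open Filter Topology

theorem sum_by_degree {α : Type*} (δ : α → ℕ) (w : α → ℝ) (hw : ∀ a, |w a| ≤ 1)
    (hfin : ∀ n, {a | δ a = n}.Finite) (C q x : ℝ) (hx : 0 ≤ x) (hq : 0 ≤ q) (hqx : q * x < 1)
    (hC : ∀ n, ({a | δ a = n}.ncard : ℝ) ≤ C * q ^ n) :
    Summable (fun a => w a * x ^ δ a) ∧ Summable (fun n => (∑ a ∈ (hfin n).toFinset, w a) * x ^ n) ∧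
    ∑' a, w a * x ^ δ a = ∑' n, (∑ a ∈ (hfin n).toFinset, w a) * x ^ n := by
  classical
  have hF : ∀ n, Fintype {a // δ a = n} := fun n => (hfin n).fintype
  have hsumw : ∀ n, ∀ v : α → ℝ, ∑' a : {a // δ a = n}, v a = ∑ a ∈ (hfin n).toFinset, v a := by
    intro n v
    rw [tsum_fintype]
    exact Finset.sum_bij (fun a _ => a.1) (fun a _ => by simpa using a.2) (fun a _ b _ h => Subtype.ext h)
      (fun b hb => ⟨⟨b, by simpa using hb⟩, Finset.mem_univ _, rfl⟩) (fun _ _ => rfl)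
  have hgeo : Summable (fun n : ℕ => C * (q * x) ^ n) :=
    (summable_geometric_of_lt_one (by positivity) hqx).mul_left C
  let e := Equiv.sigmaFiberEquiv δ
  have habs : Summable (fun a => |w a * x ^ δ a|) := by
    rw [← e.summable_iff]
    refine (summable_sigma_of_nonneg (f := (fun a => |w a * x ^ δ a|) ∘ e) (fun _ => abs_nonneg _)).2 ?_
    refine ⟨fun n => Summable.of_finite, ?_⟩
    refine Summable.of_nonneg_of_le (fun n => tsum_nonneg fun _ => abs_nonneg _) (fun n => ?_) hgeo
    have : ∀ a : {a // δ a = n}, ((fun a => |w a * x ^ δ a|) ∘ e) ⟨n, a⟩ = (fun a : α => |w a * x ^ n|) a := by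
      rintro ⟨a, rfl⟩; rfl
    simp only [this]
    rw [hsumw n (fun a : α => |w a * x ^ n|)]
    calc ∑ a ∈ (hfin n).toFinset, |w a * x ^ n| ≤ ∑ a ∈ (hfin n).toFinset, x ^ n := by
          refine Finset.sum_le_sum fun a _ => ?_
          rw [abs_mul, abs_of_nonneg (pow_nonneg hx n)]
          exact mul_le_of_le_one_left (pow_nonneg hx n) (hw a)
      _ = ({a | δ a = n}.ncard : ℝ) * x ^ n := by
          rw [Finset.sum_const, nsmul_eq_mul, Set.ncard_eq_toFinset_card _ (hfin n)]
      _ ≤ C * q ^ n * x ^ n := by gcongr; exact hC n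
      _ = C * (q * x) ^ n := by rw [mul_pow]; ring
  have hs := habs.of_abs
  have hs2 := e.summable_iff.2 hs
  have hterm : ∀ n, ∑' a : {a // δ a = n}, ((fun a => w a * x ^ δ a) ∘ e) ⟨n, a⟩ =
      (∑ a ∈ (hfin n).toFinset, w a) * x ^ n := by
    intro n
    have : ∀ a : {a // δ a = n}, ((fun a => w a * x ^ δ a) ∘ e) ⟨n, a⟩ = (fun a : α => w a * x ^ n) a := by
      rintro ⟨a, rfl⟩; rfl
    simp only [this]
    rw [hsumw n (fun a : α => w a * x ^ n), Finset.sum_mul]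
  refine ⟨hs, ?_, ?_⟩
  · have := hs2.sigma
    simpa only [hterm] using this
  · rw [← e.tsum_eq]
    exact (hs2.tsum_sigma' (fun n => Summable.of_finite)).trans (tsum_congr hterm)

theorem one_sub_inv_ge {u : ℝ} (hu : u < 1) : Real.exp u ≤ (1 - u)⁻¹ := by
  have h := Real.add_one_le_exp (-u)
  rw [Real.exp_neg] at h
  rw [le_inv_comm₀ (Real.exp_pos _) (by linarith)]
  linarith

theorem one_sub_inv_le {u : ℝ} (hu0 : 0 ≤ u) (hu : u ≤ 1/2) : (1 - u)⁻¹ ≤ Real.exp (u + 2 * u ^ 2) := by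
  have h1 : (1 - u)⁻¹ = 1 + u / (1 - u) := by
    have : 1 - u ≠ 0 := by linarith
    field_simp; ring
  have h2 := Real.add_one_le_exp (u / (1 - u))
  have h3 : u / (1 - u) ≤ u + 2 * u ^ 2 := by
    rw [div_le_iff₀ (by linarith)]
    nlinarith [mul_nonneg (mul_nonneg hu0 hu0) (by linarith : (0:ℝ) ≤ 1 - 2 * u)]
  calc _ = u / (1-u) + 1 := by rw [h1]; ring
    _ ≤ _ := h2
    _ ≤ _ := Real.exp_le_exp.2 h3

/-- upper bound from Euler product -/
theorem euler_upper {ι : Type*} (f : ι → ℝ) (hf : ∀ i, |f i| < 1)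
    (hs : Summable (fun D : ι →₀ ℕ => D.prod (fun i n => f i ^ n))) (hfs : Summable f) :
    Real.exp (∑' i, f i) ≤ ∑' D : ι →₀ ℕ, D.prod (fun i n => f i ^ n) := by
  have h1 := euler_tendsto f hf hs
  have h2 : Tendsto (fun S : Finset ι => Real.exp (∑ i ∈ S, f i)) atTop (𝓝 (Real.exp (∑' i, f i))) :=
    (Real.continuous_exp.tendsto _).comp hfs.hasSum
  refine le_of_tendsto_of_tendsto' h2 h1 fun S => ?_
  rw [Real.exp_sum]
  exact Finset.prod_le_prod (fun i _ => (Real.exp_pos _).le) fun i _ => one_sub_inv_ge (abs_lt.1 (hf i)).2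

theorem summable_of_euler {ι : Type*} (f : ι → ℝ) (hf0 : ∀ i, 0 ≤ f i)
    (hs : Summable (fun D : ι →₀ ℕ => D.prod (fun i n => f i ^ n))) : Summable f := by
  have hinj : Function.Injective (fun i : ι => Finsupp.single i (1 : ℕ)) :=
    Finsupp.single_left_injective one_ne_zero
  have := hs.comp_injective hinj
  refine this.congr fun i => ?_
  simp

theorem euler_lower {ι : Type*} (f : ι → ℝ) (hf0 : ∀ i, 0 ≤ f i) (hf : ∀ i, f i ≤ 1/2)
    (hs : Summable (fun D : ι →₀ ℕ => D.prod (fun i n => f i ^ n))) :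
    ∑' D : ι →₀ ℕ, D.prod (fun i n => f i ^ n) ≤ Real.exp (∑' i, f i + 2 * ∑' i, f i ^ 2) := by
  have hfs := summable_of_euler f hf0 hs
  have hfs2 : Summable (fun i => f i ^ 2) := hfs.of_nonneg_of_le (fun i => sq_nonneg _)
    (fun i => by nlinarith [hf0 i, hf i])
  refine le_of_tendsto' (euler_tendsto f (fun i => ?_) hs) fun S => ?_
  · rw [abs_of_nonneg (hf0 i)]; linarith [hf i]
  · calc ∏ i ∈ S, (1 - f i)⁻¹ ≤ ∏ i ∈ S, Real.exp (f i + 2 * f i ^ 2) :=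
        Finset.prod_le_prod (fun i _ => inv_nonneg.2 (by linarith [hf i])) fun i _ => one_sub_inv_le (hf0 i) (hf i)
      _ = Real.exp (∑ i ∈ S, f i + 2 * ∑ i ∈ S, f i ^ 2) := by
        rw [← Real.exp_sum, Finset.sum_add_distrib, Finset.mul_sum]
      _ ≤ _ := by
        apply Real.exp_le_exp.2
        gcongr
        · exact hfs.sum_le_tsum _ (fun i _ => hf0 i)
        · exact hfs2.sum_le_tsum _ (fun i _ => sq_nonneg _)

end
end FF
end

section
open IntermediateField Polynomial
namespace FF
set_option linter.unusedSectionVars false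
set_option linter.unusedVariables false
section
open Filter Topology
variable (F : Type*) {X : Type*} [Field F] [Field X] [Algebra F X] [Finite F] [GFF F X]
include F

theorem finite_degEq (n : ℤ) : {D : Place X →₀ ℤ | 0 ≤ D ∧ degD F D = n}.Finite :=
  (finite_eff F n).subset fun _ h => ⟨h.1, h.2.le⟩

/-- class-by-class sum -/
theorem sum_classes (w : (Place X →₀ ℤ) → ℝ) (wc : Cl F X → ℝ) (hw : ∀ D, w D = wc (cl F D)) (n : ℤ)
    (hfin : {c : Cl F X | degC F c = n}.Finite) :
    ∑ D ∈ (finite_degEq F (X := X) n).toFinset, w D =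
      ∑ c ∈ hfin.toFinset, wc c * (Eff F c).ncard := by
  classical
  rw [← Finset.sum_fiberwise_of_maps_to (g := cl F) (t := hfin.toFinset)]
  · refine Finset.sum_congr rfl fun c hc => ?_
    rw [Set.Finite.mem_toFinset] at hc
    have hc : degC F c = n := hc
    have : (finite_degEq F (X := X) n).toFinset.filter (fun D => cl F D = c) = (finite_Eff F c).toFinset := by
      ext D
      rw [Finset.mem_filter, Set.Finite.mem_toFinset, Set.Finite.mem_toFinset]
      constructor
      · rintro ⟨⟨h1, h2⟩, h3⟩; exact ⟨h1, h3⟩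
      · rintro ⟨h1, h3⟩
        refine ⟨⟨h1, ?_⟩, h3⟩
        rw [← degC_cl, h3, hc]
    rw [this, Set.ncard_eq_toFinset_card _ (finite_Eff F c), mul_comm, ← nsmul_eq_mul, ← Finset.sum_const]
    refine Finset.sum_congr rfl fun D hD => ?_
    rw [Set.Finite.mem_toFinset] at hD
    rw [hw, hD.2]
  · intro D hD
    rw [Set.Finite.mem_toFinset] at hD ⊢
    exact hD.2

theorem one_lt_q : 1 < Nat.card F := Finite.one_lt_card

theorem card_L0 : 1 < Nat.card (Ls F (0 : Place X →₀ ℤ)) := by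
  have : Finite (Ls F (0 : Place X →₀ ℤ)) := Module.finite_of_finite F
  have h1 : (1 : X) ∈ Ls F (0 : Place X →₀ ℤ) := fun V => by
    rw [V.G_iff one_ne_zero, V.ord_one]; simp
  have : Nontrivial (Ls F (0 : Place X →₀ ℤ)) := ⟨⟨0, ⟨1, h1⟩, fun h => zero_ne_one (congrArg Subtype.val h)⟩⟩
  exact Finite.one_lt_card

theorem card_Eff_real (D : Place X →₀ ℤ) :
    ((Nat.card (Ls F (0 : Place X →₀ ℤ)) : ℝ) - 1) * (Eff F (cl F D)).ncard = (Nat.card F : ℝ) ^ ell F D - 1 := by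
  have h := card_Eff F D
  have h1 := card_L0 F (X := X)
  have h2 : 1 ≤ Nat.card F ^ ell F D := Nat.one_le_pow _ _ (by have := one_lt_q F; omega)
  have := congrArg (Nat.cast : ℕ → ℝ) h
  rw [Nat.cast_mul, Nat.cast_sub h1.le, Nat.cast_sub h2] at this
  push_cast at this
  exact this

theorem ncard_Eff_le : ∃ m : ℕ, ∀ (c : Cl F X) (n : ℕ), degC F c = n →
    ((Eff F c).ncard : ℝ) ≤ (Nat.card F : ℝ) ^ (n + m) := by
  obtain ⟨c, hc⟩ := ell_le F (0 : Place X →₀ ℤ) le_rfl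
  refine ⟨c.toNat, fun cc n hn => ?_⟩
  have hq : (1 : ℝ) ≤ Nat.card F := by exact_mod_cast (one_lt_q F).le
  by_cases hE : (Eff F cc) = ∅
  · rw [hE]; simp; 
  · obtain ⟨D, hD0, rfl⟩ := Set.nonempty_iff_ne_empty.2 hE
    have h1 := card_Eff_real F D
    have h2 : (2 : ℝ) ≤ Nat.card (Ls F (0 : Place X →₀ ℤ)) := by exact_mod_cast card_L0 F (X := X)
    have h3 := hc D hD0
    rw [add_zero] at h3
    rw [degC_cl] at hn
    have h4 : ell F D ≤ n + c.toNat := by omega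
    have h5 : (Nat.card F : ℝ) ^ ell F D ≤ (Nat.card F : ℝ) ^ (n + c.toNat) := pow_le_pow_right₀ hq h4
    nlinarith [(Nat.cast_nonneg (Eff F (cl F D)).ncard : (0 : ℝ) ≤ _)]

theorem ncard_deg_le : ∃ C : ℝ, 0 ≤ C ∧ ∀ n : ℕ, ({D : Place X →₀ ℤ | 0 ≤ D ∧ degD F D = n}.ncard : ℝ) ≤
    C * (Nat.card F : ℝ) ^ n := by
  obtain ⟨m, hm⟩ := ncard_Eff_le F (X := X)
  obtain ⟨h, hh⟩ := finite_Cl F X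
  refine ⟨h * (Nat.card F : ℝ) ^ m, by positivity, fun n => ?_⟩
  have h1 := sum_classes F (X := X) (fun _ => 1) (fun _ => 1) (fun _ => rfl) n (hh n).1
  rw [Finset.sum_const, nsmul_eq_mul, mul_one, ← Set.ncard_eq_toFinset_card _ (finite_degEq F n)] at h1
  rw [h1]
  calc ∑ c ∈ (hh n).1.toFinset, 1 * ((Eff F c).ncard : ℝ) ≤ ∑ c ∈ (hh n).1.toFinset, (Nat.card F : ℝ) ^ (n + m) := by
        refine Finset.sum_le_sum fun c hc => ?_
        rw [Set.Finite.mem_toFinset] at hc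
        rw [one_mul]
        exact hm c n hc
    _ = ({c : Cl F X | degC F c = n}.ncard : ℝ) * (Nat.card F : ℝ) ^ (n + m) := by
        rw [Finset.sum_const, nsmul_eq_mul, ← Set.ncard_eq_toFinset_card _ (hh n).1]
    _ ≤ h * (Nat.card F : ℝ) ^ (n + m) := by gcongr; exact (hh n).2
    _ = _ := by rw [pow_add]; ring

/-- effective divisors -/
noncomputable def effEquiv : (Place X →₀ ℕ) ≃ {D : Place X →₀ ℤ // 0 ≤ D} where
  toFun D := ⟨D.mapRange (fun n : ℕ => (n : ℤ)) rfl, fun V => by simp⟩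
  invFun D := D.1.mapRange Int.toNat rfl
  left_inv D := by ext V; simp
  right_inv D := by
    apply Subtype.ext; ext V
    simpa using D.2 V

/-- multiplicative extension of a function to divisors -/
noncomputable def Psi (ψ : Place X → ℝ) (D : Place X →₀ ℤ) : ℝ := D.prod fun V n => ψ V ^ n

omit F in
theorem Psi_add (ψ : Place X → ℝ) (h : ∀ V, ψ V ≠ 0) (D E : Place X →₀ ℤ) :
    Psi ψ (D + E) = Psi ψ D * Psi ψ E :=
  Finsupp.prod_add_index' (fun V => zpow_zero _) (fun V m n => zpow_add₀ (h V) m n)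

omit F in
theorem Psi_single (ψ : Place X → ℝ) (V : Place X) (n : ℤ) : Psi ψ (Finsupp.single V n) = ψ V ^ n :=
  Finsupp.prod_single_index (zpow_zero _)

omit F in
theorem Psi_pm (ψ : Place X → ℝ) (h : ∀ V, ψ V = 1 ∨ ψ V = -1) (D : Place X →₀ ℤ) :
    Psi ψ D = 1 ∨ Psi ψ D = -1 := by
  classical
  unfold Psi Finsupp.prod
  refine Finset.prod_induction _ (fun a => a = 1 ∨ a = -1) ?_ (Or.inl rfl) ?_
  · rintro a b (rfl | rfl) (rfl | rfl) <;> simp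
  · intro V _
    simp only
    rcases h V with h | h <;> rw [h]
    · simp
    · rcases Int.even_or_odd (D V) with h2 | h2
      · exact Or.inl h2.neg_one_zpow
      · exact Or.inr h2.neg_one_zpow

noncomputable def degN (D : {D : Place X →₀ ℤ // 0 ≤ D}) : ℕ := (degD F D.1).toNat

theorem degN_cast (D : {D : Place X →₀ ℤ // 0 ≤ D}) : (degN F D : ℤ) = degD F D.1 :=
  Int.toNat_of_nonneg (degD_nonneg F D.2)

theorem term_eq (ψ : Place X → ℝ) (x : ℝ) (D : Place X →₀ ℕ) :
    D.prod (fun V n => (ψ V * x ^ V.deg F) ^ n) = Psi ψ (effEquiv D).1 * x ^ degN F (effEquiv D) := by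
  classical
  have h1 : Psi ψ (effEquiv D).1 = D.prod (fun V n => ψ V ^ n) := by
    unfold Psi effEquiv
    simp only [Equiv.coe_fn_mk]
    rw [Finsupp.prod_mapRange_index (fun V => zpow_zero _)]
    simp
  have h2 : degN F (effEquiv D) = D.sum (fun V n => n * V.deg F) := by
    apply Nat.cast_injective (R := ℤ)
    rw [degN_cast]
    unfold effEquiv degD
    simp only [Equiv.coe_fn_mk]
    rw [Finsupp.linearCombination_apply, Finsupp.sum_mapRange_index (by simp)]
    simp [Finsupp.sum]
  rw [h1, h2]
  unfold Finsupp.prod Finsupp.sum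
  rw [← Finset.prod_pow_eq_pow_sum, ← Finset.prod_mul_distrib]
  refine Finset.prod_congr rfl fun V _ => ?_
  simp only
  rw [mul_pow, mul_comm (D V), pow_mul]

theorem finite_degN (n : ℕ) : {D : {D : Place X →₀ ℤ // 0 ≤ D} | degN F D = n}.Finite := by
  refine Set.Finite.of_finite_image (f := Subtype.val) ((finite_degEq F n).subset ?_) Subtype.val_injective.injOn
  rintro _ ⟨D, hD, rfl⟩
  refine ⟨D.2, ?_⟩
  rw [← degN_cast]; exact congrArg _ hD

theorem sum_degN (w : (Place X →₀ ℤ) → ℝ) (n : ℕ) :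
    ∑ D ∈ (finite_degN F (X := X) n).toFinset, w D.1 = ∑ D ∈ (finite_degEq F (X := X) n).toFinset, w D := by
  refine Finset.sum_bij (fun D _ => D.1) ?_ (fun a _ b _ h => Subtype.ext h) ?_ (fun _ _ => rfl)
  · intro D hD
    rw [Set.Finite.mem_toFinset] at hD ⊢
    refine ⟨D.2, ?_⟩
    rw [← degN_cast]; exact congrArg _ hD
  · intro D hD
    rw [Set.Finite.mem_toFinset] at hD
    refine ⟨⟨D, hD.1⟩, ?_, rfl⟩
    rw [Set.Finite.mem_toFinset]
    apply Nat.cast_injective (R := ℤ)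
    rw [degN_cast]; exact hD.2

noncomputable def acoef (ψ : Place X → ℝ) (n : ℕ) : ℝ :=
  ∑ D ∈ (finite_degEq F (X := X) n).toFinset, Psi ψ D

theorem acoef_le : ∃ C : ℝ, 0 ≤ C ∧ ∀ ψ : Place X → ℝ, (∀ V, ψ V = 1 ∨ ψ V = -1) → ∀ n : ℕ,
    |acoef F ψ n| ≤ C * (Nat.card F : ℝ) ^ n := by
  obtain ⟨C, hC0, hC⟩ := ncard_deg_le F (X := X)
  refine ⟨C, hC0, fun ψ hψ n => ?_⟩
  refine le_trans (Finset.abs_sum_le_sum_abs _ _) (le_trans ?_ (hC n))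
  rw [Set.ncard_eq_toFinset_card _ (finite_degEq F n), Finset.card_eq_sum_ones]
  push_cast
  refine Finset.sum_le_sum fun D _ => ?_
  rcases Psi_pm ψ hψ D with h | h <;> rw [h] <;> simp

theorem zeta_sum (ψ : Place X → ℝ) (hψ : ∀ V, ψ V = 1 ∨ ψ V = -1) (x : ℝ) (hx : 0 ≤ x)
    (hqx : (Nat.card F : ℝ) * x < 1) :
    Summable (fun D : Place X →₀ ℕ => D.prod (fun V n => (ψ V * x ^ V.deg F) ^ n)) ∧
    Summable (fun n => acoef F ψ n * x ^ n) ∧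
    ∑' D : Place X →₀ ℕ, D.prod (fun V n => (ψ V * x ^ V.deg F) ^ n) = ∑' n, acoef F ψ n * x ^ n := by
  obtain ⟨C, hC0, hC⟩ := ncard_deg_le F (X := X)
  have key := sum_by_degree (degN F (X := X)) (fun D => Psi ψ D.1)
    (fun D => by rcases Psi_pm ψ hψ D.1 with h | h <;> rw [h] <;> simp) (finite_degN F) C (Nat.card F) x hx
    (by positivity) hqx (fun n => by
      refine le_trans (le_of_eq ?_) (hC n)
      have := sum_degN F (X := X) (fun _ => 1) n
      simp only [Finset.sum_const, nsmul_eq_mul, mul_one] at this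
      rw [Set.ncard_eq_toFinset_card _ (finite_degN F n), Set.ncard_eq_toFinset_card _ (finite_degEq F n)]
      exact this)
  simp only [sum_degN F (Psi ψ)] at key
  refine ⟨?_, key.2.1, ?_⟩
  · have h := (effEquiv.summable_iff (f := fun D : {D : Place X →₀ ℤ // 0 ≤ D} => Psi ψ D.1 * x ^ degN F D)).2 key.1
    exact h.congr fun D => (term_eq F ψ x D).symm
  · have h := effEquiv.tsum_eq (fun D : {D : Place X →₀ ℤ // 0 ≤ D} => Psi ψ D.1 * x ^ degN F D)
    rw [tsum_congr (term_eq F ψ x), h, key.2.2]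
    rfl

end
end FF
end

section
open IntermediateField Polynomial
namespace FF
set_option linter.unusedSectionVars false
set_option linter.unusedVariables false
section
open Filter Topology
variable (F : Type*) {X : Type*} [Field F] [Field X] [Algebra F X] [Finite F] [GFF F X]
include F

theorem acoef_rec (ψ : Place X → ℝ) (hψ : ∀ V, ψ V = 1 ∨ ψ V = -1)
    (hp : ∀ z : X, z ≠ 0 → Psi ψ (dv F z) = 1) (V1 : Place X) (hV1 : ψ V1 = -1) :
    ∃ B : ℝ, 0 ≤ B ∧ ∀ n : ℕ, |acoef F ψ (n + V1.deg F) + (Nat.card F : ℝ) ^ V1.deg F * acoef F ψ n| ≤ B := by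
  classical
  obtain ⟨C, hC0, hC⟩ := acoef_le F (X := X)
  obtain ⟨h, hh⟩ := finite_Cl F X
  obtain ⟨γ, c, hR⟩ := riemann F (X := X)
  set v := V1.deg F with hv
  set q : ℝ := (Nat.card F : ℝ) with hq
  have hq1 : 1 ≤ q := by rw [hq]; exact_mod_cast (one_lt_q F).le
  have hq0 : 0 ≤ q := by linarith
  have hψ0 : ∀ V, ψ V ≠ 0 := fun V => by rcases hψ V with h | h <;> rw [h] <;> norm_num
  refine ⟨h * q ^ v + 2 * C * q ^ (c.toNat + v), by positivity, fun n => ?_⟩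
  by_cases hn : (n : ℤ) < c
  · have h1 := hC ψ hψ (n + v)
    have h2 := hC ψ hψ n
    have h3 : q ^ (n + v) ≤ q ^ (c.toNat + v) := pow_le_pow_right₀ hq1 (by omega)
    calc _ ≤ |acoef F ψ (n + v)| + |q ^ v * acoef F ψ n| := abs_add_le _ _
      _ = |acoef F ψ (n + v)| + q ^ v * |acoef F ψ n| := by rw [abs_mul, abs_of_nonneg (by positivity : 0 ≤ q ^ v)]
      _ ≤ C * q ^ (n + v) + q ^ v * (C * q ^ n) := by gcongr
      _ = 2 * C * q ^ (n + v) := by rw [pow_add]; ring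
      _ ≤ 2 * C * q ^ (c.toNat + v) := by gcongr
      _ ≤ _ := by have : 0 ≤ h * q ^ v := by positivity
                  linarith
  · push Not at hn
    let wc : Cl F X → ℝ := fun c => Psi ψ (cl_surj F c).choose
    have hw : ∀ D, Psi ψ D = wc (cl F D) := by
      intro D
      obtain ⟨z, hz, he⟩ := (cl_eq F).1 (cl_surj F (cl F D)).choose_spec
      simp only [wc]
      conv_lhs => rw [he]
      rw [Psi_add ψ hψ0, hp z hz, mul_one]
    have hwc : ∀ c, |wc c| = 1 := fun c => by
      rcases Psi_pm ψ hψ (cl_surj F c).choose with h | h <;> simp [wc, h]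
    have e1 : acoef F ψ n = _ := sum_classes F (Psi ψ) wc hw n (hh n).1
    have e2 : acoef F ψ (n + v) = _ := sum_classes F (Psi ψ) wc hw (n + v : ℕ) (hh (n + v : ℕ)).1
    let κ : Cl F X := cl F (Finsupp.single V1 1)
    have e3 : ∑ c ∈ (hh (n + v : ℕ)).1.toFinset, wc c * ((Eff F c).ncard : ℝ) =
        ∑ c ∈ (hh n).1.toFinset, - wc c * ((Eff F (c + κ)).ncard : ℝ) := by
      symm
      have hκ : degC F κ = v := by rw [degC_cl, degD_single, one_mul]
      refine Finset.sum_bij (fun c _ => c + κ) ?_ (fun a _ b _ h => add_right_cancel h) ?_ ?_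
      · intro c hc
        rw [Set.Finite.mem_toFinset] at hc ⊢
        have hc : degC F c = n := hc
        change degC F (c + κ) = _
        rw [map_add, hc, hκ]; push_cast; rfl
      · intro c hc
        rw [Set.Finite.mem_toFinset] at hc
        have hc : degC F c = (n + v : ℕ) := hc
        refine ⟨c - κ, ?_, sub_add_cancel _ _⟩
        rw [Set.Finite.mem_toFinset]
        change degC F (c - κ) = _
        rw [map_sub, hc, hκ]; push_cast; ring
      · intro c hc
        congr 1
        obtain ⟨D, rfl⟩ := cl_surj F c
        rw [← cl_add, ← hw, ← hw, Psi_add ψ hψ0, Psi_single, hV1]; simp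
    rw [e2, e3, e1, Finset.mul_sum, ← Finset.sum_add_distrib]
    have hterm : ∀ c ∈ (hh n).1.toFinset,
        |- wc c * ((Eff F (c + κ)).ncard : ℝ) + q ^ v * (wc c * ((Eff F c).ncard : ℝ))| ≤ q ^ v := by
      intro cc hc
      rw [Set.Finite.mem_toFinset] at hc
      obtain ⟨D, rfl⟩ := cl_surj F cc
      have hc : degD F D = n := hc
      have h1 := card_Eff_real F D
      have h2 := card_Eff_real F (D + Finsupp.single V1 1)
      have h3 := hR D (by omega)
      have hd : degD F (D + Finsupp.single V1 1) = degD F D + v := by rw [map_add, degD_single, one_mul]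
      have h4 := hR (D + Finsupp.single V1 1) (by rw [hd]; omega)
      have h5 : ell F (D + Finsupp.single V1 1) = ell F D + v := by rw [hd] at h4; omega
      rw [h5, pow_add] at h2
      rw [cl_add] at h2
      have hL : (2 : ℝ) ≤ Nat.card (Ls F (0 : Place X →₀ ℤ)) := by exact_mod_cast card_L0 F (X := X)
      set l : ℝ := (Nat.card (Ls F (0 : Place X →₀ ℤ)) : ℝ)
      set N : ℝ := ((Eff F (cl F D)).ncard : ℝ)
      set N' : ℝ := ((Eff F (cl F D + κ)).ncard : ℝ)
      have h2' : (l - 1) * N' = q ^ ell F D * q ^ v - 1 := h2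
      have h6 : -wc (cl F D) * N' + q ^ v * (wc (cl F D) * N) = wc (cl F D) * (q ^ v * N - N') := by ring
      rw [h6, abs_mul, hwc, one_mul]
      have h7 : (l - 1) * (q ^ v * N - N') = 1 - q ^ v := by
        have : (l - 1) * (q ^ v * N - N') = q ^ v * ((l - 1) * N) - (l - 1) * N' := by ring
        rw [this, h1, h2']; ring
      have h8 : 1 ≤ q ^ v := one_le_pow₀ hq1
      have h9 : (l - 1) * |q ^ v * N - N'| ≤ q ^ v := by
        rw [← abs_of_nonneg (by linarith : 0 ≤ l - 1), ← abs_mul, h7, abs_le]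
        constructor <;> linarith
      nlinarith [abs_nonneg (q ^ v * N - N')]
    refine le_trans (Finset.abs_sum_le_sum_abs _ _) (le_trans (Finset.sum_le_sum hterm) ?_)
    rw [Finset.sum_const, nsmul_eq_mul, ← Set.ncard_eq_toFinset_card _ (hh n).1]
    have h1 : ({c : Cl F X | degC F c = n}.ncard : ℝ) ≤ h := by exact_mod_cast (hh n).2
    have h2 : 0 ≤ 2 * C * q ^ (c.toNat + v) := by positivity
    have h3 : ({c : Cl F X | degC F c = n}.ncard : ℝ) * q ^ v ≤ h * q ^ v := by gcongr
    linarith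

set_option maxHeartbeats 1000000 in
theorem L_bound (ψ : Place X → ℝ) (hψ : ∀ V, ψ V = 1 ∨ ψ V = -1)
    (hp : ∀ z : X, z ≠ 0 → Psi ψ (dv F z) = 1) (V1 : Place X) (hV1 : ψ V1 = -1) :
    ∃ C : ℝ, 0 < C ∧ ∀ x : ℝ, 0 ≤ x → (Nat.card F : ℝ) * x < 1 → ∑' n, acoef F ψ n * x ^ n ≤ C := by
  obtain ⟨B, hB0, hB⟩ := acoef_rec F ψ hψ hp V1 hV1
  obtain ⟨C, hC0, hC⟩ := acoef_le F (X := X)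
  set v := V1.deg F with hv
  set q : ℝ := (Nat.card F : ℝ) with hq
  have hq2 : 2 ≤ q := by rw [hq]; exact_mod_cast (one_lt_q F)
  refine ⟨C * v + 2 * B + 1, by positivity, fun x hx hqx => ?_⟩
  have hx2 : x ≤ 1/2 := by nlinarith
  obtain ⟨-, hs, -⟩ := zeta_sum F ψ hψ x hx hqx
  set L := ∑' n, acoef F ψ n * x ^ n
  have h1 : ∑ n ∈ Finset.range v, acoef F ψ n * x ^ n + ∑' n, acoef F ψ (n + v) * x ^ (n + v) = L :=
    hs.sum_add_tsum_nat_add v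
  have hs' : Summable fun n => acoef F ψ (n + v) * x ^ (n + v) := (summable_nat_add_iff v).2 hs
  have h2 : (q * x) ^ v * L = ∑' n, (q * x) ^ v * (acoef F ψ n * x ^ n) := tsum_mul_left.symm
  have hs2 : Summable fun n => (q * x) ^ v * (acoef F ψ n * x ^ n) := hs.mul_left _
  have h3 : L + (q * x) ^ v * L = ∑ n ∈ Finset.range v, acoef F ψ n * x ^ n +
      ∑' n, (acoef F ψ (n + v) * x ^ (n + v) + (q * x) ^ v * (acoef F ψ n * x ^ n)) := by
    rw [hs'.tsum_add hs2, ← h2, ← h1]; ring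
  have h4 : ∑ n ∈ Finset.range v, acoef F ψ n * x ^ n ≤ C * v := by
    calc _ ≤ ∑ n ∈ Finset.range v, C := by
          refine Finset.sum_le_sum fun n _ => ?_
          calc acoef F ψ n * x ^ n ≤ (C * q ^ n) * x ^ n := by
                gcongr; exact (le_abs_self _).trans (hC ψ hψ n)
            _ = C * (q * x) ^ n := by rw [mul_pow]; ring
            _ ≤ C * 1 := by gcongr; exact pow_le_one₀ (by positivity) hqx.le
            _ = C := mul_one C
      _ = C * v := by rw [Finset.sum_const, Finset.card_range, nsmul_eq_mul, mul_comm]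
  have h5 : ∑' n, (acoef F ψ (n + v) * x ^ (n + v) + (q * x) ^ v * (acoef F ψ n * x ^ n)) ≤ 2 * B := by
    have hg : HasSum (fun n : ℕ => B * (1/2 : ℝ) ^ n) (B * 2) := by
      have := hasSum_geometric_two.mul_left B
      exact this
    rw [mul_comm 2 B, ← hg.tsum_eq]
    refine (hs'.add hs2).tsum_le_tsum (fun n => ?_) hg.summable
    calc acoef F ψ (n + v) * x ^ (n + v) + (q * x) ^ v * (acoef F ψ n * x ^ n) =
          (acoef F ψ (n + v) + q ^ v * acoef F ψ n) * x ^ (n + v) := by rw [mul_pow, pow_add]; ring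
      _ ≤ B * x ^ (n + v) := by gcongr; exact (le_abs_self _).trans (hB n)
      _ ≤ B * (1/2) ^ n := by
        gcongr
        rw [pow_add]
        calc x ^ n * x ^ v ≤ x ^ n * 1 := by gcongr; exact pow_le_one₀ hx (by linarith)
          _ = x ^ n := mul_one _
          _ ≤ (1/2) ^ n := by gcongr
  have h6 : 0 ≤ (q * x) ^ v := by positivity
  by_cases hL : L ≤ 0
  · have : 0 ≤ C * v + 2 * B + 1 := by positivity
    linarith
  · push Not at hL
    nlinarith [mul_nonneg h6 hL.le]

variable (X) in
noncomputable def Zf (x : ℝ) : ℝ := ∑' n, acoef F (fun _ : Place X => 1) n * x ^ n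

theorem acoef_one (n : ℕ) : acoef F (fun _ : Place X => 1) n = {D : Place X →₀ ℤ | 0 ≤ D ∧ degD F D = n}.ncard := by
  rw [Set.ncard_eq_toFinset_card _ (finite_degEq F n), Finset.card_eq_sum_ones]
  unfold acoef
  push_cast
  refine Finset.sum_congr rfl fun D _ => ?_
  simp [Psi]

variable (X) in
theorem Z_upper : ∃ C : ℝ, 0 < C ∧ ∀ x : ℝ, 0 ≤ x → (Nat.card F : ℝ) * x < 1 →
    Zf F X x ≤ C * (1 - Nat.card F * x)⁻¹ := by
  obtain ⟨C, hC0, hC⟩ := acoef_le F (X := X)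
  refine ⟨C + 1, by positivity, fun x hx hqx => ?_⟩
  obtain ⟨-, hs, -⟩ := zeta_sum F (fun _ : Place X => 1) (fun _ => Or.inl rfl) x hx hqx
  have hg := (hasSum_geometric_of_lt_one (by positivity) hqx).mul_left (C + 1)
  unfold Zf
  rw [← hg.tsum_eq]
  refine hs.tsum_le_tsum (fun n => ?_) hg.summable
  calc _ ≤ (C * (Nat.card F : ℝ) ^ n) * x ^ n := by
        gcongr; exact (le_abs_self _).trans (hC _ (fun _ => Or.inl rfl) n)
    _ = C * (Nat.card F * x) ^ n := by rw [mul_pow]; ring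
    _ ≤ (C + 1) * (Nat.card F * x) ^ n := by gcongr; linarith

variable (X) in
theorem Z_lower : ∃ C : ℝ, 0 < C ∧ ∀ x : ℝ, 1/2 ≤ (Nat.card F : ℝ) * x → (Nat.card F : ℝ) * x < 1 →
    C * (1 - Nat.card F * x)⁻¹ ≤ Zf F X x := by
  classical
  obtain ⟨W⟩ := exists_place F (X := X)
  obtain ⟨γ, hγ⟩ := riemann_bound F (X := X)
  set w := W.deg F with hw
  have hw0 : 0 < w := W.deg_pos F
  set q : ℝ := (Nat.card F : ℝ) with hq
  have hq2 : 2 ≤ q := by rw [hq]; exact_mod_cast (one_lt_q F)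
  set l : ℝ := (Nat.card (Ls F (0 : Place X →₀ ℤ)) : ℝ) with hl
  have hl2 : 2 ≤ l := by rw [hl]; exact_mod_cast card_L0 F (X := X)
  set g := γ.toNat with hg
  -- coefficient bound
  have hcoef : ∀ k : ℕ, q ^ (k * w) ≤ (2 * l * q ^ g) * acoef F (fun _ : Place X => 1) ((k + g + 1) * w) := by
    intro k
    rw [acoef_one]
    have h1 := card_Eff_real F (Finsupp.single W ((k + g + 1 : ℕ) : ℤ))
    have h2 := hγ (Finsupp.single W ((k + g + 1 : ℕ) : ℤ))
    rw [degD_single] at h2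
    have h3 : k * w + 1 ≤ ell F (Finsupp.single W ((k + g + 1 : ℕ) : ℤ)) := by
      have h4 : (k + g + 1) * w = k * w + (g + 1) * w := by ring
      have h5 : g + 1 ≤ (g + 1) * w := Nat.le_mul_of_pos_right _ hw0
      have h6 : γ ≤ g := Int.self_le_toNat _
      have h7 : (((k + g + 1 : ℕ) : ℤ)) * (w : ℤ) = (((k + g + 1) * w : ℕ) : ℤ) := by push_cast; ring
      rw [h7] at h2
      omega
    have h4 : q ^ (k * w + 1) ≤ q ^ ell F (Finsupp.single W ((k + g + 1 : ℕ) : ℤ)) := pow_le_pow_right₀ (by linarith) h3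
    have h5 : (1 : ℝ) ≤ q ^ (k * w) := one_le_pow₀ (by linarith)
    have h6 : (Eff F (cl F (Finsupp.single W ((k + g + 1 : ℕ) : ℤ)))).ncard ≤
        {D : Place X →₀ ℤ | 0 ≤ D ∧ degD F D = ((k + g + 1) * w : ℕ)}.ncard := by
      refine Set.ncard_le_ncard ?_ (finite_degEq F _)
      rintro D ⟨h1, h2⟩
      refine ⟨h1, ?_⟩
      rw [← degC_cl, h2, degC_cl, degD_single]; push_cast; rfl
    have h6' : ((Eff F (cl F (Finsupp.single W ((k + g + 1 : ℕ) : ℤ)))).ncard : ℝ) ≤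
        {D : Place X →₀ ℤ | 0 ≤ D ∧ degD F D = ((k + g + 1) * w : ℕ)}.ncard := by exact_mod_cast h6
    set N : ℝ := ((Eff F (cl F (Finsupp.single W ((k + g + 1 : ℕ) : ℤ)))).ncard : ℝ)
    set A : ℝ := ({D : Place X →₀ ℤ | 0 ≤ D ∧ degD F D = ((k + g + 1) * w : ℕ)}.ncard : ℝ)
    have hA : 0 ≤ A := Nat.cast_nonneg _
    have hN : 0 ≤ N := Nat.cast_nonneg _
    have h1' : (l - 1) * N = q ^ ell F (Finsupp.single W ((k + g + 1 : ℕ) : ℤ)) - 1 := h1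
    have h7 : q ^ (k * w) ≤ l * N := by rw [pow_succ] at h4; nlinarith
    have h8 : (1 : ℝ) ≤ q ^ g := one_le_pow₀ (by linarith)
    calc q ^ (k * w) ≤ l * N := h7
      _ ≤ l * A := by gcongr
      _ ≤ l * A * (2 * q ^ g) := le_mul_of_one_le_right (by positivity) (by linarith)
      _ = _ := by ring
  set c : ℝ := 2 * l * q ^ g with hc
  have hc0 : 0 < c := by positivity
  refine ⟨(1/(2*q)) ^ ((g + 1) * w) / (c * w), by positivity, fun x hx1 hqx => ?_⟩
  have hx : 0 < x := by
    by_contra h; push Not at h; nlinarith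
  have hxq : 1/(2*q) ≤ x := by rw [div_le_iff₀ (by positivity)]; linarith
  have hx1' : x ≤ 1 := by nlinarith
  obtain ⟨-, hs, -⟩ := zeta_sum F (fun _ : Place X => 1) (fun _ => Or.inl rfl) x hx.le hqx
  have hinj : Function.Injective (fun k : ℕ => (k + g + 1) * w) := by
    intro a b h
    have := Nat.eq_of_mul_eq_mul_right hw0 h
    omega
  have hnn : ∀ n, 0 ≤ acoef F (fun _ : Place X => 1) n * x ^ n := fun n => by rw [acoef_one]; positivity
  have hle : ∑' k : ℕ, acoef F (fun _ : Place X => 1) ((k + g + 1) * w) * x ^ ((k + g + 1) * w) ≤ Zf F X x :=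
    tsum_comp_le_tsum_of_inj hs hnn hinj
  have hs1 : Summable fun k : ℕ => acoef F (fun _ : Place X => 1) ((k + g + 1) * w) * x ^ ((k + g + 1) * w) :=
    hs.comp_injective hinj
  have hyw : (q * x) ^ w < 1 := pow_lt_one₀ (by positivity) hqx hw0.ne'
  have hgeo := (hasSum_geometric_of_lt_one (by positivity) hyw).mul_left ((1/(2*q)) ^ ((g + 1) * w) / c)
  have hle2 : (1/(2*q)) ^ ((g + 1) * w) / c * (1 - (q * x) ^ w)⁻¹ ≤ Zf F X x := by
    rw [← hgeo.tsum_eq]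
    refine le_trans (hgeo.summable.tsum_le_tsum (fun k => ?_) hs1) hle
    rw [div_mul_eq_mul_div, div_le_iff₀ hc0]
    have h1 := hcoef k
    calc (1 / (2 * q)) ^ ((g + 1) * w) * ((q * x) ^ w) ^ k
        ≤ x ^ ((g + 1) * w) * ((q * x) ^ w) ^ k := by gcongr
      _ = q ^ (k * w) * x ^ ((k + g + 1) * w) := by
          rw [← pow_mul, mul_comm w k, mul_pow, add_assoc, add_mul k, pow_add]; ring
      _ ≤ (c * acoef F (fun _ : Place X => 1) ((k + g + 1) * w)) * x ^ ((k + g + 1) * w) := by gcongr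
      _ = _ := by ring
  refine le_trans ?_ hle2
  have hb : 1 - (q * x) ^ w ≤ w * (1 - q * x) := by
    have := one_add_mul_le_pow (a := q * x - 1) (by linarith [mul_pos (by linarith : 0 < q) hx]) w
    rw [add_sub_cancel] at this
    linarith
  have hw0' : (0 : ℝ) < w := by exact_mod_cast hw0
  rw [div_mul_eq_div_div, div_mul_eq_mul_div (_ / c)]
  rw [mul_div_assoc]
  gcongr
  rw [div_le_iff₀ hw0', inv_mul_eq_div, le_div_iff₀ (by linarith : 0 < 1 - (q*x)^w), inv_mul_eq_div,
    div_le_iff₀ (by linarith)]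
  linarith

end
end FF
end

section
open IntermediateField Polynomial
namespace FF
set_option linter.unusedSectionVars false
set_option linter.unusedVariables false
section
open Filter Topology
variable (F : Type*) {X : Type*} [Field F] [Field X] [Algebra F X] [Finite F] [GFF F X]
include F

theorem summable_deg (x : ℝ) (hx : 0 ≤ x) (hqx : (Nat.card F : ℝ) * x < 1) :
    Summable (fun V : Place X => x ^ V.deg F) := by
  obtain ⟨h, -, -⟩ := zeta_sum F (fun _ : Place X => 1) (fun _ => Or.inl rfl) x hx hqx
  simp only [one_mul] at h
  exact summable_of_euler _ (fun V => by positivity) h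

omit [Algebra F X] [GFF F X] [Field X] in
theorem two_le_q : (2 : ℝ) ≤ Nat.card F := by exact_mod_cast (one_lt_q F)

variable (X) in
theorem H_sq : ∃ C : ℝ, 0 ≤ C ∧ ∀ x : ℝ, 0 ≤ x → (Nat.card F : ℝ) * x < 1 →
    Summable (fun V : Place X => (x ^ V.deg F) ^ 2) ∧ ∑' V : Place X, (x ^ V.deg F) ^ 2 ≤ C := by
  have hq := two_le_q F
  set q : ℝ := (Nat.card F : ℝ) with hq
  have hx0 : q * (q⁻¹ ^ 2) < 1 := by
    rw [pow_two, ← mul_assoc, mul_inv_cancel₀ (by positivity), one_mul]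
    exact inv_lt_one_of_one_lt₀ (by linarith)
  have hs0 := summable_deg F (X := X) (q⁻¹ ^ 2) (by positivity) hx0
  refine ⟨∑' V : Place X, (q⁻¹ ^ 2) ^ V.deg F, tsum_nonneg fun _ => by positivity, fun x hx hqx => ?_⟩
  have hxq : x ≤ q⁻¹ := by
    rw [← one_div, le_div_iff₀ (by positivity)]; linarith
  have hle : ∀ V : Place X, (x ^ V.deg F) ^ 2 ≤ (q⁻¹ ^ 2) ^ V.deg F := fun V => by
    rw [← pow_mul, mul_comm, pow_mul]; gcongr
  have hs1 : Summable (fun V : Place X => (x ^ V.deg F) ^ 2) :=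
    hs0.of_nonneg_of_le (fun _ => by positivity) hle
  exact ⟨hs1, hs1.tsum_le_tsum hle hs0⟩

/-- the weight function has logarithmic density `a` -/
def Dens (w : Place X → ℝ) (a : ℝ) : Prop :=
  ∃ C : ℝ, ∀ x : ℝ, 1/2 ≤ (Nat.card F : ℝ) * x → (Nat.card F : ℝ) * x < 1 →
    |∑' V, w V * x ^ V.deg F - a * Real.log ((1 - (Nat.card F : ℝ) * x)⁻¹)| ≤ C

omit [Algebra F X] [GFF F X] [Field X] in
theorem x_pos {x : ℝ} (h : 1/2 ≤ (Nat.card F : ℝ) * x) : 0 < x := by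
  have := two_le_q F
  by_contra h'; push Not at h'; nlinarith

omit [Algebra F X] [GFF F X] [Field X] in
theorem x_le {x : ℝ} (h : (Nat.card F : ℝ) * x < 1) : x ≤ 1/2 := by
  have := two_le_q F
  by_contra h'; push Not at h'; nlinarith

theorem summable_w (w : Place X → ℝ) (B : ℝ) (hw : ∀ V, |w V| ≤ B) (x : ℝ) (hx : 0 ≤ x)
    (hqx : (Nat.card F : ℝ) * x < 1) : Summable (fun V : Place X => w V * x ^ V.deg F) := by
  refine Summable.of_norm_bounded ((summable_deg F x hx hqx).mul_left B) fun V => ?_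
  rw [Real.norm_eq_abs, abs_mul, abs_of_nonneg (by positivity : 0 ≤ x ^ V.deg F)]
  gcongr
  exact hw V

theorem Dens.one : Dens F (fun _ : Place X => 1) 1 := by
  obtain ⟨C1, hC1, h1⟩ := Z_upper F X
  obtain ⟨C2, hC2, h2⟩ := Z_lower F X
  obtain ⟨C3, hC3, h3⟩ := H_sq F X
  refine ⟨|Real.log C1| + |Real.log C2| + 2 * C3, fun x hx1 hqx => ?_⟩
  have hx := x_pos F hx1
  have hxl := x_le F hqx
  obtain ⟨hs, -, he⟩ := zeta_sum F (fun _ : Place X => 1) (fun _ => Or.inl rfl) x hx.le hqx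
  have hz : ∑' D : Place X →₀ ℕ, D.prod (fun V n => (1 * x ^ V.deg F) ^ n) = Zf F X x := he
  simp only [one_mul] at hz hs ⊢
  have hsd := summable_deg F (X := X) x hx.le hqx
  have hb : ∀ V : Place X, x ^ V.deg F ≤ 1/2 := fun V => by
    calc x ^ V.deg F ≤ x ^ 1 := pow_le_pow_of_le_one hx.le (by linarith) (V.deg_pos F)
      _ ≤ 1/2 := by rw [pow_one]; exact hxl
  have hu := euler_upper _ (fun V : Place X => by
    rw [abs_of_nonneg (by positivity)]; linarith [hb V]) hs hsd
  have hl := euler_lower _ (fun V : Place X => by positivity) hb hs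
  rw [hz] at hu hl
  have a1 := h1 x hx.le hqx
  have a2 := h2 x hx1 hqx
  have hp : 0 < (1 - (Nat.card F : ℝ) * x)⁻¹ := inv_pos.2 (by linarith)
  have b1 := Real.log_le_log (Real.exp_pos _) (hu.trans a1)
  have b2 := Real.log_le_log (by positivity) (a2.trans hl)
  rw [Real.log_exp, Real.log_mul hC1.ne' hp.ne'] at b1
  rw [Real.log_exp, Real.log_mul hC2.ne' hp.ne'] at b2
  have c3 := (h3 x hx.le hqx).2
  have d1 := le_abs_self (Real.log C1)
  have d2 := neg_abs_le (Real.log C2)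
  have d3 := abs_nonneg (Real.log C1)
  have d4 := abs_nonneg (Real.log C2)
  rw [abs_le]
  constructor <;> linarith

theorem Dens.add {w w' : Place X → ℝ} {a a' B B' : ℝ} (h : Dens F w a) (h' : Dens F w' a')
    (hw : ∀ V, |w V| ≤ B) (hw' : ∀ V, |w' V| ≤ B') : Dens F (fun V => w V + w' V) (a + a') := by
  obtain ⟨C, hC⟩ := h
  obtain ⟨C', hC'⟩ := h'
  refine ⟨C + C', fun x hx1 hqx => ?_⟩
  have h1 := hC x hx1 hqx
  have h2 := hC' x hx1 hqx
  have hx := x_pos F hx1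
  simp only [add_mul]
  rw [(summable_w F w B hw x hx.le hqx).tsum_add (summable_w F w' B' hw' x hx.le hqx)]
  rw [abs_le] at *
  constructor <;> linarith [h1.1, h1.2, h2.1, h2.2]

theorem Dens.smul {w : Place X → ℝ} {a : ℝ} (c : ℝ) (h : Dens F w a) :
    Dens F (fun V => c * w V) (c * a) := by
  obtain ⟨C, hC⟩ := h
  refine ⟨|c| * C, fun x hx1 hqx => ?_⟩
  simp only [mul_assoc]
  rw [tsum_mul_left, ← mul_sub, abs_mul]
  gcongr
  exact hC x hx1 hqx

/-- comparison up to an error of order `x ^ (2 deg)` and finitely many exceptions -/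
theorem Dens.congr {w w' : Place X → ℝ} {a B B' : ℝ} (h : Dens F w a)
    (hw : ∀ V, |w V| ≤ B) (hw' : ∀ V, |w' V| ≤ B') (hf : {V | w V ≠ w' V}.Finite) : Dens F w' a := by
  obtain ⟨C, hC⟩ := h
  refine ⟨C + ∑ V ∈ hf.toFinset, |w' V - w V|, fun x hx1 hqx => ?_⟩
  have hx := x_pos F hx1
  have hxl := x_le F hqx
  have h1 := hC x hx1 hqx
  have h2 : ∑' V, w' V * x ^ V.deg F - ∑' V, w V * x ^ V.deg F = ∑ V ∈ hf.toFinset, (w' V - w V) * x ^ V.deg F := by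
    rw [← (summable_w F w' B' hw' x hx.le hqx).tsum_sub (summable_w F w B hw x hx.le hqx)]
    rw [tsum_eq_sum (s := hf.toFinset)]
    · exact Finset.sum_congr rfl fun V _ => by ring
    · intro V hV
      have : w V = w' V := by simpa using hV
      rw [this, sub_self]
  have h3 : |∑ V ∈ hf.toFinset, (w' V - w V) * x ^ V.deg F| ≤ ∑ V ∈ hf.toFinset, |w' V - w V| := by
    refine (Finset.abs_sum_le_sum_abs _ _).trans (Finset.sum_le_sum fun V _ => ?_)
    rw [abs_mul]
    refine mul_le_of_le_one_right (abs_nonneg _) ?_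
    rw [abs_of_nonneg (by positivity)]
    exact pow_le_one₀ hx.le (by linarith)
  rw [← h2] at h3
  rw [abs_le] at *
  constructor <;> linarith [h1.1, h1.2, h3.1, h3.2]

/-- a nontrivial character trivial on principal divisors has nonpositive density -/
theorem Dens.char {ψ : Place X → ℝ} {a : ℝ} (h : Dens F ψ a) (hψ : ∀ V, ψ V = 1 ∨ ψ V = -1)
    (hp : ∀ z : X, z ≠ 0 → Psi ψ (dv F z) = 1) (V1 : Place X) (hV1 : ψ V1 = -1) : a ≤ 0 := by
  obtain ⟨C, hC⟩ := h
  obtain ⟨C1, hC1, h1⟩ := L_bound F ψ hψ hp V1 hV1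
  have hq2 := two_le_q F
  set q : ℝ := (Nat.card F : ℝ) with hq
  by_contra ha
  push Not at ha
  -- choose x
  set t : ℝ := max 2 (Real.exp ((C + Real.log C1 + 1) / a)) with ht
  have ht2 : 2 ≤ t := le_max_left _ _
  have htl : (C + Real.log C1 + 1) / a ≤ Real.log t := by
    rw [Real.le_log_iff_exp_le (by linarith)]; exact le_max_right _ _
  set x : ℝ := (1 - t⁻¹) / q with hx
  have hqx : q * x = 1 - t⁻¹ := by rw [hx]; field_simp
  have hti : t⁻¹ ≤ 1/2 := by rw [inv_le_comm₀ (by linarith) (by norm_num)]; norm_num; exact ht2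
  have hti0 : 0 < t⁻¹ := inv_pos.2 (by linarith)
  have h2 : 1/2 ≤ q * x := by rw [hqx]; linarith
  have h3 : q * x < 1 := by rw [hqx]; linarith
  have hx0 := x_pos F h2
  have hxl := x_le F h3
  have h4 := hC x h2 h3
  have h5 := h1 x hx0.le h3
  rw [hqx, sub_sub_cancel, inv_inv] at h4
  obtain ⟨hs, -, he⟩ := zeta_sum F ψ hψ x hx0.le h3
  have hψ1 : ∀ V, |ψ V| ≤ 1 := fun V => by rcases hψ V with h | h <;> simp [h]
  have hb : ∀ V : Place X, |ψ V * x ^ V.deg F| < 1 := fun V => by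
    rw [abs_mul, abs_of_nonneg (by positivity : 0 ≤ x ^ V.deg F)]
    calc _ ≤ 1 * x ^ V.deg F := by gcongr; exact hψ1 V
      _ ≤ x ^ 1 := by rw [one_mul]; exact pow_le_pow_of_le_one hx0.le (by linarith) (V.deg_pos F)
      _ < 1 := by rw [pow_one]; linarith
  have hu := euler_upper _ hb hs (summable_w F ψ 1 hψ1 x hx0.le h3)
  rw [he] at hu
  have b1 := Real.log_le_log (Real.exp_pos _) (hu.trans h5)
  rw [Real.log_exp] at b1
  rw [div_le_iff₀ ha] at htl
  rw [abs_le] at h4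
  linarith [h4.1]

end
end FF
end

section
open IntermediateField Polynomial
namespace FF
set_option linter.unusedSectionVars false
set_option linter.unusedVariables false

section
variable {X Y : Type*} [Field X] [Field Y]

/-- `V` is the restriction of `W` along `φ`. -/
def Lies (φ : X →+* Y) (W : Place Y) (V : Place X) : Prop := ∀ x, x ∈ V.A ↔ φ x ∈ W.A

theorem Lies.ord {φ : X →+* Y} {W : Place Y} {V : Place X} (h : Lies φ W V) :
    ∃ e : ℤ, 0 < e ∧ ∀ x, W.ord (φ x) = e * V.ord x := by
  have h0 : ∀ x, x ≠ 0 → (0 ≤ V.ord x ↔ 0 ≤ W.ord (φ x)) := fun x hx => by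
    rw [← V.G_iff hx, ← V.mem_iff, h, W.mem_iff, W.G_iff (by simpa using hx)]
  have hu : ∀ x, x ≠ 0 → V.ord x = 0 → W.ord (φ x) = 0 := fun x hx hv => by
    have h1 := (h0 x hx).1 (by omega)
    have h2 := (h0 x⁻¹ (inv_ne_zero hx)).1 (by rw [V.ord_inv]; omega)
    rw [map_inv₀, W.ord_inv] at h2
    omega
  have hpos : 0 < W.ord (φ V.pi) := by
    have h1 := (h0 V.pi V.pi_ne).1 (by rw [V.ord_pi]; omega)
    have h2 := (h0 V.pi⁻¹ (inv_ne_zero V.pi_ne)).not.1 (by rw [V.ord_inv, V.ord_pi]; omega)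
    rw [map_inv₀, W.ord_inv] at h2
    omega
  refine ⟨W.ord (φ V.pi), hpos, fun x => ?_⟩
  by_cases hx : x = 0
  · simp [hx, W.ord_zero, V.ord_zero]
  have hp := zpow_ne_zero (V.ord x) V.pi_ne
  have h1 := hu (x / V.pi ^ V.ord x) (div_ne_zero hx hp) (by
    rw [V.ord_div hx hp, V.ord_zpow, V.ord_pi]; ring)
  rw [map_div₀, W.ord_div (by simpa using hx) ((map_ne_zero φ).2 hp), map_zpow₀, W.ord_zpow] at h1
  linarith

theorem Lies.unique {φ : X →+* Y} {W : Place Y} {V V' : Place X} (h : Lies φ W V) (h' : Lies φ W V') : V = V' := by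
  apply Place.ext
  ext x
  rw [h x, h' x]

theorem Lies.G {φ : X →+* Y} {W : Place Y} {V : Place X} (h : Lies φ W V) {x : X} : V.G 1 x ↔ W.G 1 (φ x) := by
  obtain ⟨e, he, ho⟩ := h.ord
  by_cases hx : x = 0
  · simp [hx, Place.G_zero]
  rw [V.G_iff hx, W.G_iff (by simpa using hx), ho]
  constructor
  · intro h; nlinarith
  · intro h; by_contra h'; nlinarith

theorem Lies.G0 {φ : X →+* Y} {W : Place Y} {V : Place X} (h : Lies φ W V) {x : X} : V.G 0 x ↔ W.G 0 (φ x) := by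
  rw [← V.mem_iff, ← W.mem_iff, h]

end

/-- data of a quadratic extension -/
structure Quad (X Y : Type*) [Field X] [Field Y] [Algebra X Y] where
  b : X
  s : Y
  σ : Y →+* Y
  N : Y → X
  hs : s ^ 2 = algebraMap X Y b
  hb : b ≠ 0
  rep : ∀ y, ∃ u v : X, y = algebraMap X Y u + algebraMap X Y v * s
  σX : ∀ x, σ (algebraMap X Y x) = algebraMap X Y x
  σs : σ s = - s
  hN : ∀ y, algebraMap X Y (N y) = y * σ y
  h2 : (2 : X) ≠ 0

section
variable (F : Type*) {X Y : Type*} [Field F] [Field X] [Field Y] [Algebra F X] [Algebra F Y] [Algebra X Y]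
  [IsScalarTower F X Y] [Finite F] [GFF F X] [GFF F Y] (Q : Quad X Y)

namespace Quad
include Q

theorem σσ (y : Y) : Q.σ (Q.σ y) = y := by
  obtain ⟨u, v, rfl⟩ := Q.rep y
  simp [Q.σX, Q.σs]

theorem s_ne : Q.s ≠ 0 := by
  intro h
  have := Q.hs
  rw [h] at this
  apply Q.hb
  apply (algebraMap X Y).injective
  rw [map_zero, ← this]; ring

theorem hN' (u v : X) : Q.N (algebraMap X Y u + algebraMap X Y v * Q.s) = u ^ 2 - Q.b * v ^ 2 := by
  apply (algebraMap X Y).injective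
  rw [Q.hN]
  simp only [map_add, map_mul, Q.σX, Q.σs, map_sub, map_pow, ← Q.hs]
  ring

theorem tr (y : Y) : ∃ t : X, algebraMap X Y t = y + Q.σ y := by
  obtain ⟨u, v, rfl⟩ := Q.rep y
  refine ⟨2 * u, ?_⟩
  simp only [map_add, map_mul, Q.σX, Q.σs, map_ofNat]; ring

theorem two_ne : (2 : Y) ≠ 0 := by
  have := Q.h2
  intro h
  apply this
  apply (algebraMap X Y).injective
  rw [map_ofNat, map_zero]; exact h

theorem nonsq (x : X) : x ^ 2 ≠ Q.b := by
  intro h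
  have h1 : (Q.s - algebraMap X Y x) * (Q.s + algebraMap X Y x) = 0 := by
    have := Q.hs
    rw [← h, map_pow] at this
    linear_combination this
  have h3 : Q.σ Q.s = Q.s := by
    rcases mul_eq_zero.1 h1 with h | h
    · rw [show Q.s = algebraMap X Y x by linear_combination h, Q.σX]
    · rw [show Q.s = algebraMap X Y (-x) by rw [map_neg]; linear_combination h, Q.σX]
  rw [Q.σs] at h3
  have h4 : 2 * Q.s = 0 := by linear_combination -h3
  exact mul_ne_zero Q.two_ne Q.s_ne h4

include F

theorem comap_ne_top (W : Place Y) : W.A.comap (algebraMap X Y) ≠ ⊤ := by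
  intro h
  have hX : ∀ x : X, W.G 0 (algebraMap X Y x) := fun x => by
    have : x ∈ W.A.comap (algebraMap X Y) := by rw [h]; trivial
    exact W.mem_iff.1 this
  set y := W.pi⁻¹ with hy
  have hy0 : y ≠ 0 := inv_ne_zero W.pi_ne
  have hyo : W.ord y = -1 := by rw [hy, W.ord_inv, W.ord_pi]
  obtain ⟨t, ht⟩ := Q.tr y
  have e : y ^ 2 = algebraMap X Y t * y - algebraMap X Y (Q.N y) := by rw [ht, Q.hN]; ring
  have h1 : W.G (-1) (y ^ 2) := by
    rw [e]
    refine W.G_sub ?_ (W.G_mono (by omega) (hX _))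
    have := W.G_mul (hX t) (W.G_ord (x := y))
    rwa [hyo, zero_add] at this
  rw [W.G_iff (pow_ne_zero 2 hy0), W.ord_pow, hyo] at h1
  norm_num at h1

/-- restriction of places -/
noncomputable def rest (W : Place Y) : Place X :=
  ⟨W.A.comap (algebraMap X Y), dvr_of_ne_top F _ (Q.comap_ne_top F W)⟩

theorem rest_lies (W : Place Y) : Lies (algebraMap X Y) W (Q.rest F W) := fun x => Iff.rfl

theorem comapσ_ne_top (W : Place Y) : W.A.comap Q.σ ≠ ⊤ := by
  intro h
  have : Q.σ W.pi⁻¹ ∈ W.A.comap Q.σ := by rw [h]; trivial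
  have h2 : Q.σ (Q.σ W.pi⁻¹) ∈ W.A := this
  rw [Q.σσ] at h2
  exact W.not_mem_inv (by rw [W.ord_pi]; omega) h2

noncomputable def conj (W : Place Y) : Place Y :=
  ⟨W.A.comap Q.σ, dvr_of_ne_top F _ (Q.comapσ_ne_top F W)⟩

theorem conj_lies (W : Place Y) : Lies Q.σ W (Q.conj F W) := fun x => Iff.rfl

theorem conj_conj (W : Place Y) : Q.conj F (Q.conj F W) = W := by
  apply Place.ext
  ext x
  change Q.σ (Q.σ x) ∈ W.A ↔ _
  rw [Q.σσ]

theorem conj_ord (W : Place Y) (y : Y) : (Q.conj F W).ord y = W.ord (Q.σ y) := by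
  obtain ⟨e, he, h⟩ := (Q.conj_lies F W).ord
  have h1 := h (Q.σ W.pi)
  rw [Q.σσ, W.ord_pi] at h1
  have : e = 1 := Int.eq_one_of_mul_eq_one_right he.le h1.symm
  rw [h, this, one_mul]

theorem conj_G (W : Place Y) {n : ℤ} {y : Y} : (Q.conj F W).G n y ↔ W.G n (Q.σ y) := by
  rw [Place.G_iff', Place.G_iff', conj_ord, map_eq_zero]

theorem rest_conj (W : Place Y) : Q.rest F (Q.conj F W) = Q.rest F W := by
  apply Place.ext
  ext x
  change Q.σ (algebraMap X Y x) ∈ W.A ↔ algebraMap X Y x ∈ W.A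
  rw [Q.σX]

theorem fibre {W W' : Place Y} (h : Q.rest F W' = Q.rest F W) : W' = W ∨ W' = Q.conj F W := by
  classical
  by_contra hne
  push Not at hne
  obtain ⟨h1, h2⟩ := hne
  have h3 : Q.conj F W' ≠ W := fun h => h2 (by rw [← h, conj_conj])
  have h4 : Q.conj F W' ≠ Q.conj F W := fun h => h1 (by rw [← Q.conj_conj F W', h, conj_conj])
  obtain ⟨y, hy⟩ := Place.approx {W', Q.conj F W', W, Q.conj F W}
    (fun U => if U = W' ∨ U = Q.conj F W' then 0 else 1) 1
  have y1 := hy W' (by simp)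
  have y2 := hy (Q.conj F W') (by simp)
  have y3 := hy W (by simp)
  have y4 := hy (Q.conj F W) (by simp)
  rw [if_pos (Or.inl rfl), sub_zero] at y1
  rw [if_pos (Or.inr rfl), sub_zero] at y2
  rw [if_neg (by push Not; exact ⟨fun h => h1 h.symm, fun h => h3 h.symm⟩)] at y3
  rw [if_neg (by push Not; exact ⟨fun h => h2 h.symm, fun h => h4 h.symm⟩)] at y4
  have one : ∀ U : Place Y, U.G 1 (y - 1) → U.ord y = 0 ∧ y ≠ 0 := fun U hU => by
    have := U.ord_add_eq (x := 1) one_ne_zero (y := y - 1) (by rw [U.ord_one]; simpa using hU)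
    rwa [add_sub_cancel, U.ord_one] at this
  have y3' := one _ y3
  have y4' := one _ y4
  have hσy : Q.σ y ≠ 0 := by simpa using y3'.2
  rw [conj_ord] at y4'
  rw [conj_G, W'.G_iff hσy] at y2
  rw [W'.G_iff y3'.2] at y1
  obtain ⟨e, he, ho⟩ := (Q.rest_lies F W).ord
  obtain ⟨e', he', ho'⟩ := (Q.rest_lies F W').ord
  have a := ho (Q.N y)
  have a' := ho' (Q.N y)
  rw [Q.hN, Place.ord_mul _ y3'.2 hσy, y3'.1, y4'.1] at a
  rw [Q.hN, Place.ord_mul _ y3'.2 hσy, h] at a'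
  have : (Q.rest F W).ord (Q.N y) = 0 := by
    rcases mul_eq_zero.1 (show e * _ = 0 by linarith [a]) with h | h
    · omega
    · exact h
  rw [this] at a'
  omega

theorem exists_over (V : Place X) : ∃ W : Place Y, Q.rest F W = V := by
  let A := V.A.toSubring.map (algebraMap X Y)
  have hpV : V.pi ∈ V.A := V.mem_iff.2 ((V.G_iff V.pi_ne).2 (by rw [V.ord_pi]; omega))
  have hp : algebraMap X Y V.pi ∈ A := ⟨V.pi, hpV, rfl⟩
  have hI : Ideal.span {(⟨algebraMap X Y V.pi, hp⟩ : A)} ≠ ⊤ := by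
    intro h
    rw [Ideal.span_singleton_eq_top] at h
    obtain ⟨⟨w, w', hw', rfl⟩, hw⟩ := h.exists_right_inv
    have h2 := congrArg Subtype.val hw
    have h3 : algebraMap X Y V.pi * algebraMap X Y w' = 1 := h2
    rw [← map_mul, ← map_one (algebraMap X Y)] at h3
    have h4 := (algebraMap X Y).injective h3
    have h5 : V.pi⁻¹ = w' := (eq_inv_of_mul_eq_one_right h4).symm
    exact V.not_mem_inv (x := V.pi) (by rw [V.ord_pi]; omega) (by rw [h5]; exact hw')
  obtain ⟨B, hB, hB2⟩ := Ideal.image_subset_nonunits_valuationSubring _ hI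
  have hz1 : algebraMap X Y V.pi ∈ B.nonunits := hB2 ⟨⟨_, hp⟩, Ideal.mem_span_singleton_self _, rfl⟩
  have hz0 : algebraMap X Y V.pi ≠ 0 := by simpa using V.pi_ne
  have hz2 : (algebraMap X Y V.pi)⁻¹ ∉ B := ((ValuationSubring.mem_nonunits_iff_or B).1 hz1).resolve_left hz0
  have hne : B ≠ ⊤ := by rintro rfl; exact hz2 (ValuationSubring.mem_top _)
  refine ⟨⟨B, dvr_of_ne_top F B hne⟩, (Place.eq_of_le ?_).symm⟩
  intro x hx
  exact hB ⟨x, hx, rfl⟩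

/-- if the place is not fixed by conjugation, then it is unramified -/
theorem ord_of_ne {W : Place Y} (h : Q.conj F W ≠ W) (x : X) : W.ord (algebraMap X Y x) = (Q.rest F W).ord x := by
  classical
  obtain ⟨e, he, ho⟩ := (Q.rest_lies F W).ord
  obtain ⟨y, hy⟩ := Place.approx {W, Q.conj F W} (fun U => if U = W then W.pi else 1) 2
  have y1 := hy W (by simp)
  have y2 := hy (Q.conj F W) (by simp)
  rw [if_pos rfl] at y1
  rw [if_neg h] at y2
  have h1 := W.ord_add_eq W.pi_ne (y := y - W.pi) (by rw [W.ord_pi]; exact y1)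
  have h2 := (Q.conj F W).ord_add_eq one_ne_zero (y := y - 1) (by rw [Place.ord_one]; exact Place.G_mono _ (by omega) y2)
  rw [add_sub_cancel, W.ord_pi] at h1
  rw [add_sub_cancel, Place.ord_one, conj_ord] at h2
  have h3 := ho (Q.N y)
  rw [Q.hN, W.ord_mul h1.2 (by simpa using h1.2), h1.1, h2.1] at h3
  have : e = 1 := Int.eq_one_of_mul_eq_one_right he.le h3.symm
  rw [ho, this, one_mul]

/-- residue extension is trivial -/
def Surj (Q : Quad X Y) (W : Place Y) : Prop := ∀ y, W.G 0 y → ∃ u : X, W.G 1 (y - algebraMap X Y u)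

theorem surj_of_ne {W : Place Y} (h : Q.conj F W ≠ W) : Q.Surj W := by
  classical
  intro y hy
  obtain ⟨z, hz⟩ := Place.approx {W, Q.conj F W} (fun U => if U = W then y else 0) 1
  have z1 := hz W (by simp)
  have z2 := hz (Q.conj F W) (by simp)
  rw [if_pos rfl] at z1
  rw [if_neg h, sub_zero, conj_G] at z2
  obtain ⟨t, ht⟩ := Q.tr z
  refine ⟨t, ?_⟩
  have := W.G_neg (W.G_add z1 z2)
  rw [ht]
  convert this using 1
  ring

end Quad
end
end FF
end

section
open IntermediateField Polynomial
namespace FF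
set_option linter.unusedSectionVars false
set_option linter.unusedVariables false

section
variable {X : Type*} [Field X] (V : Place X)

theorem Place.G_one {y : X} (h : V.G 1 (y - 1)) : y ≠ 0 ∧ V.ord y = 0 := by
  have := V.ord_add_eq (x := 1) one_ne_zero (y := y - 1) (by rw [V.ord_one]; simpa using h)
  rw [add_sub_cancel, V.ord_one] at this
  exact ⟨this.2, this.1⟩

/-- `b` is locally a square up to first order -/
def plus (V : Place X) (b : X) : Prop := ∃ c, V.G 1 (b * c ^ 2 - 1)

variable {V}
theorem plus.ne {b : X} (h : plus V b) : b ≠ 0 := by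
  rintro rfl
  obtain ⟨c, hc⟩ := h
  have := V.G_one hc
  simp at this

theorem plus.even {b : X} (h : plus V b) : Even (V.ord b) := by
  have h0 := h.ne
  obtain ⟨c, hc⟩ := h
  have h1 := V.G_one hc
  have hc0 : c ≠ 0 := by rintro rfl; simp at h1
  rw [V.ord_mul h0 (pow_ne_zero 2 hc0), V.ord_pow] at h1
  refine ⟨-V.ord c, ?_⟩
  have := h1.2
  push_cast at this
  omega

theorem plus.mul {b b' : X} (h : plus V b) (h' : plus V b') : plus V (b * b') := by
  obtain ⟨c, hc⟩ := h
  obtain ⟨c', hc'⟩ := h'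
  refine ⟨c * c', ?_⟩
  have h1 := V.G_one hc'
  have h2 : V.G 0 (b' * c' ^ 2) := (V.G_iff h1.1).2 (by omega)
  have h3 := V.G_add (V.G_mul hc h2) (by simpa using hc')
  rw [add_zero] at h3
  convert h3 using 1
  ring

theorem plus.sq {x : X} (hx : x ≠ 0) : plus V (x ^ 2) := by
  refine ⟨x⁻¹, ?_⟩
  rw [← mul_pow, mul_inv_cancel₀ hx, one_pow, sub_self]
  exact V.G_zero

theorem plus_mul_sq {b x : X} (hx : x ≠ 0) : plus V (b * x ^ 2) ↔ plus V b := by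
  constructor
  · rintro ⟨c, hc⟩
    refine ⟨c * x, ?_⟩
    convert hc using 1; ring
  · intro h; exact h.mul (plus.sq hx)

theorem plus_iff_isSquare {b : X} (hb : b ≠ 0) (hb0 : V.ord b = 0) (hbA : b ∈ V.A) :
    plus V b ↔ IsSquare (IsLocalRing.residue V.A ⟨b, hbA⟩) := by
  have key : ∀ a c : V.A, IsLocalRing.residue V.A a = IsLocalRing.residue V.A c ↔ V.G 1 ((a : X) - c) := by
    intro a c
    rw [← sub_eq_zero, ← map_sub, IsLocalRing.residue_eq_zero_iff, Place.mem_max_iff]; rfl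
  constructor
  · rintro ⟨c, hc⟩
    have h1 := V.G_one hc
    have hc0 : c ≠ 0 := by rintro rfl; simp at h1
    rw [V.ord_mul hb (pow_ne_zero 2 hc0), V.ord_pow, hb0] at h1
    have hco : V.ord c = 0 := by have := h1.2; push_cast at this; omega
    have hcA : c⁻¹ ∈ V.A := V.mem_iff.2 ((V.G_iff (inv_ne_zero hc0)).2 (by rw [V.ord_inv]; omega))
    refine ⟨IsLocalRing.residue V.A ⟨c⁻¹, hcA⟩, ?_⟩
    rw [← map_mul, key]
    have h2 : V.G 0 (c⁻¹ ^ 2) := (V.G_iff (pow_ne_zero 2 (inv_ne_zero hc0))).2 (by rw [V.ord_pow, V.ord_inv]; push_cast; omega)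
    have h3 := V.G_mul hc h2
    rw [add_zero] at h3
    convert h3 using 1
    change b - c⁻¹ * c⁻¹ = _
    field_simp
  · rintro ⟨r, hr⟩
    obtain ⟨⟨c, hcA⟩, rfl⟩ := IsLocalRing.residue_surjective r
    rw [← map_mul, key] at hr
    have hr : V.G 1 (b - c * c) := hr
    have h1 := V.ord_add_eq hb (y := -(b - c * c)) (by rw [hb0]; exact V.G_neg hr)
    have h2 : b + -(b - c * c) = c ^ 2 := by ring
    rw [h2, V.ord_pow, hb0] at h1
    have hc0 : c ≠ 0 := by rintro rfl; simp at h1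
    have hco : V.ord c = 0 := by have := h1.1; push_cast at this; omega
    refine ⟨c⁻¹, ?_⟩
    have h3 : V.G 0 (c⁻¹ ^ 2) := (V.G_iff (pow_ne_zero 2 (inv_ne_zero hc0))).2 (by rw [V.ord_pow, V.ord_inv]; push_cast; omega)
    have h4 := V.G_mul hr h3
    rw [add_zero] at h4
    convert h4 using 1
    field_simp

/-- local norms at inert places have even order -/
theorem even_of_not_plus {b : X} (hb : b ≠ 0) (he : Even (V.ord b)) (hp : ¬ plus V b) (x y : X) :
    Even (V.ord (x ^ 2 - b * y ^ 2)) := by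
  by_cases hy : y = 0
  · rw [hy]; simp [V.ord_pow]
  have hby : b * y ^ 2 ≠ 0 := mul_ne_zero hb (pow_ne_zero 2 hy)
  have heby : Even (V.ord (b * y ^ 2)) := by
    rw [V.ord_mul hb (pow_ne_zero 2 hy), V.ord_pow]
    exact he.add (by simp)
  by_cases h : V.G (V.ord (b * y ^ 2) + 1) (x ^ 2)
  · have := V.ord_add_eq hby (y := - x ^ 2) (V.G_neg h)
    rw [show x ^ 2 - b * y ^ 2 = -(b * y ^ 2 + - x ^ 2) by ring, V.ord_neg, this.1]
    exact heby
  · have hx : x ≠ 0 := by rintro rfl; apply h; rw [zero_pow two_ne_zero]; exact V.G_zero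
    have hx2 := pow_ne_zero 2 hx
    rw [V.G_iff hx2] at h
    have e : x ^ 2 - b * y ^ 2 = x ^ 2 * -(b * (y / x) ^ 2 - 1) := by field_simp; ring
    by_cases hw : b * (y / x) ^ 2 - 1 = 0
    · exact absurd ⟨y / x, by rw [hw]; exact V.G_zero⟩ hp
    have h0 : V.G 0 (b * (y / x) ^ 2 - 1) := by
      refine V.G_sub ?_ ((V.G_iff one_ne_zero).2 (by rw [V.ord_one]))
      rw [show b * (y / x) ^ 2 = (b * y ^ 2) / x ^ 2 by field_simp, V.G_iff (div_ne_zero hby hx2), V.ord_div hby hx2]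
      omega
    have h1 : ¬ V.G 1 (b * (y / x) ^ 2 - 1) := fun h => hp ⟨_, h⟩
    rw [V.G_iff hw] at h0 h1
    rw [e, V.ord_mul hx2 (neg_ne_zero.2 hw), V.ord_neg, V.ord_pow, show V.ord (b * (y / x) ^ 2 - 1) = 0 by omega]
    simp

/-- scaling to a unit -/
theorem exists_unit {b : X} (hb : b ≠ 0) (he : Even (V.ord b)) :
    ∃ x : X, x ≠ 0 ∧ V.ord (b * x ^ 2) = 0 ∧ b * x ^ 2 ∈ V.A := by
  obtain ⟨k, hk⟩ := he
  have h0 := zpow_ne_zero (-k) V.pi_ne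
  have h1 : V.ord (b * (V.pi ^ (-k)) ^ 2) = 0 := by
    rw [V.ord_mul hb (pow_ne_zero 2 h0), V.ord_pow, V.ord_zpow, V.ord_pi, hk]; push_cast; ring
  exact ⟨V.pi ^ (-k), h0, h1, V.mem_iff.2 ((V.G_iff (mul_ne_zero hb (pow_ne_zero 2 h0))).2 h1.ge)⟩

end

section
variable (F : Type*) {X : Type*} [Field F] [Field X] [Algebra F X] [Finite F] [GFF F X]
include F

theorem ord_two (h2 : (2 : X) ≠ 0) (V : Place X) : V.ord (2 : X) = 0 := by
  rw [← map_ofNat (algebraMap F X) 2]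
  exact Place.ord_algebraMap F V 2

theorem plus_of_not {V : Place X} (h2 : (2 : X) ≠ 0) {a b : X} (ha : a ≠ 0) (hb : b ≠ 0) (hea : Even (V.ord a))
    (heb : Even (V.ord b)) (hpa : ¬ plus V a) (hpb : ¬ plus V b) : plus V (a * b) := by
  obtain ⟨x, hx, hx0, hxA⟩ := exists_unit ha hea
  obtain ⟨y, hy, hy0, hyA⟩ := exists_unit hb heb
  rw [← plus_mul_sq (V := V) hx, plus_iff_isSquare (mul_ne_zero ha (pow_ne_zero 2 hx)) hx0 hxA] at hpa
  rw [← plus_mul_sq (V := V) hy, plus_iff_isSquare (mul_ne_zero hb (pow_ne_zero 2 hy)) hy0 hyA] at hpb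
  rw [← plus_mul_sq (mul_ne_zero hx hy), show a * b * (x * y) ^ 2 = (a * x ^ 2) * (b * y ^ 2) by ring]
  have hx1 := mul_ne_zero ha (pow_ne_zero 2 hx)
  have hy1 := mul_ne_zero hb (pow_ne_zero 2 hy)
  rw [plus_iff_isSquare (mul_ne_zero hx1 hy1) (by rw [V.ord_mul hx1 hy1, hx0, hy0, add_zero]) (V.A.mul_mem _ _ hxA hyA)]
  have e : IsLocalRing.residue V.A ⟨(a * x ^ 2) * (b * y ^ 2), V.A.mul_mem _ _ hxA hyA⟩ =
    IsLocalRing.residue V.A ⟨a * x ^ 2, hxA⟩ * IsLocalRing.residue V.A ⟨b * y ^ 2, hyA⟩ := by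
    rw [← map_mul]; rfl
  rw [e]
  have := Place.finite_res' F V
  have := Fintype.ofFinite V.res
  classical
  set α := IsLocalRing.residue V.A ⟨a * x ^ 2, hxA⟩
  set β := IsLocalRing.residue V.A ⟨b * y ^ 2, hyA⟩
  have hchar : ringChar V.res ≠ 2 := by
    intro hch
    have h : (2 : V.res) = 0 := by
      have := neg_one_eq_one_iff.2 hch
      linear_combination -this
    have h3 : IsLocalRing.residue V.A 2 = 0 := by rw [map_ofNat]; exact h
    rw [IsLocalRing.residue_eq_zero_iff, Place.mem_max_iff] at h3
    have h3 : V.G 1 (2 : X) := h3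
    rw [V.G_iff h2, ord_two F h2] at h3
    omega
  have hα : α ≠ 0 := by rintro h; rw [h] at hpa; exact hpa (IsSquare.zero)
  have hβ : β ≠ 0 := by rintro h; rw [h] at hpb; exact hpb (IsSquare.zero)
  rw [← quadraticChar_one_iff_isSquare (mul_ne_zero hα hβ), map_mul,
    quadraticChar_neg_one_iff_not_isSquare.2 hpa, quadraticChar_neg_one_iff_not_isSquare.2 hpb]
  norm_num

end

section
variable (F : Type*) {X Y : Type*} [Field F] [Field X] [Field Y] [Algebra F X] [Algebra F Y] [Algebra X Y]
  [IsScalarTower F X Y] [Finite F] [GFF F X] [GFF F Y] (Q : Quad X Y)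

namespace Quad
include Q F

theorem plus_up {W : Place Y} {a : X} (h : plus (Q.rest F W) a) : plus W (algebraMap X Y a) := by
  obtain ⟨c, hc⟩ := h
  refine ⟨algebraMap X Y c, ?_⟩
  rw [(Q.rest_lies F W).G] at hc
  simpa using hc

theorem plus_down {W : Place Y} (hS : Q.Surj W) {a : X} (he : Even ((Q.rest F W).ord a))
    (h : plus W (algebraMap X Y a)) : plus (Q.rest F W) a := by
  set V := Q.rest F W
  have ha : a ≠ 0 := by rintro rfl; exact h.ne (map_zero _)
  obtain ⟨x, hx, hx0, hxA⟩ := exists_unit ha he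
  rw [← plus_mul_sq hx]
  have hx' : algebraMap X Y x ≠ 0 := by simpa using hx
  rw [← plus_mul_sq hx', ← map_pow, ← map_mul] at h
  set a' := a * x ^ 2
  have ha' : a' ≠ 0 := mul_ne_zero ha (pow_ne_zero 2 hx)
  have ha'' : algebraMap X Y a' ≠ 0 := by simpa using ha'
  obtain ⟨e, he, ho⟩ := (Q.rest_lies F W).ord
  have h1 : W.ord (algebraMap X Y a') = 0 := by rw [ho, hx0, mul_zero]
  obtain ⟨c, hc⟩ := h
  have h2 := W.G_one hc
  have hc0 : c ≠ 0 := by rintro rfl; simp at h2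
  rw [W.ord_mul ha'' (pow_ne_zero 2 hc0), W.ord_pow, h1] at h2
  have hco : W.ord c = 0 := by have := h2.2; push_cast at this; omega
  have hc1 : W.G 0 c := (W.G_iff hc0).2 hco.ge
  obtain ⟨u, hu⟩ := hS c hc1
  refine ⟨u, ?_⟩
  rw [(Q.rest_lies F W).G]
  have hu0 : W.G 0 (algebraMap X Y u) := by
    have := W.G_sub hc1 (W.G_mono (by omega : (0:ℤ) ≤ 1) hu)
    simpa using this
  have h3 : W.G 1 (algebraMap X Y a' * ((c - algebraMap X Y u) * (c + algebraMap X Y u))) := by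
    have := W.G_mul ((W.G_iff ha'').2 h1.ge) (W.G_mul hu (W.G_add hc1 hu0))
    simpa using this
  have h4 := W.G_sub hc h3
  convert h4 using 1
  simp only [map_sub, map_mul, map_pow, map_one]
  ring

theorem conj_ne_of_plus {W : Place Y} (h : plus (Q.rest F W) Q.b) : Q.conj F W ≠ W := by
  intro hW
  obtain ⟨c, hc⟩ := h
  rw [(Q.rest_lies F W).G] at hc
  have h2 : ¬ W.G 1 (2 : Y) := by rw [W.G_iff Q.two_ne, ord_two F Q.two_ne]; omega
  set t := algebraMap X Y c * Q.s
  have e : algebraMap X Y (Q.b * c ^ 2 - 1) = (t - 1) * (t + 1) := by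
    simp only [map_sub, map_mul, map_pow, map_one, ← Q.hs, t]; ring
  have hσ : Q.σ t = - t := by simp [t, Q.σX, Q.σs]
  have key : W.G 1 (t - 1) ↔ W.G 1 (t + 1) := by
    conv_lhs => rw [← hW, conj_G, map_sub, hσ, map_one]
    constructor
    · intro h; have := W.G_neg h; convert this using 1; ring
    · intro h; have := W.G_neg h; convert this using 1; ring
  have hn : ¬ W.G 1 (t - 1) := by
    intro h
    have := W.G_sub (key.1 h) h
    apply h2
    convert this using 1; ring
  have hn' := key.not.1 hn
  have h3 : t - 1 ≠ 0 := by intro h; rw [h] at hn; exact hn W.G_zero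
  have h4 : t + 1 ≠ 0 := by intro h; rw [h] at hn'; exact hn' W.G_zero
  rw [e, W.G_iff (mul_ne_zero h3 h4), W.ord_mul h3 h4] at hc
  rw [W.G_iff h3] at hn
  rw [W.G_iff h4] at hn'
  omega

theorem not_surj {W : Place Y} (he : Even ((Q.rest F W).ord Q.b)) (h : ¬ plus (Q.rest F W) Q.b) : ¬ Q.Surj W := by
  intro hS
  apply h
  apply Q.plus_down F hS he
  rw [← Q.hs]
  exact plus.sq Q.s_ne

theorem N_ne {y : Y} (hy : y ≠ 0) : Q.N y ≠ 0 := by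
  intro h
  have := Q.hN y
  rw [h, map_zero] at this
  exact mul_ne_zero hy (by simpa using hy) this.symm

theorem ordN_of_ne {W : Place Y} (h : Q.conj F W ≠ W) {y : Y} (hy : y ≠ 0) :
    (Q.rest F W).ord (Q.N y) = W.ord y + (Q.conj F W).ord y := by
  rw [← Q.ord_of_ne F h, Q.hN, W.ord_mul hy (by simpa using hy), conj_ord]

theorem odd_aux {W : Place Y} (ho : ¬ Even ((Q.rest F W).ord Q.b)) :
    Q.conj F W = W ∧ ∀ x, W.ord (algebraMap X Y x) = 2 * (Q.rest F W).ord x := by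
  have hs := congrArg W.ord Q.hs
  rw [W.ord_pow] at hs
  have h1 : Q.conj F W = W := by
    by_contra h
    rw [Q.ord_of_ne F h] at hs
    exact ho ⟨W.ord Q.s, by rw [← hs]; push_cast; ring⟩
  refine ⟨h1, ?_⟩
  obtain ⟨e, he, hoe⟩ := (Q.rest_lies F W).ord
  have h2 := hoe (Q.N W.pi)
  rw [Q.hN, W.ord_mul W.pi_ne (by simpa using W.pi_ne), ← Q.conj_ord F, h1, W.ord_pi] at h2
  have h3 : e ∣ 2 := ⟨_, by linarith⟩
  rw [hoe] at hs
  have h4 : Even e := by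
    have h5 : Even (e * (Q.rest F W).ord Q.b) := by rw [← hs]; simp
    exact (Int.even_mul.1 h5).resolve_right ho
  have h5 : e = 2 := by
    obtain ⟨k, hk⟩ := h4
    have := Int.le_of_dvd (by norm_num) h3
    omega
  intro x
  rw [hoe, h5]

theorem ordN_of_odd {W : Place Y} (ho : ¬ Even ((Q.rest F W).ord Q.b)) {y : Y} (hy : y ≠ 0) :
    (Q.rest F W).ord (Q.N y) = W.ord y := by
  obtain ⟨h1, h2⟩ := Q.odd_aux F ho
  have h3 := h2 (Q.N y)
  rw [Q.hN, W.ord_mul hy (by simpa using hy), ← Q.conj_ord F, h1] at h3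
  omega

theorem surj_of_odd {W : Place Y} (ho : ¬ Even ((Q.rest F W).ord Q.b)) : Q.Surj W := by
  obtain ⟨h1, h2⟩ := Q.odd_aux F ho
  intro y hy
  obtain ⟨u, v, rfl⟩ := Q.rep y
  refine ⟨u, ?_⟩
  rw [add_sub_cancel_left]
  by_cases hv : v = 0
  · rw [hv]; simp [Place.G_zero]
  have hv' : algebraMap X Y v ≠ 0 := by simpa using hv
  have hvs := mul_ne_zero hv' Q.s_ne
  have hso : 2 * W.ord Q.s = 2 * (Q.rest F W).ord Q.b := by
    rw [← h2, ← Q.hs, W.ord_pow]; push_cast; rfl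
  have h3 : W.ord (algebraMap X Y v * Q.s) = 2 * (Q.rest F W).ord v + (Q.rest F W).ord Q.b := by
    rw [W.ord_mul hv' Q.s_ne, h2]; omega
  rw [W.G_iff hvs]
  by_contra hlt
  have hodd : ¬ Even (W.ord (algebraMap X Y v * Q.s)) := by
    rw [h3, Int.even_add]; simpa using ho
  have hlt0 : W.ord (algebraMap X Y v * Q.s) < 0 := by
    rcases lt_or_eq_of_le (show W.ord (algebraMap X Y v * Q.s) ≤ 0 by omega) with h | h
    · exact h
    · rw [h] at hodd; exact absurd (by decide : Even (0:ℤ)) hodd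
  by_cases hu : u = 0
  · rw [hu, map_zero, zero_add, W.G_iff hvs] at hy; omega
  have hu' : algebraMap X Y u ≠ 0 := by simpa using hu
  have hne : W.ord (algebraMap X Y u) ≠ W.ord (algebraMap X Y v * Q.s) := by
    intro h; rw [← h, h2] at hodd; exact hodd (by simp)
  rcases lt_or_gt_of_ne hne with h | h
  · have := W.ord_add_eq hu' (y := algebraMap X Y v * Q.s) ((W.G_iff hvs).2 (by omega))
    rw [W.G_iff this.2, this.1] at hy
    omega
  · have := W.ord_add_eq hvs (y := algebraMap X Y u) ((W.G_iff hu').2 (by omega))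
    rw [add_comm, W.G_iff this.2, this.1] at hy
    omega

end Quad
end
end FF
end

section
open IntermediateField Polynomial
namespace FF
set_option linter.unusedSectionVars false
set_option linter.unusedVariables false
set_option linter.style.haveILetI false

section
variable (F : Type*) {X Y : Type*} [Field F] [Field X] [Field Y] [Algebra F X] [Algebra F Y] [Algebra X Y]
  [IsScalarTower F X Y] [Finite F] [GFF F X] [GFF F Y] (Q : Quad X Y)

namespace Quad
include Q F

/-- map of valuation rings -/
noncomputable def rmap (W : Place Y) : (Q.rest F W).A →+* W.A where
  toFun x := ⟨algebraMap X Y x, x.2⟩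
  map_one' := by ext; simp
  map_mul' := by intros; ext; simp
  map_zero' := by ext; simp
  map_add' := by intros; ext; simp

theorem rmap_local (W : Place Y) : IsLocalHom (Q.rmap F W) := by
  refine ⟨fun a ha => ?_⟩
  by_contra h
  have h1 : a ∈ IsLocalRing.maximalIdeal (Q.rest F W).A := h
  rw [Place.mem_max_iff, (Q.rest_lies F W).G] at h1
  have h2 : Q.rmap F W a ∈ IsLocalRing.maximalIdeal W.A := by
    rw [Place.mem_max_iff]; exact h1
  exact h2 ha

theorem exists_resMap (W : Place Y) : ∃ f : (Q.rest F W).res →+* W.res,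
    (∀ c : F, f (algebraMap F _ c) = algebraMap F _ c) ∧ (Function.Surjective f ↔ Q.Surj W) := by
  have := Q.rmap_local F W
  refine ⟨IsLocalRing.ResidueField.map (Q.rmap F W), fun c => ?_, ?_⟩
  · have h1 : algebraMap F (Q.rest F W).res c = IsLocalRing.residue _ (algebraMap F (Q.rest F W).A c) := rfl
    have h2 : algebraMap F W.res c = IsLocalRing.residue _ (algebraMap F W.A c) := rfl
    rw [h1, h2, IsLocalRing.ResidueField.map_residue]
    congr 1
    apply Subtype.ext
    change algebraMap X Y (algebraMap F X c) = algebraMap F Y c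
    rw [← IsScalarTower.algebraMap_apply]
  · have key : ∀ a c : W.A, IsLocalRing.residue W.A a = IsLocalRing.residue W.A c ↔ W.G 1 ((a : Y) - c) := by
      intro a c
      rw [← sub_eq_zero, ← map_sub, IsLocalRing.residue_eq_zero_iff, Place.mem_max_iff]; rfl
    constructor
    · intro h y hy
      obtain ⟨r, hr⟩ := h (IsLocalRing.residue W.A ⟨y, W.mem_iff.2 hy⟩)
      obtain ⟨u, rfl⟩ := IsLocalRing.residue_surjective r
      rw [IsLocalRing.ResidueField.map_residue] at hr
      exact ⟨u, (key _ _).1 hr.symm⟩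
    · intro h r
      obtain ⟨⟨y, hyA⟩, rfl⟩ := IsLocalRing.residue_surjective r
      obtain ⟨u, hu⟩ := h y (W.mem_iff.1 hyA)
      have huA : u ∈ (Q.rest F W).A := by
        rw [Place.mem_iff, (Q.rest_lies F W).G0]
        have := W.G_sub (W.mem_iff.1 hyA) (W.G_mono (by omega : (0:ℤ) ≤ 1) hu)
        simpa using this
      refine ⟨IsLocalRing.residue _ ⟨u, huA⟩, ?_⟩
      rw [IsLocalRing.ResidueField.map_residue]
      exact ((key _ _).2 hu).symm

theorem deg_eq {W : Place Y} (h : Q.Surj W) : W.deg F = (Q.rest F W).deg F := by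
  obtain ⟨f, hf, hs⟩ := Q.exists_resMap F W
  let g : (Q.rest F W).res →ₐ[F] W.res := { f with commutes' := hf }
  exact (LinearEquiv.finrank_eq (AlgEquiv.ofBijective g ⟨f.injective, hs.2 h⟩).toLinearEquiv).symm

theorem deg_ge {W : Place Y} (h : ¬ Q.Surj W) : 2 * (Q.rest F W).deg F ≤ W.deg F := by
  obtain ⟨f, hf, hs⟩ := Q.exists_resMap F W
  letI := f.toAlgebra
  haveI : IsScalarTower F (Q.rest F W).res W.res := IsScalarTower.of_algebraMap_eq fun c => (hf c).symm
  have h1 := Module.finrank_mul_finrank F (Q.rest F W).res W.res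
  have := Place.finite_res F W
  haveI : Module.Finite (Q.rest F W).res W.res := Module.Finite.of_restrictScalars_finite F _ _
  have h2 : 0 < Module.finrank (Q.rest F W).res W.res := Module.finrank_pos
  have h3 : Module.finrank (Q.rest F W).res W.res ≠ 1 := by
    intro h3
    apply h
    rw [← hs]
    have := Subalgebra.bot_eq_top_of_finrank_eq_one h3
    intro r
    have hr : r ∈ (⊥ : Subalgebra (Q.rest F W).res W.res) := by rw [this]; trivial
    exact Algebra.mem_bot.1 hr
  have h4 : 2 ≤ Module.finrank (Q.rest F W).res W.res := by omega
  change 2 * Module.finrank F (Q.rest F W).res ≤ Module.finrank F W.res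
  rw [← h1, mul_comm]
  exact Nat.mul_le_mul_left _ h4

open Classical in
/-- fibre of the restriction map -/
noncomputable def fib (V : Place X) : Finset (Place Y) :=
  {(Q.exists_over F V).choose, Q.conj F (Q.exists_over F V).choose}

theorem mem_fib {V : Place X} {W : Place Y} : W ∈ Q.fib F V ↔ Q.rest F W = V := by
  classical
  have h := (Q.exists_over F V).choose_spec
  unfold fib
  rw [Finset.mem_insert, Finset.mem_singleton]
  constructor
  · rintro (rfl | rfl)
    · exact h
    · rw [rest_conj]; exact h
  · intro h'
    exact Q.fibre F (h'.trans h.symm)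

theorem card_fib (V : Place X) : (Q.fib F V).card ≤ 2 := by
  classical
  exact Finset.card_le_two

theorem fib_eq {V : Place X} {W : Place Y} (h : Q.rest F W = V) [DecidableEq (Place Y)] : Q.fib F V = {W, Q.conj F W} := by
  ext U
  rw [mem_fib, Finset.mem_insert, Finset.mem_singleton]
  constructor
  · intro h'; exact Q.fibre F (h'.trans h.symm)
  · rintro (rfl | rfl)
    · exact h
    · rw [rest_conj]; exact h

end Quad
end

theorem hasSum_fib {A B : Type*} (r : B → A) (fb : A → Finset B) (h : ∀ a b, b ∈ fb a ↔ r b = a)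
    (f : B → ℝ) (hf : Summable f) : HasSum (fun a => ∑ b ∈ fb a, f b) (∑' b, f b) := by
  have h1 := (Equiv.hasSum_iff (Equiv.sigmaFiberEquiv r)).2 hf.hasSum
  refine h1.sigma fun V => ?_
  have h2 : HasSum (fun W : {W // W ∈ fb V} => f (W : B)) (∑ b ∈ fb V, f b) :=
    Finset.hasSum (fb V) f
  exact (Equiv.hasSum_iff (Equiv.subtypeEquivRight fun W => (h V W).symm)).2 h2

section
variable {X : Type*} [Field X]
open Classical in
/-- local quadratic character -/
noncomputable def chi (b : X) (V : Place X) : ℝ := if plus V b then 1 else -1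

theorem abs_chi (b : X) (V : Place X) : |chi b V| ≤ 1 := by
  unfold chi; split_ifs <;> simp
end

section
variable (F : Type*) {X Y : Type*} [Field F] [Field X] [Field Y] [Algebra F X] [Algebra F Y] [Algebra X Y]
  [IsScalarTower F X Y] [Finite F] [GFF F X] [GFF F Y] (Q : Quad X Y)
include Q F
set_option maxHeartbeats 1000000 in
theorem Quad.dens_chi : Dens F (chi Q.b) 0 := by
  classical
  obtain ⟨C, hC⟩ := Dens.one F (X := Y)
  obtain ⟨C2, hC2, hH⟩ := H_sq F X
  have hbad := finite_supp F Q.b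
  obtain ⟨C1, hC1⟩ := Dens.one F (X := X)
  refine ⟨C + C1 + 2 * C2 + 4 * hbad.toFinset.card, fun x hx1 hqx => ?_⟩
  have hx := x_pos F hx1
  have hxl := x_le F hqx
  have hY := hC x hx1 hqx
  have hX := hC1 x hx1 hqx
  simp only [one_mul] at hY hX
  have sY := summable_deg F (X := Y) x hx.le hqx
  have sX := summable_deg F (X := X) x hx.le hqx
  have s2 := (hH x hx.le hqx).1
  -- fibre sums
  let g : Place X → ℝ := fun V => ∑ W ∈ Q.fib F V, x ^ W.deg F
  have hg : HasSum g (∑' W : Place Y, x ^ W.deg F) :=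
    hasSum_fib (Q.rest F) (Q.fib F) (fun V W => Q.mem_fib F) (fun W => x ^ W.deg F) sY
  have sχ := summable_w F (chi Q.b) 1 (abs_chi Q.b) x hx.le hqx
  -- pointwise bound
  have hfin : Summable (fun V : Place X => if V ∈ hbad.toFinset then (4 : ℝ) else 0) :=
    summable_of_hasFiniteSupport (hbad.toFinset.finite_toSet.subset fun V hV => by
      by_contra h
      apply hV
      exact if_neg h)
  have hpt : ∀ V : Place X, |g V - (x ^ V.deg F + chi Q.b V * x ^ V.deg F)| ≤
      2 * (x ^ V.deg F) ^ 2 + if V ∈ hbad.toFinset then (4 : ℝ) else 0 := by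
    intro V
    have hxV : x ^ V.deg F ≤ 1 := pow_le_one₀ hx.le (by linarith)
    have hxV0 : 0 ≤ x ^ V.deg F := by positivity
    have hg0 : 0 ≤ g V := Finset.sum_nonneg fun W _ => by positivity
    have hsum : ∀ B : ℝ, 0 ≤ B → (∀ W ∈ Q.fib F V, x ^ W.deg F ≤ B) → g V ≤ 2 * B := fun B hB h => by
      calc g V ≤ ∑ W ∈ Q.fib F V, B := Finset.sum_le_sum h
        _ = (Q.fib F V).card * B := by rw [Finset.sum_const, nsmul_eq_mul]
        _ ≤ 2 * B := by gcongr; exact_mod_cast Q.card_fib F V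
    by_cases hV : V ∈ hbad.toFinset
    · rw [if_pos hV]
      have h1 := hsum 1 zero_le_one fun W _ => pow_le_one₀ hx.le (by linarith)
      have h2 := abs_le.1 (abs_chi Q.b V)
      rw [abs_le]
      constructor <;> nlinarith
    · rw [if_neg hV, add_zero]
      have hV0 : V.ord Q.b = 0 := by
        by_contra h
        exact hV (by simpa using h)
      by_cases hp : plus V Q.b
      · obtain ⟨W, rfl⟩ := Q.exists_over F V
        have h1 := Q.conj_ne_of_plus F hp
        have h2 : g (Q.rest F W) = 2 * x ^ (Q.rest F W).deg F := by
          simp only [g]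
          rw [Q.fib_eq F (W := W) rfl, Finset.sum_pair h1.symm, Q.deg_eq F (Q.surj_of_ne F h1),
            Q.deg_eq F (W := Q.conj F W) (Q.surj_of_ne F (by rw [Q.conj_conj F]; exact h1.symm)), Q.rest_conj F]
          ring
        rw [h2, chi, if_pos hp]
        rw [show 2 * x ^ (Q.rest F W).deg F - (x ^ (Q.rest F W).deg F + 1 * x ^ (Q.rest F W).deg F) = 0 by ring, abs_zero]
        positivity
      · rw [chi, if_neg hp, show g V - (x ^ V.deg F + -1 * x ^ V.deg F) = g V by ring, abs_of_nonneg hg0]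
        refine hsum _ (by positivity) fun W hW => ?_
        rw [Q.mem_fib F] at hW
        subst hW
        have h1 := Q.deg_ge F (Q.not_surj F (W := W) (by rw [hV0]; exact Even.zero) hp)
        rw [← pow_mul, mul_comm]
        exact pow_le_pow_of_le_one hx.le (by linarith) h1
  have hB : HasSum (fun V : Place X => 2 * (x ^ V.deg F) ^ 2 + if V ∈ hbad.toFinset then (4 : ℝ) else 0)
      (2 * (∑' V : Place X, (x ^ V.deg F) ^ 2) + 4 * hbad.toFinset.card) := by
    refine (s2.hasSum.mul_left 2).add ?_
    have : HasSum (fun V : Place X => if V ∈ hbad.toFinset then (4 : ℝ) else 0)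
        (∑ V ∈ hbad.toFinset, if V ∈ hbad.toFinset then (4 : ℝ) else 0) :=
      hasSum_sum_of_ne_finset_zero fun V hV => if_neg hV
    rwa [Finset.sum_congr rfl fun V hV => if_pos hV, Finset.sum_const, nsmul_eq_mul, mul_comm] at this
  have hD := hg.sub (sX.hasSum.add sχ.hasSum)
  have hfinal : |(∑' W : Place Y, x ^ W.deg F) - (∑' V : Place X, x ^ V.deg F + ∑' V, chi Q.b V * x ^ V.deg F)| ≤
      2 * (∑' V : Place X, (x ^ V.deg F) ^ 2) + 4 * hbad.toFinset.card := by
    rw [abs_le]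
    constructor
    · rw [← neg_le_neg_iff, neg_neg]
      exact hasSum_le (fun V => (neg_le_abs _).trans (hpt V)) hD.neg hB
    · exact hasSum_le (fun V => (le_abs_self _).trans (hpt V)) hD hB
  have h2 := (hH x hx.le hqx).2
  rw [abs_le] at *
  constructor <;> linarith [hY.1, hY.2, hX.1, hX.2, hfinal.1, hfinal.2]
end
end FF
end

section
open IntermediateField Polynomial
namespace FF
set_option linter.unusedSectionVars false
set_option linter.unusedVariables false
set_option linter.style.haveILetI false

universe u v
theorem GFF.of_finite {X Y : Type u} (F : Type v) [Field F] [Field X] [Field Y] [Algebra F X] [Algebra F Y] [Algebra X Y]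
    [IsScalarTower F X Y] [GFF F X] [Module.Finite X Y] : GFF F Y := by
  have := GFF.ess (F := F) (X := X)
  refine ⟨Algebra.EssFiniteType.comp F X Y, ?_⟩
  rw [← _root_.trdeg_add_eq F X, GFF.trdeg, _root_.trdeg_eq_zero_iff.2 inferInstance, add_zero]
section
variable (F : Type v) {X : Type u} [Field F] [Field X] [Algebra F X] [Finite F] [GFF F X]
include F

theorem exists_quad (h2 : (2 : X) ≠ 0) (b : X) (hb : ∀ x, x ^ 2 ≠ b) :
    ∃ (Y : Type u) (_ : Field Y) (_ : Algebra F Y) (_ : Algebra X Y) (_ : IsScalarTower F X Y)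
      (_ : GFF F Y) (Q : Quad X Y), Q.b = b := by
  haveI : Fact (∀ r, r ^ 2 ≠ b + 0 * r) := ⟨fun r => by simpa using hb r⟩
  refine ⟨QuadraticAlgebra X b 0, inferInstance, inferInstance, inferInstance, inferInstance,
    GFF.of_finite (X := X) F, ?_⟩
  refine ⟨{ b := b, s := QuadraticAlgebra.omega, σ := starRingEnd _, N := QuadraticAlgebra.norm,
            hs := ?_, hb := ?_, rep := ?_, σX := ?_, σs := ?_, hN := ?_, h2 := h2 }, rfl⟩
  · ext <;> simp [sq]
  · rintro rfl; exact hb 0 (by simp)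
  · intro y; exact ⟨y.re, y.im, by ext <;> simp⟩
  · intro x; ext <;> simp [starRingEnd_apply]
  · ext <;> simp [starRingEnd_apply]
  · intro y; rw [QuadraticAlgebra.algebraMap_norm_eq_mul_star, starRingEnd_apply]

theorem dens_chi (h2 : (2 : X) ≠ 0) (b : X) (hb : ∀ x, x ^ 2 ≠ b) : Dens F (chi b) 0 := by
  obtain ⟨Y, _, _, _, _, _, Q, rfl⟩ := exists_quad F h2 b hb
  exact Q.dens_chi F

theorem Dens.zero {a : ℝ} (h : Dens F (fun _ : Place X => 0) a) : a = 0 := by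
  obtain ⟨C, hC⟩ := h
  have hq := two_le_q F
  set q : ℝ := (Nat.card F : ℝ) with hqd
  by_contra ha
  have ha' : 0 < |a| := abs_pos.2 ha
  have h0 : 0 ≤ C := (abs_nonneg _).trans (hC (1/2/q) (by field_simp; rfl) (by field_simp; norm_num))
  set t := Real.exp (-(C + 1) / |a| - 1) with ht
  have htp : 0 < t := Real.exp_pos _
  have hth : t ≤ 1/2 := by
    have h1 : t ≤ Real.exp (-1) := Real.exp_le_exp.2 (by
      have : 0 ≤ (C + 1) / |a| := by positivity
      rw [neg_div]; linarith)
    have h2 : Real.exp (-1) < 1/2 := by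
      have := Real.exp_neg_one_lt_d9
      linarith
    linarith
  have h1 := hC ((1 - t) / q) (by field_simp; linarith) (by field_simp; linarith)
  have h3 : q * ((1 - t) / q) = 1 - t := by field_simp
  simp only [zero_mul, tsum_zero, zero_sub, abs_neg] at h1
  rw [h3, sub_sub_cancel, Real.log_inv, ht, Real.log_exp, abs_mul] at h1
  have h4 : (C + 1) / |a| + 1 ≤ |(-(-(C + 1) / |a| - 1))| := le_trans (le_of_eq (by ring)) (le_abs_self _)
  have h5 := mul_le_mul_of_nonneg_left h4 ha'.le
  have h6 : |a| * ((C + 1) / |a| + 1) = C + 1 + |a| := by field_simp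
  linarith

omit F in
/-- the set of places used for the character -/
def TT (ε η : X) (V : Place X) : Prop := ¬ plus V ε ∧ plus V η

omit F in
open Classical in
/-- the character -/
noncomputable def psi (ε η : X) (V : Place X) : ℝ := if TT ε η V then -1 else 1

omit F in
theorem psi_pm (ε η : X) (V : Place X) : psi ε η V = 1 ∨ psi ε η V = -1 := by
  unfold psi; split_ifs <;> simp

theorem finite_bad (ε : X) : {V : Place X | ¬ V.ord ε = 0}.Finite := finite_supp F ε

theorem chi_mul (h2 : (2 : X) ≠ 0) {ε η : X} (hε : ε ≠ 0) (hη : η ≠ 0) {V : Place X} (h : Even (V.ord ε))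
    (h' : Even (V.ord η)) : chi (ε * η) V = chi ε V * chi η V := by
  have key : ∀ {a b : X}, a ≠ 0 → plus V a → plus V (a * b) → plus V b := fun {a b} ha h1 h2 => by
    have := h1.mul h2
    rwa [show a * (a * b) = b * a ^ 2 by ring, plus_mul_sq ha] at this
  unfold chi
  by_cases h1 : plus V ε
  · by_cases h3 : plus V η
    · rw [if_pos h1, if_pos h3, if_pos (h1.mul h3), mul_one]
    · rw [if_pos h1, if_neg h3, if_neg fun h4 => h3 (key hε h1 h4), one_mul]
  · by_cases h3 : plus V η
    · rw [if_neg h1, if_pos h3, if_neg fun h4 => h1 (key hη h3 (by rwa [mul_comm])), mul_one]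
    · rw [if_neg h1, if_neg h3, if_pos (plus_of_not F h2 hε hη h h' h1 h3)]; norm_num

theorem dens_psi (h2 : (2 : X) ≠ 0) {ε η : X} (hε : ∀ x, x ^ 2 ≠ ε) (hη : ∀ x, x ^ 2 ≠ η)
    (hεη : ∀ x, x ^ 2 ≠ ε * η) : Dens F (psi ε η) (1/2) := by
  have hε0 : ε ≠ 0 := fun h => hε 0 (by simp [h])
  have hη0 : η ≠ 0 := fun h => hη 0 (by simp [h])
  have d0 := (Dens.one F (X := X)).smul F (1/2)
  have d1 := (dens_chi F h2 ε hε).smul F (1/2)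
  have d2 := (dens_chi F h2 η hη).smul F (-1/2)
  have d3 := (dens_chi F h2 _ hεη).smul F (1/2)
  have a1 : ∀ V, |(1/2) * chi ε V| ≤ 1/2 := fun V => by
    rw [abs_mul]; have := abs_chi ε V; norm_num; linarith
  have a2 : ∀ V, |(-1/2) * chi η V| ≤ 1/2 := fun V => by
    rw [abs_mul]; have := abs_chi η V; norm_num; linarith
  have a3 : ∀ V, |(1/2) * chi (ε*η) V| ≤ 1/2 := fun V => by
    rw [abs_mul]; have := abs_chi (ε*η) V; norm_num; linarith
  have a0 : ∀ V : Place X, |(1/2 : ℝ) * 1| ≤ 1/2 := fun V => by norm_num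
  have e1 := d0.add F d1 a0 a1
  have b1 : ∀ V : Place X, |(1/2 : ℝ) * 1 + (1/2) * chi ε V| ≤ 1/2 + 1/2 := fun V => (abs_add_le _ _).trans (add_le_add (a0 V) (a1 V))
  have e2 := e1.add F d2 b1 a2
  have b2 : ∀ V : Place X, |(1/2 : ℝ) * 1 + (1/2) * chi ε V + (-1/2) * chi η V| ≤ 1/2 + 1/2 + 1/2 := fun V => (abs_add_le _ _).trans (add_le_add (b1 V) (a2 V))
  have e3 := e2.add F d3 b2 a3
  have b3 : ∀ V : Place X, |(1/2 : ℝ) * 1 + (1/2) * chi ε V + (-1/2) * chi η V + (1/2) * chi (ε * η) V| ≤ 1/2 + 1/2 + 1/2 + 1/2 := fun V => (abs_add_le _ _).trans (add_le_add (b2 V) (a3 V))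
  have e4 := e3.congr F (w' := psi ε η) (B' := 1) b3 (fun V => by rcases psi_pm ε η V with h | h <;> simp [h]) ?_
  · convert e4 using 1; norm_num
  · refine ((finite_bad F ε).union (finite_bad F η)).subset fun V hV => ?_
    by_contra h
    simp only [Set.mem_union, Set.mem_ofPred_eq, not_or, not_not] at h
    apply hV
    change (1/2 : ℝ) * 1 + (1/2) * chi ε V + (-1/2) * chi η V + (1/2) * chi (ε * η) V = _
    rw [chi_mul F h2 hε0 hη0 (by rw [h.1]; exact Even.zero) (by rw [h.2]; exact Even.zero)]
    unfold psi TT chi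
    by_cases h1 : plus V ε <;> by_cases h3 : plus V η <;> simp [h1, h3] <;> norm_num

theorem main_char (h2 : (2 : X) ≠ 0) {ε η : X} (hε : ∀ x, x ^ 2 ≠ ε) (hη : ∀ x, x ^ 2 ≠ η)
    (hεη : ∀ x, x ^ 2 ≠ ε * η) : ∃ ξ : X, ξ ≠ 0 ∧ Psi (psi ε η) (dv F ξ) ≠ 1 := by
  by_contra hcon
  push Not at hcon
  have hd := dens_psi F h2 hε hη hεη
  by_cases hV : ∃ V, psi ε η V = -1
  · obtain ⟨V, hV⟩ := hV
    have := hd.char F (psi_pm ε η) hcon V hV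
    norm_num at this
  · push Not at hV
    have h1 : psi ε η = fun _ => 1 := funext fun V => (psi_pm ε η V).resolve_right (hV V)
    rw [h1] at hd
    have h3 := hd.add F ((Dens.one F (X := X)).smul F (-1)) (B := 1) (B' := 1) (by simp) (by simp)
    norm_num at h3
    have := h3.zero F
    norm_num at this
end
end FF
end

section
open IntermediateField Polynomial
namespace FF
set_option linter.unusedSectionVars false
set_option linter.unusedVariables false

theorem pow_half {q d : ℕ} (hq : Odd q) : ∃ k, q ^ d / 2 = (q / 2) * k ∧ (Even k ↔ Even d) := by
  refine ⟨∑ i ∈ Finset.range d, q ^ i, ?_, ?_⟩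
  · obtain ⟨m, rfl⟩ := hq
    have h1 : (∑ i ∈ Finset.range d, (2 * m + 1) ^ i) * (2 * m) + 1 = (2 * m + 1) ^ d := by
      induction d with
      | zero => simp
      | succ n ih => rw [Finset.sum_range_succ, add_mul, pow_succ, ← ih]; ring
    rw [← h1, show (2 * m + 1) / 2 = m by omega]
    rw [show (∑ i ∈ Finset.range d, (2 * m + 1) ^ i) * (2 * m) = 2 * (m * ∑ i ∈ Finset.range d, (2 * m + 1) ^ i) by ring]
    omega
  · induction d with
    | zero => simp
    | succ n ih =>
      rw [Finset.sum_range_succ, Nat.even_add, ih, Nat.even_add_one]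
      have : ¬ Even (q ^ n) := Nat.not_even_iff_odd.2 hq.pow
      tauto

section
variable (F : Type*) {X : Type*} [Field F] [Field X] [Algebra F X] [Finite F] [GFF F X]
include F

theorem plus_const (hF : Odd (Nat.card F)) {e : F} (he : ¬ IsSquare e) (V : Place X) :
    plus V (algebraMap F X e) ↔ Even (V.deg F) := by
  classical
  have he0 : e ≠ 0 := by rintro rfl; exact he ⟨0, by simp⟩
  have heX : algebraMap F X e ≠ 0 := by simpa using he0
  have hA : algebraMap F X e ∈ V.A := V.mem_iff.2 ((V.G_iff heX).2 (by rw [Place.ord_algebraMap F V]))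
  rw [plus_iff_isSquare heX (Place.ord_algebraMap F V e) hA]
  have h1 : IsLocalRing.residue V.A ⟨algebraMap F X e, hA⟩ = algebraMap F V.res e := rfl
  rw [h1]
  have := Place.finite_res' F V
  have := Fintype.ofFinite V.res
  have := Fintype.ofFinite F
  have hc := Place.card_res F V
  have hchar : ringChar F ≠ 2 := by
    intro h
    have := FiniteField.even_card_of_char_two h
    rw [Nat.card_eq_fintype_card] at hF
    rw [Nat.odd_iff] at hF; omega
  have hchar' : ringChar V.res ≠ 2 := by
    intro h
    have := FiniteField.even_card_of_char_two h
    rw [← Nat.card_eq_fintype_card, hc] at this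
    have h3 := hF.pow (n := V.deg F)
    rw [Nat.odd_iff] at h3; omega
  rw [FiniteField.isSquare_iff hchar' (by simpa using he0), ← Nat.card_eq_fintype_card, hc]
  obtain ⟨k, hk, hk'⟩ := pow_half (d := V.deg F) hF
  have hm : e ^ (Nat.card F / 2) = -1 := by
    rw [Nat.card_eq_fintype_card]
    refine (FiniteField.pow_dichotomy hchar he0).resolve_left fun h => he ?_
    rwa [FiniteField.isSquare_iff hchar he0]
  rw [hk, pow_mul, ← map_pow, hm, map_neg, map_one, ← hk']
  rcases Nat.even_or_odd k with h | h
  · simp [h]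
  · rw [h.neg_one_pow]
    simp only [Nat.not_even_iff_odd.2 h, iff_false]
    exact Ring.neg_one_ne_one_of_char_ne_two hchar'

theorem exists_plus (h2 : (2 : X) ≠ 0) {ε : X} (hε : ∀ x, x ^ 2 ≠ ε) : ∃ V, plus V ε := by
  by_contra h
  push Not at h
  have h1 : chi ε = fun _ => -1 := funext fun V => if_neg (h V)
  have hd := dens_chi F h2 ε hε
  rw [h1] at hd
  have h3 := (hd.add F (Dens.one F (X := X)) (B := 1) (B' := 1) (by simp) (by simp))
  norm_num at h3
  have := h3.zero F
  norm_num at this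

theorem exists_eta (h2 : (2 : X) ≠ 0) {ε : X} (hε : ∀ x, x ^ 2 ≠ ε) :
    ∃ x y : X, ∃ V : Place X, x ^ 2 - ε * y ^ 2 ≠ 0 ∧ Odd (V.ord (x ^ 2 - ε * y ^ 2)) := by
  obtain ⟨V, c, hc⟩ := exists_plus F h2 hε
  have hne : 1 - ε * c ^ 2 ≠ 0 := by
    intro h
    have h1 : ε * c ^ 2 = 1 := (sub_eq_zero.1 h).symm
    have hc0 : c ≠ 0 := by rintro rfl; simp at h1
    apply hε c⁻¹
    field_simp
    rw [mul_comm]; exact h1.symm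
  have h1 : V.G 1 (1 - ε * c ^ 2) := by rw [← neg_sub]; exact V.G_neg hc
  rw [V.G_iff hne] at h1
  by_cases ho : Odd (V.ord (1 - ε * c ^ 2))
  · exact ⟨1, c, V, by simpa using hne, by simpa using ho⟩
  · refine ⟨1 + V.pi, c, V, ?_⟩
    have h3 : 2 ≤ V.ord (1 - ε * c ^ 2) := by
      by_contra h
      exact ho ⟨0, by omega⟩
    have h4 : (1 + V.pi) ^ 2 - ε * c ^ 2 = 2 * V.pi + (V.pi ^ 2 + (1 - ε * c ^ 2)) := by ring
    have h5 : V.ord (2 * V.pi) = 1 := by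
      rw [V.ord_mul h2 V.pi_ne, ord_two F h2, V.ord_pi]; norm_num
    have h6 := V.ord_add_eq (x := 2 * V.pi) (y := V.pi ^ 2 + (1 - ε * c ^ 2)) (mul_ne_zero h2 V.pi_ne) (by
      rw [h5]
      refine V.G_add ((V.G_iff (pow_ne_zero _ V.pi_ne)).2 ?_) ((V.G_iff hne).2 (by omega))
      rw [V.ord_pow, V.ord_pi]; norm_num)
    rw [h4, h6.1, h5]
    exact ⟨h6.2, odd_one⟩

omit F in
/-- norm group -/
def NG (b : X) : Subgroup Xˣ where
  carrier := {u | ∃ x y : X, (u : X) = x ^ 2 - b * y ^ 2}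
  mul_mem' := by
    rintro u v ⟨x, y, h⟩ ⟨x', y', h'⟩
    refine ⟨x * x' + b * y * y', x * y' + y * x', ?_⟩
    rw [Units.val_mul, h, h']; ring
  one_mem' := ⟨1, 0, by simp⟩
  inv_mem' := by
    rintro u ⟨x, y, h⟩
    refine ⟨x / u, y / u, ?_⟩
    rw [Units.val_inv_eq_inv_val]
    have h0 : (u : X) ≠ 0 := u.ne_zero
    field_simp
    rw [h]

omit F in
theorem mem_NG {b : X} {u : Xˣ} : u ∈ NG b ↔ ∃ x y : X, (u : X) = x ^ 2 - b * y ^ 2 := Iff.rfl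

omit F in
/-- the big norm group -/
def Gam (ε η : X) : Subgroup Xˣ := NG ε ⊔ NG η ⊔ NG (ε * η)

omit F in
theorem mem_Gam {ε η : X} {u : Xˣ} : u ∈ Gam ε η ↔ ∃ a ∈ NG ε, ∃ b ∈ NG η, ∃ c ∈ NG (ε * η), a * b * c = u := by
  unfold Gam
  rw [Subgroup.mem_sup]
  constructor
  · rintro ⟨y, hy, c, hc, rfl⟩
    obtain ⟨a, ha, b, hb, rfl⟩ := Subgroup.mem_sup.1 hy
    exact ⟨a, ha, b, hb, c, hc, rfl⟩
  · rintro ⟨a, ha, b, hb, c, hc, rfl⟩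
    exact ⟨a * b, Subgroup.mem_sup.2 ⟨a, ha, b, hb, rfl⟩, c, hc, rfl⟩

/-- the character as a hom -/
noncomputable def phi (ε η : X) : Xˣ →* ℝ where
  toFun u := Psi (psi ε η) (dv F (u : X))
  map_one' := by
    have : dv F ((1 : Xˣ) : X) = 0 := by ext V; rw [dv_apply]; simp [V.ord_one]
    rw [this]; simp [Psi]
  map_mul' u v := by
    rw [Units.val_mul, dv_mul F u.ne_zero v.ne_zero, Psi_add]
    intro V; rcases psi_pm ε η V with h | h <;> simp [h]

theorem Psi_eq_one (ψ : Place X → ℝ) (z : X) (h : ∀ V, ψ V ^ V.ord z = 1) : Psi ψ (dv F z) = 1 := by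
  unfold Psi Finsupp.prod
  refine Finset.prod_eq_one fun V _ => ?_
  rw [dv_apply]; exact h V

theorem Psi_congr (ψ ψ' : Place X → ℝ) (z : X) (h : ∀ V, ψ V ^ V.ord z = ψ' V ^ V.ord z) :
    Psi ψ (dv F z) = Psi ψ' (dv F z) := by
  unfold Psi Finsupp.prod
  refine Finset.prod_congr rfl fun V _ => ?_
  rw [dv_apply]; exact h V

theorem Psi_degree (D : Place X →₀ ℤ) : Psi (fun V => (-1) ^ V.deg F) D = (-1) ^ degD F D := by
  classical
  induction D using Finsupp.induction_linear with
  | zero => simp [Psi]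
  | add D E hD hE =>
    rw [Psi_add _ (fun V => by simp), hD, hE, map_add, zpow_add₀ (by norm_num)]
  | single V n =>
    rw [Psi_single, degD_single, ← zpow_natCast, ← zpow_mul, mul_comm]

/-- standing hypotheses on ε and η -/
structure Good (ε η : X) : Prop where
  h2 : (2 : X) ≠ 0
  ε0 : ε ≠ 0
  η0 : η ≠ 0
  ord_ε : ∀ V : Place X, V.ord ε = 0
  deg : ∀ V : Place X, plus V ε ↔ Even (V.deg F)
  ev : ∀ V : Place X, ¬ plus V ε → Even (V.ord η)
  ns1 : ∀ x, x ^ 2 ≠ ε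
  ns2 : ∀ x, x ^ 2 ≠ η
  ns3 : ∀ x, x ^ 2 ≠ ε * η

theorem exists_good (hF : Odd (Nat.card F)) {e : F} (he : ∀ x : X, x ^ 2 ≠ algebraMap F X e) :
    ∃ η : X, Good F (algebraMap F X e) η := by
  have h2F : (2 : F) ≠ 0 := by
    intro h
    obtain ⟨m, hm⟩ := hF
    have h1 : Nat.card F • (1 : F) = 0 := card_nsmul_eq_zero'
    rw [hm, nsmul_eq_mul] at h1
    push_cast at h1
    rw [h] at h1
    simp at h1
  have h2 : (2 : X) ≠ 0 := by
    rw [← map_ofNat (algebraMap F X) 2]; simpa using h2F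
  have hns : ¬ IsSquare e := by
    rintro ⟨r, rfl⟩
    exact he (algebraMap F X r) (by rw [map_mul, sq])
  have he0 : algebraMap F X e ≠ 0 := fun h => he 0 (by simp [h])
  obtain ⟨x, y, V, h0, ho⟩ := exists_eta F h2 he
  refine ⟨x ^ 2 - algebraMap F X e * y ^ 2, h2, he0, h0, fun V => Place.ord_algebraMap F V e,
    plus_const F hF hns, fun V hV => even_of_not_plus he0 (by rw [Place.ord_algebraMap F V]; exact Even.zero) hV _ _, he, ?_, ?_⟩
  · intro z hz
    rw [← hz, V.ord_pow] at ho
    exact Int.not_even_iff_odd.2 ho (even_two_mul _)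
  · intro z hz
    have hz' := congrArg V.ord hz
    rw [V.ord_mul he0 h0, Place.ord_algebraMap F V, zero_add, V.ord_pow] at hz'
    rw [← hz'] at ho
    exact Int.not_even_iff_odd.2 ho (even_two_mul _)

theorem phi_Gam {ε η : X} (H : Good F ε η) {u : Xˣ} (hu : u ∈ Gam ε η) : phi F ε η u = 1 := by
  obtain ⟨a, ⟨xa, ya, ha⟩, b, ⟨xb, yb, hb⟩, c, ⟨xc, yc, hc⟩, rfl⟩ := mem_Gam.1 hu
  have ev : ∀ z : X, (∀ V, TT ε η V → Even (V.ord z)) → Psi (psi ε η) (dv F z) = 1 := fun z hz =>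
    Psi_eq_one F _ _ fun V => by
      unfold psi; split_ifs with h
      · exact (hz V h).neg_one_zpow
      · exact one_zpow _
  have h1 : phi F ε η a = 1 := ev a fun V hV => by
    rw [ha]; exact even_of_not_plus H.ε0 (by rw [H.ord_ε]; exact Even.zero) hV.1 _ _
  have h3 : phi F ε η c = 1 := ev c fun V hV => by
    rw [hc]
    refine even_of_not_plus (mul_ne_zero H.ε0 H.η0) ?_ ?_ _ _
    · rw [V.ord_mul H.ε0 H.η0, H.ord_ε, zero_add]; exact H.ev V hV.1
    · intro h
      have := hV.2.mul h
      rw [show η * (ε * η) = ε * η ^ 2 by ring, plus_mul_sq H.η0] at this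
      exact hV.1 this
  have h2 : phi F ε η b = 1 := by
    change Psi (psi ε η) (dv F (b : X)) = 1
    rw [Psi_congr F (psi ε η) (fun V => (-1) ^ V.deg F), Psi_degree, degD_dv, zpow_zero]
    intro V
    have hd := H.deg V
    by_cases hp : plus V ε
    · rw [psi, if_neg (fun h => h.1 hp), (hd.1 hp).neg_one_pow]
    · have hodd : Odd (V.deg F) := Nat.not_even_iff_odd.1 fun h => hp (hd.2 h)
      rw [hodd.neg_one_pow]
      by_cases hq : plus V η
      · rw [psi, if_pos ⟨hp, hq⟩]
      · have : Even (V.ord (b : X)) := by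
          rw [hb]; exact even_of_not_plus H.η0 (H.ev V hp) hq _ _
        rw [psi, if_neg (fun h => hq h.2), this.neg_one_zpow, one_zpow]
  rw [map_mul, map_mul, h1, h2, h3]; norm_num
end
end FF
end

section
open IntermediateField Polynomial
namespace FF
set_option linter.unusedSectionVars false
set_option linter.unusedVariables false

section
variable (F : Type*) {X Y : Type*} [Field F] [Field X] [Field Y] [Algebra F X] [Algebra F Y] [Algebra X Y]
  [IsScalarTower F X Y] [Finite F] [GFF F X] [GFF F Y] (Q : Quad X Y)
include Q F

theorem Quad.TT_iff {ε η : X} (H : Good F ε η) {W : Place Y} (hS : Q.Surj W) :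
    TT (algebraMap X Y ε) (algebraMap X Y η) W ↔ TT ε η (Q.rest F W) := by
  have h1 : plus W (algebraMap X Y ε) ↔ plus (Q.rest F W) ε :=
    ⟨fun h => Q.plus_down F hS (by rw [H.ord_ε]; exact Even.zero) h, fun h => Q.plus_up F h⟩
  unfold TT
  rw [h1]
  refine and_congr_right fun h => ?_
  exact ⟨fun h' => Q.plus_down F hS (H.ev _ h) h', fun h => Q.plus_up F h⟩

theorem Quad.psi_eq {ε η : X} (H : Good F ε η) {W : Place Y} (hS : Q.Surj W) :
    psi (algebraMap X Y ε) (algebraMap X Y η) W = psi ε η (Q.rest F W) := by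
  have h := Q.TT_iff F H hS
  unfold psi
  by_cases h' : TT ε η (Q.rest F W)
  · rw [if_pos h', if_pos (h.2 h')]
  · rw [if_neg h', if_neg (fun h1 => h' (h.1 h1))]

theorem Quad.plus_up' {a : X} (ha : a ≠ 0) {W : Place Y} (hea : Even ((Q.rest F W).ord a))
    (heb : Even ((Q.rest F W).ord Q.b)) (hb : ¬ plus (Q.rest F W) Q.b) : plus W (algebraMap X Y a) := by
  by_cases h : plus (Q.rest F W) a
  · exact Q.plus_up F h
  · have h1 := Q.plus_up F (plus_of_not F Q.h2 ha Q.hb hea heb h hb)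
    rwa [map_mul, ← Q.hs, plus_mul_sq Q.s_ne] at h1

theorem Quad.psi_fib {ε η : X} (H : Good F ε η) (V : Place X) {ξ : Y} (hξ : ξ ≠ 0) :
    ∏ W ∈ Q.fib F V, psi (algebraMap X Y ε) (algebraMap X Y η) W ^ W.ord ξ = psi ε η V ^ V.ord (Q.N ξ) := by
  classical
  obtain ⟨W, rfl⟩ := Q.exists_over F V
  rw [Q.fib_eq F (W := W) rfl]
  by_cases he : Even ((Q.rest F W).ord Q.b)
  · by_cases hp : plus (Q.rest F W) Q.b
    · have h1 := Q.conj_ne_of_plus F hp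
      have h1' : Q.conj F (Q.conj F W) ≠ Q.conj F W := by rw [Q.conj_conj F]; exact h1.symm
      rw [Finset.prod_pair h1.symm, Q.psi_eq F H (Q.surj_of_ne F h1), Q.psi_eq F H (Q.surj_of_ne F h1'),
        Q.rest_conj F, Q.ordN_of_ne F h1 hξ, zpow_add₀]
      rcases psi_pm ε η (Q.rest F W) with h | h <;> simp [h]
    · have h1 : ∀ U ∈ ({W, Q.conj F W} : Finset (Place Y)),
          psi (algebraMap X Y ε) (algebraMap X Y η) U ^ U.ord ξ = 1 := by
        intro U hU
        rw [← Q.fib_eq F (W := W) rfl, Q.mem_fib F] at hU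
        rw [← hU] at he hp
        have := Q.plus_up' F H.ε0 (by rw [H.ord_ε]; exact Even.zero) he hp
        rw [psi, if_neg (fun h => h.1 this), one_zpow]
      rw [Finset.prod_eq_one h1]
      obtain ⟨u, v, rfl⟩ := Q.rep ξ
      rw [Q.hN']
      have h2 := even_of_not_plus Q.hb he hp u v
      rcases psi_pm ε η (Q.rest F W) with h | h
      · rw [h, one_zpow]
      · rw [h, h2.neg_one_zpow]
  · have h1 := (Q.odd_aux F he).1
    rw [h1, Finset.pair_eq_singleton, Finset.prod_singleton, Q.psi_eq F H (Q.surj_of_odd F he), Q.ordN_of_odd F he hξ]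

theorem Quad.psi_N {ε η : X} (H : Good F ε η) {ξ : Y} (hξ : ξ ≠ 0) :
    Psi (psi (algebraMap X Y ε) (algebraMap X Y η)) (dv F ξ) = Psi (psi ε η) (dv F (Q.N ξ)) := by
  classical
  set S : Finset (Place X) := (dv F (Q.N ξ)).support ∪ (dv F ξ).support.image (Q.rest F) with hS
  have h1 : Psi (psi ε η) (dv F (Q.N ξ)) = ∏ V ∈ S, psi ε η V ^ V.ord (Q.N ξ) := by
    unfold Psi
    rw [Finsupp.prod_of_support_subset (s := S) _ Finset.subset_union_left _ (fun V _ => zpow_zero _)]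
    simp only [dv_apply]
  have h2 : Psi (psi (algebraMap X Y ε) (algebraMap X Y η)) (dv F ξ) =
      ∏ W ∈ S.biUnion (Q.fib F), psi (algebraMap X Y ε) (algebraMap X Y η) W ^ W.ord ξ := by
    unfold Psi
    rw [Finsupp.prod_of_support_subset (s := S.biUnion (Q.fib F)) _ ?_ _ (fun V _ => zpow_zero _)]
    · simp only [dv_apply]
    · intro W hW
      rw [Finset.mem_biUnion]
      exact ⟨Q.rest F W, Finset.mem_union_right _ (Finset.mem_image_of_mem _ hW), (Q.mem_fib F).2 rfl⟩
  rw [h1, h2, Finset.prod_biUnion]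
  · exact Finset.prod_congr rfl fun V _ => Q.psi_fib F H V hξ
  · intro V _ V' _ hne
    rw [Function.onFun, Finset.disjoint_left]
    intro W hW hW'
    rw [Q.mem_fib F] at hW hW'
    exact hne (hW.symm.trans hW')

theorem Quad.nonsq_up {a : X} (h : ∀ x, x ^ 2 ≠ a) (h' : ∀ x, x ^ 2 ≠ a * Q.b) (y : Y) : y ^ 2 ≠ algebraMap X Y a := by
  intro hy
  have hσ : (Q.σ y) ^ 2 = y ^ 2 := by rw [← map_pow, hy, Q.σX]
  rcases sq_eq_sq_iff_eq_or_eq_neg.1 hσ with h1 | h1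
  · obtain ⟨u, v, rfl⟩ := Q.rep y
    have h2 : algebraMap X Y v * Q.s = 0 := by
      have h3 : (2 : Y) * (algebraMap X Y v * Q.s) = 0 := by
        simp only [map_add, map_mul, Q.σX, Q.σs] at h1
        linear_combination -h1
      exact (mul_eq_zero.1 h3).resolve_left Q.two_ne
    rw [h2, add_zero, ← map_pow] at hy
    exact h u ((algebraMap X Y).injective hy)
  · obtain ⟨u, v, rfl⟩ := Q.rep y
    have h2 : algebraMap X Y u = 0 := by
      have h3 : (2 : Y) * (algebraMap X Y u) = 0 := by
        simp only [map_add, map_mul, Q.σX, Q.σs] at h1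
        linear_combination h1
      exact (mul_eq_zero.1 h3).resolve_left Q.two_ne
    rw [h2, zero_add, mul_pow, Q.hs, ← map_pow, ← map_mul] at hy
    apply h' (v * Q.b)
    rw [← (algebraMap X Y).injective hy]; ring

omit Q in
theorem phi_apply (ε η : X) (u : Xˣ) : phi F ε η u = Psi (psi ε η) (dv F (u : X)) := rfl

theorem Quad.complete {ε η : X} (H : Good F ε η) (h1 : ∀ x, x ^ 2 ≠ ε * Q.b) (h2 : ∀ x, x ^ 2 ≠ η * Q.b)
    (h3 : ∀ x, x ^ 2 ≠ ε * η * Q.b) : ∃ u ∈ NG Q.b, u ∉ Gam ε η := by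
  obtain ⟨ξ, hξ, h⟩ := main_char F (X := Y) Q.two_ne (Q.nonsq_up F H.ns1 h1) (Q.nonsq_up F H.ns2 h2)
    (by rw [← map_mul]; exact Q.nonsq_up F H.ns3 h3)
  rw [Q.psi_N F H hξ] at h
  have h0 := Q.N_ne F hξ
  refine ⟨Units.mk0 _ h0, ?_, fun hG => h ?_⟩
  swap
  · have := phi_Gam F H hG
    rwa [phi_apply, Units.val_mk0] at this
  obtain ⟨u, v, rfl⟩ := Q.rep ξ
  exact ⟨u, v, by rw [Units.val_mk0, Q.hN']⟩
end

section
universe u v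
variable (F : Type v) {X : Type u} [Field F] [Field X] [Algebra F X] [Finite F] [GFF F X]
include F
theorem complete {ε η b : X} (H : Good F ε η) (h0 : ∀ x, x ^ 2 ≠ b) (h1 : ∀ x, x ^ 2 ≠ ε * b) (h2 : ∀ x, x ^ 2 ≠ η * b)
    (h3 : ∀ x, x ^ 2 ≠ ε * η * b) : ∃ u ∈ NG b, u ∉ Gam ε η := by
  obtain ⟨Y, _, _, _, _, _, Q, rfl⟩ := exists_quad F H.h2 b h0
  exact Q.complete F H h1 h2 h3
end
end FF
end

section
open IntermediateField Polynomial
namespace FF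
set_option linter.unusedSectionVars false
set_option linter.unusedVariables false

theorem finite_quot_of {G : Type*} [CommGroup G] (N : Submodule ℤ (Additive G)) (hN : N.FG) (Γ : Subgroup G)
    (hsq : ∀ g : G, g ^ 2 ∈ Γ) (hs : ∀ g : G, ∃ h : G, Additive.ofMul h ∈ N ∧ g⁻¹ * h ∈ Γ) : Finite (G ⧸ Γ) := by
  let π : Additive G →ₗ[ℤ] Additive (G ⧸ Γ) := (MonoidHom.toAdditive (QuotientGroup.mk' Γ)).toIntLinearMap
  have hπ : N.map π = ⊤ := by
    rw [eq_top_iff]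
    intro x _
    obtain ⟨g, hg0⟩ := QuotientGroup.mk_surjective (Additive.toMul x)
    obtain ⟨h, hh, hg⟩ := hs g
    refine ⟨Additive.ofMul h, hh, ?_⟩
    change Additive.ofMul (QuotientGroup.mk h : G ⧸ Γ) = _
    have hx : x = Additive.ofMul (QuotientGroup.mk g : G ⧸ Γ) := by rw [hg0]; rfl
    rw [hx, (QuotientGroup.eq (s := Γ)).2 hg]
  have hfg : Module.Finite ℤ (Additive (G ⧸ Γ)) := ⟨by rw [← hπ]; exact hN.map π⟩
  have : Finite (Additive (G ⧸ Γ)) := by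
    apply Module.finite_of_fg_torsion
    intro x
    refine ⟨⟨2, by simp⟩, ?_⟩
    obtain ⟨g, hg⟩ := QuotientGroup.mk_surjective (Additive.toMul x)
    change (2 : ℤ) • x = 0
    have : x = Additive.ofMul (QuotientGroup.mk g : G ⧸ Γ) := by rw [hg]; rfl
    rw [this, ofNat_zsmul, ← ofMul_pow, ← QuotientGroup.mk_pow, (QuotientGroup.eq_one_iff _).2 (hsq g)]; rfl
  exact this

section
variable (F : Type*) {X Y : Type*} [Field F] [Field X] [Field Y] [Algebra F X] [Algebra F Y] [Algebra X Y]
  [IsScalarTower F X Y] [Finite F] [GFF F X] [GFF F Y] (Q : Quad X Y)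
include Q F

theorem Quad.exists_norm : ∃ S : Set (Place X), S.Finite ∧ ∀ V, V ∉ S → plus V Q.b →
    ∃ u ∈ NG Q.b, V.ord (u : X) = 1 ∧ ∀ V', V' ∉ S → V' ≠ V → V'.ord (u : X) = 0 := by
  classical
  obtain ⟨γ, hγ⟩ := riemann_bound F (X := Y)
  obtain ⟨W0⟩ := exists_place F (X := Y)
  have hd0 := W0.deg_pos F
  set d0 : ℤ := (W0.deg F : ℤ) with hd0'
  have hd0p : 0 < d0 := by rw [hd0']; exact_mod_cast hd0
  set B : ℕ := (γ + d0).toNat with hB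
  set S0 : Set (Place Y) := insert W0 {W | W.deg F ≤ B} with hS0
  refine ⟨Q.rest F '' S0, ((finite_deg_le F B).insert _).image _, fun V hV hp => ?_⟩
  obtain ⟨W, rfl⟩ := Q.exists_over F V
  have hc := Q.conj_ne_of_plus F hp
  have hW : W ∉ S0 := fun h => hV ⟨W, h, rfl⟩
  have hcW : Q.conj F W ∉ S0 := fun h => hV ⟨_, h, Q.rest_conj F W⟩
  set n : ℤ := (γ + W.deg F) / d0 + 1 with hn
  have hn1 : γ + W.deg F < n * d0 := by
    have := Int.lt_ediv_add_one_mul_self (γ + W.deg F) hd0p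
    exact this
  have hn2 : n * d0 ≤ γ + W.deg F + d0 := by
    have := Int.ediv_mul_le (γ + W.deg F) hd0p.ne'
    rw [hn, add_mul]; linarith
  set D : Place Y →₀ ℤ := Finsupp.single W0 n - Finsupp.single W 1 with hD
  have hdD : degD F D = n * d0 - W.deg F := by
    rw [hD, map_sub, degD_single, degD_single, one_mul]
  have hell : 0 < ell F D := by
    have := hγ D
    omega
  obtain ⟨y, hy, hE⟩ := exists_pos F hell
  have hdE : degD F (D + dv F y) = n * d0 - W.deg F := by rw [map_add, degD_dv, add_zero, hdD]
  have hsm : ∀ U, U ∉ S0 → (D + dv F y) U = 0 := by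
    intro U hU
    by_contra h
    have h0 := hE U
    have h1 := le_degD F hE U
    rw [hdE] at h1
    apply hU
    right
    change U.deg F ≤ B
    have h2 : (1 : ℤ) ≤ (D + dv F y) U := by
      rw [Finsupp.coe_zero, Pi.zero_apply] at h0; omega
    have h3 : (U.deg F : ℤ) ≤ (D + dv F y) U * U.deg F := le_mul_of_one_le_left (by positivity) h2
    omega
  have hord : ∀ U, U ∉ S0 → U.ord y = if U = W then 1 else 0 := by
    intro U hU
    have h1 := hsm U hU
    have h2 : W0 ≠ U := fun h => hU (by left; exact h.symm)
    rw [Finsupp.add_apply, dv_apply, hD, Finsupp.sub_apply, Finsupp.single_eq_of_ne' h2, zero_sub, Finsupp.single_apply] at h1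
    simp only [eq_comm (a := W)] at h1
    linarith
  have hN0 := Q.N_ne F hy
  refine ⟨Units.mk0 _ hN0, ?_, ?_, ?_⟩
  · obtain ⟨u, v, rfl⟩ := Q.rep y
    exact ⟨u, v, by rw [Units.val_mk0, Q.hN']⟩
  · rw [Units.val_mk0, Q.ordN_of_ne F hc hy, hord W hW, hord _ hcW, if_pos rfl, if_neg hc]; rfl
  · intro V' hV' hne
    obtain ⟨U, rfl⟩ := Q.exists_over F V'
    have hU : U ∉ S0 := fun h => hV' ⟨U, h, rfl⟩
    have hcU : Q.conj F U ∉ S0 := fun h => hV' ⟨_, h, Q.rest_conj F U⟩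
    have h1 : U ≠ W := fun h => hne (by rw [h])
    have h2 : Q.conj F U ≠ W := fun h => hne (by rw [← Q.rest_conj F U, h])
    obtain ⟨e, he, ho⟩ := (Q.rest_lies F U).ord
    have h3 := ho (Q.N y)
    rw [Q.hN, U.ord_mul hy (by simpa using hy), ← Q.conj_ord F, hord U hU, hord _ hcU, if_neg h1, if_neg h2, add_zero] at h3
    rw [Units.val_mk0]
    exact (mul_eq_zero.1 h3.symm).resolve_left he.ne'
end

section
universe u v
variable (F : Type v) {X : Type u} [Field F] [Field X] [Algebra F X] [Finite F] [GFF F X]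
include F

theorem exists_norm (h2 : (2 : X) ≠ 0) (b : X) (hb : ∀ x, x ^ 2 ≠ b) :
    ∃ S : Set (Place X), S.Finite ∧ ∀ V, V ∉ S → plus V b →
    ∃ u ∈ NG b, V.ord (u : X) = 1 ∧ ∀ V', V' ∉ S → V' ≠ V → V'.ord (u : X) = 0 := by
  obtain ⟨Y, _, _, _, _, _, Q, rfl⟩ := exists_quad F h2 b hb
  exact Q.exists_norm F

theorem exists_gam {ε η : X} (H : Good F ε η) : ∃ S : Set (Place X), S.Finite ∧ ∀ V, V ∉ S →
    ∃ u ∈ Gam ε η, V.ord (u : X) = 1 ∧ ∀ V', V' ∉ S → V' ≠ V → V'.ord (u : X) = 0 := by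
  obtain ⟨S1, f1, h1⟩ := exists_norm F H.h2 _ H.ns1
  obtain ⟨S2, f2, h2⟩ := exists_norm F H.h2 _ H.ns2
  obtain ⟨S3, f3, h3⟩ := exists_norm F H.h2 _ H.ns3
  have l1 : NG ε ≤ Gam ε η := le_sup_left.trans le_sup_left
  have l2 : NG η ≤ Gam ε η := le_sup_right.trans le_sup_left
  have l3 : NG (ε * η) ≤ Gam ε η := le_sup_right
  refine ⟨S1 ∪ S2 ∪ S3 ∪ {V | ¬ V.ord η = 0}, ((f1.union f2).union f3).union (finite_bad F η), fun V hV => ?_⟩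
  simp only [Set.mem_union, not_or, Set.mem_ofPred_eq, not_not] at hV ⊢
  obtain ⟨⟨⟨v1, v2⟩, v3⟩, v4⟩ := hV
  by_cases p1 : plus V ε
  · obtain ⟨u, hu, ho, hz⟩ := h1 V v1 p1
    exact ⟨u, l1 hu, ho, fun V' hV' => hz V' hV'.1.1.1⟩
  by_cases p2 : plus V η
  · obtain ⟨u, hu, ho, hz⟩ := h2 V v2 p2
    exact ⟨u, l2 hu, ho, fun V' hV' => hz V' hV'.1.1.2⟩
  have p3 : plus V (ε * η) := plus_of_not F H.h2 H.ε0 H.η0 (by rw [H.ord_ε]; exact Even.zero) (by rw [v4]; exact Even.zero) p1 p2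
  obtain ⟨u, hu, ho, hz⟩ := h3 V v3 p3
  exact ⟨u, l3 hu, ho, fun V' hV' => hz V' hV'.1.2⟩

omit F in
/-- order as a linear map -/
noncomputable def ordHom (V : Place X) : Additive Xˣ →ₗ[ℤ] ℤ :=
  AddMonoidHom.toIntLinearMap
  { toFun := fun u => V.ord ((Additive.toMul u : Xˣ) : X)
    map_zero' := V.ord_one
    map_add' := fun u v => V.ord_mul (Units.ne_zero _) (Units.ne_zero _) }

omit F in
theorem ordHom_apply (V : Place X) (u : Xˣ) : ordHom V (Additive.ofMul u) = V.ord (u : X) := rfl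

theorem fg_units (S : Set (Place X)) (hS : S.Finite) :
    (⨅ V : {V : Place X // V ∉ S}, LinearMap.ker (ordHom (V : Place X))).FG := by
  have := hS.to_subtype
  let f : Additive Xˣ →ₗ[ℤ] (S → ℤ) := LinearMap.pi fun V => ordHom (V : Place X)
  apply Submodule.fg_of_fg_map_of_fg_inf_ker f
  · exact IsNoetherian.noetherian _
  · rw [Submodule.fg_def]
    refine ⟨_, ?_, Submodule.span_eq _⟩
    have : Finite (Ls F (0 : Place X →₀ ℤ)) := Module.finite_of_finite F
    have hfin : ((Ls F (0 : Place X →₀ ℤ) : Submodule F X) : Set X).Finite := Set.toFinite _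
    refine (hfin.preimage (f := fun u : Additive Xˣ => ((Additive.toMul u : Xˣ) : X)) ?_).subset ?_
    · intro a _ b _ h
      exact Units.ext h
    · intro u hu
      obtain ⟨h1, h2⟩ := Submodule.mem_inf.1 hu
      rw [Submodule.mem_iInf] at h1
      rw [LinearMap.mem_ker] at h2
      refine mem_Ls.2 fun V => ?_
      rw [V.G_iff (Units.ne_zero _)]
      have : V.ord ((Additive.toMul u : Xˣ) : X) = 0 := by
        by_cases hV : V ∈ S
        · exact congrFun h2 ⟨V, hV⟩
        · exact h1 ⟨V, hV⟩
      rw [this]; simp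

theorem finite_index {ε η : X} (H : Good F ε η) : Finite (Xˣ ⧸ Gam ε η) := by
  classical
  obtain ⟨S, hS, h⟩ := exists_gam F H
  refine finite_quot_of _ (fg_units F S hS) _ (fun g => ?_) fun g => ?_
  · exact (le_sup_left.trans le_sup_left : NG ε ≤ Gam ε η) ⟨g, 0, by simp⟩
  · choose! t ht ho hz using h
    set P := (dv F (g : X)).support.filter (fun V => V ∉ S) with hP
    set γ : Xˣ := ∏ V ∈ P, t V ^ (- V.ord (g : X)) with hγ
    have hγG : γ ∈ Gam ε η := Subgroup.prod_mem _ fun V hV => Subgroup.zpow_mem _ (ht V (Finset.mem_filter.1 hV).2) _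
    refine ⟨g * γ, ?_, by simpa using hγG⟩
    rw [Submodule.mem_iInf]
    rintro ⟨V, hV⟩
    rw [LinearMap.mem_ker, ofMul_mul, map_add, ordHom_apply, hγ, ofMul_prod, map_sum]
    have h1 : ∀ U ∈ P, ordHom V (Additive.ofMul (t U ^ (-U.ord (g : X)))) = if U = V then - V.ord (g : X) else 0 := by
      intro U hU
      have hUS := (Finset.mem_filter.1 hU).2
      rw [ofMul_zpow, map_zsmul, ordHom_apply]
      split_ifs with hUV
      · subst hUV; rw [ho U hUS]; simp
      · rw [hz U hUS V hV (Ne.symm hUV), smul_zero]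
    rw [Finset.sum_congr rfl h1, Finset.sum_ite_eq']
    split_ifs with hVP
    · simp
    · have : V.ord (g : X) = 0 := by
        by_contra h0
        exact hVP (Finset.mem_filter.2 ⟨by rw [Finsupp.mem_support_iff, dv_apply]; exact h0, hV⟩)
      rw [this]; simp
end
end FF
end

section
open IntermediateField Polynomial
namespace FF
set_option linter.unusedSectionVars false
set_option linter.unusedVariables false

section
variable {X : Type*} [Field X]

theorem aniso_iff (a : Fin 2 → X) :
    (∀ x : Fin 2 → X, a 0 * x 0 ^ 2 + a 1 * x 1 ^ 2 = 0 → x = 0) ↔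
      (- (a 0 * a 1) ≠ 0 ∧ ∀ z, z ^ 2 ≠ - (a 0 * a 1)) := by
  constructor
  · intro h
    have ha0 : a 0 ≠ 0 := by
      intro h0
      have := congrFun (h ![1, 0] (by simp [h0])) 0
      simp at this
    have ha1 : a 1 ≠ 0 := by
      intro h0
      have := congrFun (h ![0, 1] (by simp [h0])) 1
      simp at this
    refine ⟨neg_ne_zero.2 (mul_ne_zero ha0 ha1), fun z hz => ?_⟩
    have := congrFun (h ![z, a 0] (by simp [hz]; ring)) 1
    simp at this
    exact ha0 this
  · rintro ⟨h0, h1⟩ x hx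
    have ha0 : a 0 ≠ 0 := fun h => h0 (by simp [h])
    by_cases hx1 : x 1 = 0
    · have hx0 : x 0 = 0 := by
        rw [hx1] at hx
        simpa [ha0] using hx
      funext i
      fin_cases i
      · exact hx0
      · exact hx1
    · exfalso
      apply h1 (a 0 * x 0 / x 1)
      rw [div_pow, div_eq_iff (pow_ne_zero 2 hx1)]
      linear_combination a 0 * hx

/-- no nontrivial zeros of the norm form -/
theorem norm_zero {ε : X} (hε : ∀ x, x ^ 2 ≠ ε) {x y : X} (h : x ^ 2 - ε * y ^ 2 = 0) : x = 0 ∧ y = 0 := by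
  by_cases hy : y = 0
  · subst hy
    exact ⟨by simpa using h, rfl⟩
  · exfalso
    apply hε (x / y)
    rw [div_pow, div_eq_iff (pow_ne_zero 2 hy)]
    linear_combination h

/-- the norm value product -/
def P6 (ε η : X) (x : Fin 9 → X) : X :=
  (x 0 ^ 2 - ε * x 1 ^ 2) * (x 2 ^ 2 - η * x 3 ^ 2) * (x 4 ^ 2 - ε * η * x 5 ^ 2)
end

section
universe u v
variable (F : Type v) {X : Type u} [Field F] [Field X] [Algebra F X] [Finite F] [GFF F X]
include F

theorem char_formula {ε η : X} (H : Good F ε η) (d : X) :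
    (d ≠ 0 ∧ ∀ z, z ^ 2 ≠ d) ↔
      ∃ x : Fin 9 → X, (d * x 8 ^ 2 = ε ∨ d * x 8 ^ 2 = η ∨ d * x 8 ^ 2 = ε * η) ∨
        ∃ q : Xˣ ⧸ Gam ε η, q ≠ 1 ∧ ((q.out : Xˣ) : X) * P6 ε η x = x 6 ^ 2 - ε * d * x 7 ^ 2 ∧
          P6 ε η x * d * x 8 = 1 := by
  constructor
  · rintro ⟨hd, hn⟩
    by_cases h1 : ∃ w, d * w ^ 2 = ε
    · obtain ⟨w, hw⟩ := h1
      exact ⟨fun _ => w, Or.inl (Or.inl hw)⟩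
    by_cases h2 : ∃ w, d * w ^ 2 = η
    · obtain ⟨w, hw⟩ := h2
      exact ⟨fun _ => w, Or.inl (Or.inr (Or.inl hw))⟩
    by_cases h3 : ∃ w, d * w ^ 2 = ε * η
    · obtain ⟨w, hw⟩ := h3
      exact ⟨fun _ => w, Or.inl (Or.inr (Or.inr hw))⟩
    push Not at h1 h2 h3
    have hε := H.ε0
    have hη := H.η0
    obtain ⟨u, hu, huG⟩ := complete F H (b := ε * d)
      (fun x hx => h1 (x / d) (by field_simp; linear_combination hx))
      (fun x hx => hn (x / ε) (by field_simp; linear_combination hx))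
      (fun x hx => h3 (x / d) (by field_simp; linear_combination hx))
      (fun x hx => h2 (x / (ε * d)) (by field_simp; linear_combination hx))
    set q : Xˣ ⧸ Gam ε η := QuotientGroup.mk u with hq
    have hg : u⁻¹ * q.out ∈ Gam ε η := QuotientGroup.eq.1 (QuotientGroup.out_eq' q).symm
    have hg' : q.out⁻¹ * u ∈ Gam ε η := by
      have := (Gam ε η).inv_mem hg
      simpa using this
    obtain ⟨a, ⟨a1, a2, ha⟩, b, ⟨b1, b2, hb⟩, c, ⟨c1, c2, hc⟩, habc⟩ := mem_Gam.1 hg'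
    obtain ⟨u1, u2, hu⟩ := hu
    have hP : (a1 ^ 2 - ε * a2 ^ 2) * (b1 ^ 2 - η * b2 ^ 2) * (c1 ^ 2 - ε * η * c2 ^ 2) = ((q.out⁻¹ * u : Xˣ) : X) := by
      rw [← habc, ← ha, ← hb, ← hc]; simp
    refine ⟨![a1, a2, b1, b2, c1, c2, u1, u2, (((q.out⁻¹ * u : Xˣ) : X) * d)⁻¹], Or.inr ⟨q, ?_, ?_, ?_⟩⟩
    · rw [hq, Ne, QuotientGroup.eq_one_iff]; exact huG
    · change _ * ((a1 ^ 2 - ε * a2 ^ 2) * (b1 ^ 2 - η * b2 ^ 2) * (c1 ^ 2 - ε * η * c2 ^ 2)) = u1 ^ 2 - ε * d * u2 ^ 2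
      rw [hP, ← hu, ← Units.val_mul, mul_inv_cancel_left]
    · change ((a1 ^ 2 - ε * a2 ^ 2) * (b1 ^ 2 - η * b2 ^ 2) * (c1 ^ 2 - ε * η * c2 ^ 2)) * d * _ = 1
      rw [hP]
      exact mul_inv_cancel₀ (mul_ne_zero (Units.ne_zero _) hd)
  · rintro ⟨x, h | ⟨q, hq, h1, h2⟩⟩
    · have key : ∀ θ : X, θ ≠ 0 → (∀ z, z ^ 2 ≠ θ) → d * x 8 ^ 2 = θ → (d ≠ 0 ∧ ∀ z, z ^ 2 ≠ d) := by
        intro θ h0 hn h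
        refine ⟨fun hd => h0 (by rw [← h, hd, zero_mul]), fun z hz => hn (z * x 8) (by rw [mul_pow, hz, h])⟩
      rcases h with h | h | h
      · exact key _ H.ε0 H.ns1 h
      · exact key _ H.η0 H.ns2 h
      · exact key _ (mul_ne_zero H.ε0 H.η0) H.ns3 h
    · have hd : d ≠ 0 := by rintro rfl; simp at h2
      have hP : P6 ε η x ≠ 0 := by intro h; rw [h] at h2; simp at h2
      refine ⟨hd, fun z hz => hq ?_⟩
      have hP' := hP
      rw [P6] at hP'
      obtain ⟨hAB, hC⟩ := mul_ne_zero_iff.1 hP'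
      obtain ⟨hA, hB⟩ := mul_ne_zero_iff.1 hAB
      have hG : Units.mk0 _ hP ∈ Gam ε η :=
        mem_Gam.2 ⟨Units.mk0 _ hA, ⟨_, _, rfl⟩, Units.mk0 _ hB, ⟨_, _, rfl⟩, Units.mk0 _ hC, ⟨_, _, rfl⟩, Units.ext rfl⟩
      have hG2 : q.out * Units.mk0 _ hP ∈ Gam ε η := by
        refine (le_sup_left.trans le_sup_left : NG ε ≤ Gam ε η) ⟨x 6, z * x 7, ?_⟩
        rw [Units.val_mul, Units.val_mk0, h1, ← hz]; ring
      have hG3 : q.out ∈ Gam ε η := ((Gam ε η).mul_mem_cancel_right hG).1 hG2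
      rw [← (QuotientGroup.eq_one_iff _).2 hG3]
      exact (QuotientGroup.out_eq' q).symm

theorem dioph_of_good {ε η : X} (H : Good F ε η) :
    ∃ (m : ℕ) (f : MvPolynomial (Fin 2 ⊕ Fin m) X), ∀ a : Fin 2 → X,
      a ∈ {a : Fin 2 → X | ∀ x : Fin 2 → X, a 0 * x 0 ^ 2 + a 1 * x 1 ^ 2 = 0 → x = 0} ↔
        ∃ x : Fin m → X, MvPolynomial.eval (Sum.elim a x) f = 0 := by
  classical
  have := finite_index F H
  have := Fintype.ofFinite (Xˣ ⧸ Gam ε η)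
  let d : MvPolynomial (Fin 2 ⊕ Fin 9) X := - (MvPolynomial.X (Sum.inl 0) * MvPolynomial.X (Sum.inl 1))
  let v : Fin 9 → MvPolynomial (Fin 2 ⊕ Fin 9) X := fun i => MvPolynomial.X (Sum.inr i)
  let k : X → MvPolynomial (Fin 2 ⊕ Fin 9) X := fun c => MvPolynomial.C c
  let P : MvPolynomial (Fin 2 ⊕ Fin 9) X :=
    (v 0 ^ 2 - k ε * v 1 ^ 2) * (v 2 ^ 2 - k η * v 3 ^ 2) * (v 4 ^ 2 - k ε * k η * v 5 ^ 2)
  let f : MvPolynomial (Fin 2 ⊕ Fin 9) X :=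
    (d * v 8 ^ 2 - k ε) * (d * v 8 ^ 2 - k η) * (d * v 8 ^ 2 - k ε * k η) *
      ∏ q ∈ Finset.univ.filter (fun q : Xˣ ⧸ Gam ε η => q ≠ 1),
        ((k (q.out : Xˣ) * P - (v 6 ^ 2 - k ε * d * v 7 ^ 2)) ^ 2 - k ε * (P * d * v 8 - 1) ^ 2)
  refine ⟨9, f, fun a => ?_⟩
  rw [Set.mem_ofPred_eq, aniso_iff, char_formula F H]
  refine exists_congr fun x => ?_
  have hd : MvPolynomial.eval (Sum.elim a x) d = - (a 0 * a 1) := by simp [d]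
  have hv : ∀ i, MvPolynomial.eval (Sum.elim a x) (v i) = x i := fun i => by simp [v]
  have hk : ∀ c, MvPolynomial.eval (Sum.elim a x) (k c) = c := fun c => by simp [k]
  have hP : MvPolynomial.eval (Sum.elim a x) P = P6 ε η x := by simp only [P, P6, map_mul, map_sub, map_pow, hv, hk]
  simp only [f, map_mul, map_sub, map_pow, map_prod, map_one, hv, hk, hd, hP, mul_eq_zero, sub_eq_zero (b := ε),
    sub_eq_zero (b := η), sub_eq_zero (b := ε * η), Finset.prod_eq_zero_iff, Finset.mem_filter, Finset.mem_univ, true_and, or_assoc]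
  refine or_congr Iff.rfl (or_congr Iff.rfl (or_congr Iff.rfl (exists_congr fun q => and_congr Iff.rfl ?_)))
  constructor
  · rintro ⟨h1, h2⟩
    rw [h1, h2]; ring
  · intro h
    obtain ⟨h1, h2⟩ := norm_zero H.ns1 h
    exact ⟨sub_eq_zero.1 h1, sub_eq_zero.1 h2⟩
end

section
universe u v
variable (F : Type v) {X : Type u} [Field F] [Field X] [Algebra F X] [Finite F] [GFF F X]

theorem dioph_main (hF : Odd (Nat.card F)) :
    ∃ (m : ℕ) (f : MvPolynomial (Fin 2 ⊕ Fin m) X), ∀ a : Fin 2 → X,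
      a ∈ {a : Fin 2 → X | ∀ x : Fin 2 → X, a 0 * x 0 ^ 2 + a 1 * x 1 ^ 2 = 0 → x = 0} ↔
        ∃ x : Fin m → X, MvPolynomial.eval (Sum.elim a x) f = 0 := by
  let k := algebraicClosure F X
  have hfin : Finite k := by
    have : Finite (Ls F (0 : Place X →₀ ℤ)) := Module.finite_of_finite F
    have hfin : ((Ls F (0 : Place X →₀ ℤ) : Submodule F X) : Set X).Finite := Set.toFinite _
    refine (hfin.subset (t := (k : Set X)) fun x hx => mem_Ls.2 fun V => ?_).to_subtype
    by_cases h0 : x = 0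
    · rw [h0]; exact ((Ls F (0 : Place X →₀ ℤ)).zero_mem : _) V
    · rw [V.G_iff h0, ord_of_alg F (mem_algebraicClosure_iff.1 hx)]; simp
  have hG : GFF k X := by
    refine ⟨?_, ?_⟩
    · have := GFF.ess (F := F) (X := X)
      exact Algebra.EssFiniteType.of_comp F k X
    · have h1 := lift_trdeg_add_eq F k X
      rw [_root_.trdeg_eq_zero, GFF.trdeg (F := F) (X := X)] at h1
      simpa using h1
  have hodd : Odd (Nat.card k) := by
    rw [Module.natCard_eq_pow_finrank (K := F) (V := k)]
    exact hF.pow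
  have hc : ringChar k ≠ 2 := by
    have := Fintype.ofFinite k
    rw [Nat.card_eq_fintype_card, Nat.odd_iff] at hodd
    intro h
    have := FiniteField.even_card_of_char_two h
    omega
  obtain ⟨e, he⟩ := FiniteField.exists_nonsquare hc
  obtain ⟨η, H⟩ := exists_good (X := X) k hodd (e := e) (by
    intro x hx
    have hxa : x ∈ k := by
      refine mem_algebraicClosure_iff.2 ?_
      have h1 : IsAlgebraic F (x ^ 2) := by rw [hx]; exact mem_algebraicClosure_iff.1 e.2
      exact h1.of_pow two_pos
    exact he ⟨⟨x, hxa⟩, Subtype.ext (by rw [← sq]; exact hx.symm)⟩)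
  exact dioph_of_good k H
end

theorem dioph_ff (Fq K : Type*) [Field Fq] [Fintype Fq] [Field K] [Algebra (RatFunc Fq) K]
    [FunctionField Fq K] (hq : Odd (Fintype.card Fq)) :
    ∃ (m : ℕ) (f : MvPolynomial (Fin 2 ⊕ Fin m) K), ∀ a : Fin 2 → K,
      a ∈ {a : Fin 2 → K | ∀ x : Fin 2 → K, a 0 * x 0 ^ 2 + a 1 * x 1 ^ 2 = 0 → x = 0} ↔
        ∃ x : Fin m → K, MvPolynomial.eval (Sum.elim a x) f = 0 := by
  let _ : Algebra Fq K := ((algebraMap (RatFunc Fq) K).comp (algebraMap Fq (RatFunc Fq))).toAlgebra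
  have : IsScalarTower Fq (RatFunc Fq) K := IsScalarTower.of_algebraMap_eq' rfl
  have hfd : Module.Finite (RatFunc Fq) K := inferInstanceAs (FiniteDimensional (RatFunc Fq) K)
  have hG : GFF Fq K := by
    refine ⟨?_, ?_⟩
    · have h1 : Algebra.EssFiniteType Fq[X] (RatFunc Fq) := .of_isLocalization _ (nonZeroDivisors Fq[X])
      have h2 : Algebra.EssFiniteType Fq (RatFunc Fq) := .comp Fq Fq[X] _
      exact .comp Fq (RatFunc Fq) K
    · have h1 := lift_trdeg_add_eq Fq (RatFunc Fq) K
      have h2 := trdeg_add_eq Fq Fq[X] (A := RatFunc Fq)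
      have : Algebra.IsAlgebraic Fq[X] (RatFunc Fq) := IsLocalization.isAlgebraic _ (nonZeroDivisors Fq[X])
      rw [Polynomial.trdeg_of_isDomain, _root_.trdeg_eq_zero] at h2
      rw [← h2, _root_.trdeg_eq_zero] at h1
      simpa using h1.symm
  exact dioph_main Fq (by rwa [Nat.card_eq_fintype_card])
end FF
end

/-- Over a global function field `K` of odd characteristic, the set of pairs
`(a₁, a₂) ∈ K²` such that `a₁x₁² + a₂x₂² = 0` has only the trivial solution is
diophantine over `K`. -/
theorem binary_anisotropic_diophantine_functionField
    (Fq K : Type*) [Field Fq] [Fintype Fq] [Field K] [Algebra (RatFunc Fq) K]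
    [FunctionField Fq K] (hq : Odd (Fintype.card Fq)) :
    IsDiophantine {a : Fin 2 → K |
      ∀ x : Fin 2 → K, a 0 * x 0 ^ 2 + a 1 * x 1 ^ 2 = 0 → x = 0} :=
  FF.dioph_ff Fq K hq
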